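/- Let A be a commutative noetherian local ring, C a semidualizing A-module, and Y a nonzero finitely generated A-module of finite C-dimension. Then every Y-regular sequence of elements of the maximal ideal of A is a regular sequence in A, and it extends to a maximal C-regular sequence in the maximal ideal which is also a regular sequence in A. -/

import Mathlib

open CategoryTheory Opposite

/-- A finitely generated module `C` over a commutative noetherian local ring `A` is
*semidualizing* if the natural ring homomorphism `A → End_A(C)` (sending `a` to
multiplication by `a`) is an isomorphism and `Ext_A^i(C,C) = 0` for every `i > 0`. -/
def IsSemidualizing (A : Type) [CommRing A] (C : Type) [AddCommGroup C] [Module A C] : Prop :=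
  Function.Bijective (algebraMap A (Module.End A C)) ∧
  ∀ i : ℕ, 0 < i →
    Subsingleton (((Ext A (ModuleCat A) i).obj (op (ModuleCat.of A C))).obj (ModuleCat.of A C))

/-- `Y` admits a resolution `0 → C_s → ⋯ → C_0 → Y → 0` of length at most `s` in which
each `C_i` is a finite direct sum of copies of `C`. -/
def HasResolutionByOfLength (A : Type) [CommRing A] (C : Type) [AddCommGroup C] [Module A C]
    (Y : Type) [AddCommGroup Y] [Module A Y] (s : ℕ) : Prop :=
  ∃ (n : ℕ → ℕ) (d : ∀ i : ℕ, ((Fin (n (i + 1)) → C) →ₗ[A] (Fin (n i) → C)))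
    (ε : (Fin (n 0) → C) →ₗ[A] Y),
    (∀ i, s < i → n i = 0) ∧
    Function.Surjective ε ∧ Function.Exact (d 0) ε ∧
    ∀ i : ℕ, Function.Exact (d (i + 1)) (d i)

/-- `Y` has finite `C`-dimension. -/
def HasFiniteCDim (A : Type) [CommRing A] (C : Type) [AddCommGroup C] [Module A C]
    (Y : Type) [AddCommGroup Y] [Module A Y] : Prop :=
  ∃ s : ℕ, HasResolutionByOfLength A C Y s

/-- The `C`-dimension of `Y`: the smallest `s` such that `Y` has a resolution of length `s`
by finite direct sums of copies of `C`. -/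
noncomputable def cDim (A : Type) [CommRing A] (C : Type) [AddCommGroup C] [Module A C]
    (Y : Type) [AddCommGroup Y] [Module A Y] : ℕ :=
  sInf {s | HasResolutionByOfLength A C Y s}


-- Part 0

namespace NIT
set_option linter.unusedSectionVars false

/-- A bounded complex of finite free modules, encoded by one graded square-zero matrix. -/
structure FC (B : Type) [CommRing B] where
  ι : Type
  [fin : Fintype ι]
  [dec : DecidableEq ι]
  deg : ι → ℕ
  d : Matrix ι ι B
  d_deg : ∀ i j, d i j ≠ 0 → deg j = deg i + 1
  d_sq : d * d = 0

attribute [instance] FC.fin FC.dec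

section mact
variable {B : Type} [CommRing B] {ι κ τ : Type} [Fintype ι] [Fintype κ] [Fintype τ]
  {N N' : Type} [AddCommGroup N] [Module B N] [AddCommGroup N'] [Module B N']

/-- A matrix acting on vectors with entries in a module. -/
def mact (N : Type) [AddCommGroup N] [Module B N] (M : Matrix ι κ B) :
    (κ → N) →ₗ[B] (ι → N) :=
  LinearMap.pi fun i => ∑ j, M i j • LinearMap.proj j

lemma mact_apply (M : Matrix ι κ B) (z : κ → N) (i : ι) :
    mact N M z i = ∑ j, M i j • z j := by
  simp [mact]

lemma mact_mul (M : Matrix ι κ B) (M' : Matrix κ τ B) (z : τ → N) :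
    mact N (M * M') z = mact N M (mact N M' z) := by
  ext i
  simp only [mact_apply, Matrix.mul_apply, Finset.sum_smul, Finset.smul_sum, mul_smul]
  exact Finset.sum_comm

lemma mact_add (M M' : Matrix ι κ B) (z : κ → N) :
    mact N (M + M') z = mact N M z + mact N M' z := by
  ext i
  simp [mact_apply, add_smul, Finset.sum_add_distrib]

lemma mact_sub (M M' : Matrix ι κ B) (z : κ → N) :
    mact N (M - M') z = mact N M z - mact N M' z := by
  ext i
  simp [mact_apply, sub_smul, Finset.sum_sub_distrib]

lemma mact_smul_one [DecidableEq ι] (y : B) (z : ι → N) :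
    mact N (y • (1 : Matrix ι ι B)) z = y • z := by
  ext i
  simp [mact_apply, Matrix.one_apply]

lemma mact_one [DecidableEq ι] (z : ι → N) :
    mact N (1 : Matrix ι ι B) z = z := by
  simpa using mact_smul_one (1 : B) z

lemma mact_zero (z : κ → N) : mact N (0 : Matrix ι κ B) z = 0 := by
  ext i
  simp [mact_apply]

lemma mact_comp (f : N →ₗ[B] N') (M : Matrix ι κ B) (z : κ → N) :
    mact N' M (fun j => f (z j)) = fun i => f (mact N M z i) := by
  ext i
  simp [mact_apply]

end mact

namespace FC
variable {B : Type} [CommRing B] (F : FC B)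

/-- Base change. -/
def map {B' : Type} [CommRing B'] (φ : B →+* B') : FC B' where
  ι := F.ι
  deg := F.deg
  d := F.d.map φ
  d_deg i j h := F.d_deg i j fun h0 => h (by simp [h0])
  d_sq := by rw [← Matrix.map_mul, F.d_sq]; simp

/-- Multiplication by `y` is null homotopic. -/
def NullHtp (y : B) : Prop :=
  ∃ h : Matrix F.ι F.ι B, (∀ i j, h i j ≠ 0 → F.deg i = F.deg j + 1) ∧
    F.d * h + h * F.d = y • (1 : Matrix F.ι F.ι B)

variable {F} in
lemma NullHtp.map {B' : Type} [CommRing B'] (φ : B →+* B') {y : B} (h : F.NullHtp y) :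
    (F.map φ).NullHtp (φ y) := by
  obtain ⟨h, hd, e⟩ := h
  refine ⟨h.map φ, fun i j hij => hd i j fun h0 => hij ?_, ?_⟩
  · change φ (h i j) = 0
    simp [h0]
  have := congrArg (fun M : Matrix F.ι F.ι B => M.map φ) e
  simp only [Matrix.map_add φ (map_add φ), Matrix.map_mul] at this
  refine this.trans ?_
  ext i j
  by_cases hij : i = j
  · subst hij
    change φ ((y • (1 : Matrix F.ι F.ι B)) i i) = (φ y • (1 : Matrix F.ι F.ι B')) i i
    simp
  · change φ ((y • (1 : Matrix F.ι F.ι B)) i j) = (φ y • (1 : Matrix F.ι F.ι B')) i j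
    simp [hij]

variable {F} in
lemma NullHtp.mul {y : B} (h : F.NullHtp y) (c : B) : F.NullHtp (c * y) := by
  obtain ⟨h, hd, e⟩ := h
  refine ⟨c • h, fun i j hij => hd i j fun h0 => hij (by simp [h0]), ?_⟩
  rw [Matrix.mul_smul, Matrix.smul_mul, ← smul_add, e, smul_smul]

variable {F} in
lemma NullHtp.add {y z : B} (h : F.NullHtp y) (h' : F.NullHtp z) : F.NullHtp (y + z) := by
  obtain ⟨h, hd, e⟩ := h
  obtain ⟨h', hd', e'⟩ := h'
  refine ⟨h + h', fun i j hij => ?_, ?_⟩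
  · by_cases h0 : h i j = 0
    · exact hd' i j (fun h1 => hij (by simp [h0, h1]))
    · exact hd i j h0
  · rw [add_smul, ← e, ← e', mul_add, add_mul]; abel

lemma NullHtp.zero : F.NullHtp 0 := ⟨0, by simp, by simp⟩

/-- The ideal of elements acting null homotopically. -/
def nullIdeal : Ideal B where
  carrier := {y | F.NullHtp y}
  add_mem' := NullHtp.add
  zero_mem' := NullHtp.zero F
  smul_mem' c _ h := NullHtp.mul h c

variable (N : Type) [AddCommGroup N] [Module B N]

/-- Vectors supported in one degree. -/
def supp (j : ℕ) : Submodule B (F.ι → N) where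
  carrier := {z | ∀ i, F.deg i ≠ j → z i = 0}
  add_mem' ha hb i hi := by simp [ha i hi, hb i hi]
  zero_mem' := by simp
  smul_mem' c z hz i hi := by simp [hz i hi]

/-- The differential. -/
abbrev D : (F.ι → N) →ₗ[B] (F.ι → N) := mact N F.d

lemma D_D (z : F.ι → N) : F.D N (F.D N z) = 0 := by
  rw [← mact_mul, F.d_sq, mact_zero]

/-- cycles -/
def Z (j : ℕ) : Submodule B (F.ι → N) := F.supp N j ⊓ LinearMap.ker (F.D N)
/-- boundaries -/
def Bd (j : ℕ) : Submodule B (F.ι → N) := (F.supp N (j+1)).map (F.D N)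
/-- homology -/
abbrev H (j : ℕ) : Type := (F.Z N j) ⧸ (F.Bd N j).submoduleOf (F.Z N j)
/-- length of homology -/
noncomputable def hl (j : ℕ) : ℕ∞ := Module.length B (F.H N j)

variable {N}

lemma mem_supp {j : ℕ} {z : F.ι → N} : z ∈ F.supp N j ↔ ∀ i, F.deg i ≠ j → z i = 0 := Iff.rfl

lemma mem_Z {j : ℕ} {z : F.ι → N} : z ∈ F.Z N j ↔ z ∈ F.supp N j ∧ F.D N z = 0 := Iff.rfl

lemma mem_Bd {j : ℕ} {z : F.ι → N} :
    z ∈ F.Bd N j ↔ ∃ w ∈ F.supp N (j+1), F.D N w = z := Iff.rfl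

lemma D_supp {j : ℕ} {z : F.ι → N} (hz : z ∈ F.supp N (j+1)) : F.D N z ∈ F.supp N j := by
  intro i hi
  rw [mact_apply]
  refine Finset.sum_eq_zero fun k _ => ?_
  by_cases h : F.d i k = 0
  · simp [h]
  · have := F.d_deg i k h
    rw [hz k (by omega), smul_zero]

lemma D_supp_zero {z : F.ι → N} (hz : z ∈ F.supp N 0) : F.D N z = 0 := by
  ext i
  rw [mact_apply]
  refine Finset.sum_eq_zero fun k _ => ?_
  by_cases h : F.d i k = 0
  · simp [h]
  · have := F.d_deg i k h
    rw [hz k (by omega), smul_zero]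

lemma h_supp {h : Matrix F.ι F.ι B} (hh : ∀ i j, h i j ≠ 0 → F.deg i = F.deg j + 1)
    {j : ℕ} {z : F.ι → N} (hz : z ∈ F.supp N j) : mact N h z ∈ F.supp N (j+1) := by
  intro i hi
  rw [mact_apply]
  refine Finset.sum_eq_zero fun k _ => ?_
  by_cases h0 : h i k = 0
  · simp [h0]
  · have := hh i k h0
    rw [hz k (by omega), smul_zero]

lemma Bd_le_Z (j : ℕ) : F.Bd N j ≤ F.Z N j := by
  rintro _ ⟨w, hw, rfl⟩
  exact ⟨F.D_supp hw, F.D_D N w⟩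

lemma Z_eq_bot_of_lt {s j : ℕ} (hs : ∀ i, F.deg i ≤ s) (hj : s < j) {z : F.ι → N}
    (hz : z ∈ F.supp N j) : z = 0 := by
  ext i
  exact hz i (by have := hs i; omega)

end FC

section len
variable {B : Type} [CommRing B]
  {M : Type} [AddCommGroup M] [Module B M] {M' : Type} [AddCommGroup M'] [Module B M']
  {M'' : Type} [AddCommGroup M''] [Module B M'']

lemma length_quot_le (Z Q : Submodule B M) (Z' Q' : Submodule B M') (f : M →ₗ[B] M')
    (h1 : ∀ z ∈ Z, f z ∈ Z') (h2 : ∀ z ∈ Z, f z ∈ Q' → z ∈ Q) :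
    Module.length B (Z ⧸ Q.submoduleOf Z) ≤ Module.length B (Z' ⧸ Q'.submoduleOf Z') := by
  let g : Z →ₗ[B] Z' := f.restrict h1
  let g' : Z →ₗ[B] (Z' ⧸ Q'.submoduleOf Z') := (Submodule.mkQ _).comp g
  have hk : LinearMap.ker g' ≤ Q.submoduleOf Z := by
    intro z hz
    have hz' : g z ∈ Q'.submoduleOf Z' := by
      simpa [g', Submodule.Quotient.mk_eq_zero] using hz
    exact h2 z.1 z.2 hz'
  calc Module.length B (Z ⧸ Q.submoduleOf Z)
      ≤ Module.length B (Z ⧸ LinearMap.ker g') :=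
        Module.length_le_of_surjective (Submodule.factor hk) (Submodule.factor_surjective hk)
    _ ≤ _ := Module.length_le_of_injective ((LinearMap.ker g').liftQ g' le_rfl)
        (by rw [← LinearMap.ker_eq_bot]; exact Submodule.ker_liftQ_eq_bot _ _ _ le_rfl)

lemma length_quot_le_add (Z Q : Submodule B M) (Z' Q' : Submodule B M') (Z'' Q'' : Submodule B M'')
    (g : M' →ₗ[B] M) (f : M →ₗ[B] M'')
    (hf : ∀ z ∈ Z, f z ∈ Z'')
    (hgQ : ∀ z ∈ Q', g z ∈ Q)
    (hex : ∀ z ∈ Z, f z ∈ Q'' → ∃ z' ∈ Z', z - g z' ∈ Q) :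
    Module.length B (Z ⧸ Q.submoduleOf Z) ≤
      Module.length B (Z' ⧸ Q'.submoduleOf Z') + Module.length B (Z'' ⧸ Q''.submoduleOf Z'') := by
  set K : Submodule B Z := (Q''.comap f).submoduleOf Z with hK
  have e := Module.length_eq_add_of_exact (R := B)
    (K.map (Q.submoduleOf Z).mkQ).subtype (K.map (Q.submoduleOf Z).mkQ).mkQ
    (Submodule.subtype_injective _) (Submodule.mkQ_surjective _)
    (by rw [LinearMap.exact_iff]; simp)
  rw [e]
  refine add_le_add ?_ ?_
  · -- subquotient of cycles
    let g' : Z' →ₗ[B] (M ⧸ Q) := Q.mkQ.comp (g.comp Z'.subtype)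
    let j : (Z ⧸ Q.submoduleOf Z) →ₗ[B] (M ⧸ Q) := Submodule.mapQ _ _ Z.subtype (by
      intro z hz; exact hz)
    have hj : Function.Injective j := by
      rw [← LinearMap.ker_eq_bot, eq_bot_iff]
      intro x hx
      induction x using Submodule.Quotient.induction_on with
      | _ x =>
      have : Submodule.Quotient.mk (x : M) = (0 : M ⧸ Q) := hx
      rw [Submodule.Quotient.mk_eq_zero] at this
      exact (Submodule.Quotient.mk_eq_zero _).2 this
    let G : (Z' ⧸ Q'.submoduleOf Z') →ₗ[B] (M ⧸ Q) := Submodule.liftQ _ g' (by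
      intro z hz
      simp only [g', LinearMap.mem_ker, LinearMap.comp_apply, Submodule.mkQ_apply,
        Submodule.Quotient.mk_eq_zero]
      exact hgQ _ hz)
    have hsub : (K.map (Q.submoduleOf Z).mkQ).map j ≤ LinearMap.range G := by
      rintro _ ⟨_, ⟨x, hx, rfl⟩, rfl⟩
      obtain ⟨z', hz', h⟩ := hex x.1 x.2 hx
      refine ⟨Submodule.Quotient.mk ⟨z', hz'⟩, ?_⟩
      change Submodule.Quotient.mk (g z') = Submodule.Quotient.mk (x : M)
      symm
      rw [Submodule.Quotient.eq]
      exact h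
    calc Module.length B (K.map (Q.submoduleOf Z).mkQ)
        = Module.length B ((K.map (Q.submoduleOf Z).mkQ).map j) :=
          (Submodule.equivMapOfInjective j hj _).length_eq
      _ ≤ Module.length B (LinearMap.range G) :=
          Module.length_le_of_injective (Submodule.inclusion hsub) (Submodule.inclusion_injective _)
      _ ≤ _ := Module.length_le_of_surjective G.rangeRestrict G.surjective_rangeRestrict
  · let f' : Z →ₗ[B] Z'' := f.restrict hf
    let f2 : Z →ₗ[B] (Z'' ⧸ Q''.submoduleOf Z'') := (Submodule.mkQ _).comp f'
    have hker : LinearMap.ker f2 ≤ K := by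
      intro z hz
      have hz' : f' z ∈ Q''.submoduleOf Z'' := by
        simpa [f2, Submodule.Quotient.mk_eq_zero] using hz
      exact hz'
    let q : Z →ₗ[B] ((Z ⧸ Q.submoduleOf Z) ⧸ (K.map (Q.submoduleOf Z).mkQ)) :=
      (Submodule.mkQ _).comp (Submodule.mkQ _)
    have hq : Function.Surjective q :=
      (Submodule.mkQ_surjective _).comp (Submodule.mkQ_surjective _)
    have hle : LinearMap.ker f2 ≤ LinearMap.ker q := by
      intro z hz
      simp only [q, LinearMap.mem_ker, LinearMap.comp_apply, Submodule.mkQ_apply]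
      rw [Submodule.Quotient.mk_eq_zero]
      exact ⟨z, hker hz, rfl⟩
    have hs : Function.Surjective ((LinearMap.ker f2).liftQ q hle) := by
      intro x
      obtain ⟨z, rfl⟩ := hq x
      exact ⟨Submodule.Quotient.mk z, rfl⟩
    exact (Module.length_le_of_surjective _ hs).trans
      (Module.length_le_of_injective ((LinearMap.ker f2).liftQ f2 le_rfl)
        (by rw [← LinearMap.ker_eq_bot]; exact Submodule.ker_liftQ_eq_bot _ _ _ le_rfl))

end len
end NIT

-- Part 1

open scoped Pointwise

namespace NIT
set_option linter.unusedSectionVars false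
set_option linter.style.haveILetI false
namespace FC
section
variable {B : Type} [CommRing B] (F : FC B)
  {N N' N'' : Type} [AddCommGroup N] [Module B N] [AddCommGroup N'] [Module B N']
  [AddCommGroup N''] [Module B N'']

lemma supp_lift (f : N →ₗ[B] N') (hf : Function.Surjective f) {j : ℕ} {z : F.ι → N'}
    (hz : z ∈ F.supp N' j) : ∃ w ∈ F.supp N j, f.compLeft F.ι w = z := by
  choose g hg using hf
  refine ⟨fun i => if F.deg i = j then g (z i) else 0, fun i hi => by simp [hi], ?_⟩
  ext i
  by_cases h : F.deg i = j
  · simp [h, hg]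
  · simp [h, hz i h]

lemma compLeft_supp (f : N →ₗ[B] N') {j : ℕ} {z : F.ι → N} (hz : z ∈ F.supp N j) :
    f.compLeft F.ι z ∈ F.supp N' j := fun i hi => by simp [hz i hi]

lemma supp_of_compLeft (f : N →ₗ[B] N') (hf : Function.Injective f) {j : ℕ} {z : F.ι → N}
    (hz : f.compLeft F.ι z ∈ F.supp N' j) : z ∈ F.supp N j := fun i hi => by
  apply hf; simpa using hz i hi

lemma D_compLeft (f : N →ₗ[B] N') (z : F.ι → N) :
    F.D N' (f.compLeft F.ι z) = f.compLeft F.ι (F.D N z) := mact_comp f F.d z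

lemma compLeft_inj (f : N →ₗ[B] N') (hf : Function.Injective f) :
    Function.Injective (f.compLeft F.ι) := fun a b h => by
  ext i; exact hf (congrFun h i)

lemma hl_ses (g : N' →ₗ[B] N) (f : N →ₗ[B] N'') (hg : Function.Injective g)
    (hf : Function.Surjective f) (hex : Function.Exact g f) (j : ℕ) :
    F.hl N j ≤ F.hl N' j + F.hl N'' j := by
  refine length_quot_le_add _ _ _ _ _ _ (g.compLeft F.ι) (f.compLeft F.ι) ?_ ?_ ?_
  · rintro z ⟨h1, h2⟩
    exact F.mem_Z.2 ⟨F.compLeft_supp f h1, by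
      rw [D_compLeft, LinearMap.mem_ker.1 h2, map_zero]⟩
  · rintro _ ⟨w, hw, rfl⟩
    exact ⟨g.compLeft F.ι w, F.compLeft_supp g hw, D_compLeft _ _ _⟩
  · rintro z ⟨h1, h2⟩ ⟨w, hw, hw'⟩
    obtain ⟨v, hv, rfl⟩ := F.supp_lift f hf hw
    rw [D_compLeft] at hw'
    have : ∀ i, ∃ t, g t = (z - F.D N v) i := by
      intro i
      apply (hex _).1
      have := congrFun hw' i
      simp only [LinearMap.compLeft_apply, Function.comp] at this
      simp [this]
    choose t ht using this
    have ht' : g.compLeft F.ι t = z - F.D N v := by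
      ext i; exact ht i
    refine ⟨t, F.mem_Z.2 ⟨F.supp_of_compLeft g hg ?_, ?_⟩, v, hv, ?_⟩
    · rw [ht']; exact Submodule.sub_mem _ h1 (F.D_supp hv)
    · apply F.compLeft_inj g hg
      rw [← D_compLeft, ht', map_sub, D_D, LinearMap.mem_ker.1 h2]; simp
    · rw [ht']; abel

lemma hl_le_of_equiv (e : N ≃ₗ[B] N') (j : ℕ) : F.hl N j ≤ F.hl N' j := by
  refine length_quot_le _ _ _ _ (e.toLinearMap.compLeft F.ι) ?_ ?_
  · rintro z ⟨h1, h2⟩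
    exact F.mem_Z.2 ⟨F.compLeft_supp _ h1, by
      rw [D_compLeft, LinearMap.mem_ker.1 h2, map_zero]⟩
  · rintro z ⟨h1, h2⟩ ⟨w, hw, hw'⟩
    obtain ⟨v, hv, rfl⟩ := F.supp_lift e.toLinearMap e.surjective hw
    rw [D_compLeft] at hw'
    exact ⟨v, hv, F.compLeft_inj _ e.injective hw'⟩

lemma hl_le_length (j : ℕ) : F.hl N j ≤ Module.length B (F.ι → N) :=
  (Module.length_le_of_surjective (Submodule.mkQ _) (Submodule.mkQ_surjective _)).trans
    (Module.length_le_of_injective _ (Submodule.subtype_injective _))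

lemma hl_eq_zero {s j : ℕ} (hs : ∀ i, F.deg i ≤ s) (hj : s < j) : F.hl N j = 0 := by
  unfold hl
  rw [Module.length_eq_zero_iff]
  have : Subsingleton (F.Z N j) := by
    constructor
    rintro ⟨a, ha⟩ ⟨b, hb⟩
    rw [Subtype.mk.injEq, F.Z_eq_bot_of_lt hs hj ha.1, F.Z_eq_bot_of_lt hs hj hb.1]
  exact (Submodule.mkQ_surjective _).subsingleton

lemma hl_le_quot {y : B} (hy : F.NullHtp y) (hreg : IsSMulRegular N y) (j : ℕ) :
    F.hl N j ≤ F.hl (QuotSMulTop y N) (j+1) := by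
  obtain ⟨h, hd, e⟩ := hy
  let π : N →ₗ[B] QuotSMulTop y N := Submodule.mkQ _
  have hπ : Function.Surjective π := Submodule.mkQ_surjective _
  have hker : ∀ n, π n = 0 ↔ ∃ n', y • n' = n := by
    intro n
    simp only [π, Submodule.mkQ_apply, Submodule.Quotient.mk_eq_zero]
    rw [Submodule.mem_smul_pointwise_iff_exists]; simp
  have key : ∀ z ∈ F.Z N j, F.D N (mact N h z) = y • z := by
    rintro z ⟨h1, h2⟩
    have := congrArg (fun M => mact N M z) e
    simp only [mact_add, mact_mul, mact_smul_one] at this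
    rwa [LinearMap.mem_ker.1 h2, map_zero, add_zero] at this
  refine length_quot_le _ _ _ _ ((π.compLeft F.ι).comp (mact N h)) ?_ ?_
  · rintro z hz
    refine F.mem_Z.2 ⟨F.compLeft_supp π (F.h_supp hd hz.1), ?_⟩
    rw [LinearMap.comp_apply, D_compLeft, key z hz]
    ext i
    exact (hker _).2 ⟨z i, rfl⟩
  · rintro z hz ⟨w, hw, hw'⟩
    obtain ⟨v, hv, rfl⟩ := F.supp_lift π hπ hw
    rw [D_compLeft, LinearMap.comp_apply, ← sub_eq_zero, ← map_sub] at hw'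
    have : ∀ i, ∃ t, y • t = (F.D N v - mact N h z) i := fun i => (hker _).1 (congrFun hw' i)
    choose t ht using this
    have ht' : y • t = F.D N v - mact N h z := by ext i; exact ht i
    refine ⟨-t, ?_, ?_⟩
    · apply Submodule.neg_mem
      intro i hi
      apply hreg
      have : (F.D N v - mact N h z) i = 0 :=
        (Submodule.sub_mem _ (F.D_supp hv) (F.h_supp hd hz.1)) i hi
      simp [ht i, this]
    · have h1 : y • F.D N t = - (y • z) := by
        rw [← map_smul, ht', map_sub, D_D, key z hz, zero_sub]
      ext i
      apply hreg
      have := congrFun h1 i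
      simp only [Pi.smul_apply, Pi.neg_apply] at this
      simp [this]

lemma hl_quot_mul {a b : B} (hb : IsSMulRegular N b) (j : ℕ) :
    F.hl (QuotSMulTop (a * b) N) j ≤ F.hl (QuotSMulTop a N) j + F.hl (QuotSMulTop b N) j := by
  have hm : ∀ c : B, ∀ n : N, n ∈ (c • ⊤ : Submodule B N) ↔ ∃ n', c • n' = n := by
    intro c n
    rw [Submodule.mem_smul_pointwise_iff_exists]; simp
  let g : QuotSMulTop a N →ₗ[B] QuotSMulTop (a * b) N :=
    Submodule.mapQ _ _ (LinearMap.lsmul B N b) (by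
      intro n hn
      obtain ⟨n', rfl⟩ := (hm _ _).1 hn
      refine (hm _ _).2 ⟨n', ?_⟩
      simp [mul_smul, smul_comm a b])
  let f : QuotSMulTop (a * b) N →ₗ[B] QuotSMulTop b N :=
    Submodule.mapQ _ _ LinearMap.id (by
      intro n hn
      obtain ⟨n', rfl⟩ := (hm _ _).1 hn
      exact (hm _ _).2 ⟨a • n', by simp [mul_smul, smul_comm a b]⟩)
  refine F.hl_ses g f ?_ ?_ ?_ j
  · rw [← LinearMap.ker_eq_bot, eq_bot_iff]
    intro x hx
    obtain ⟨x, rfl⟩ := Submodule.mkQ_surjective _ x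
    have h : (Submodule.Quotient.mk (b • x) : QuotSMulTop (a * b) N) = 0 := hx
    rw [Submodule.Quotient.mk_eq_zero] at h
    obtain ⟨n', h⟩ := (hm _ _).1 h
    refine (Submodule.Quotient.mk_eq_zero _).2 ((hm _ _).2 ⟨n', hb ?_⟩)
    simp only
    rw [← h, mul_smul, smul_comm]
  · intro x
    obtain ⟨x, rfl⟩ := Submodule.mkQ_surjective _ x
    exact ⟨Submodule.Quotient.mk x, rfl⟩
  · intro x
    obtain ⟨x, rfl⟩ := Submodule.mkQ_surjective _ x
    constructor
    · intro h
      have h : (Submodule.Quotient.mk x : QuotSMulTop b N) = 0 := h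
      rw [Submodule.Quotient.mk_eq_zero] at h
      obtain ⟨n', rfl⟩ := (hm _ _).1 h
      exact ⟨Submodule.Quotient.mk n', rfl⟩
    · rintro ⟨t, ht⟩
      obtain ⟨t, rfl⟩ := Submodule.mkQ_surjective _ t
      rw [← ht]
      change (Submodule.Quotient.mk (b • t) : QuotSMulTop b N) = 0
      rw [Submodule.Quotient.mk_eq_zero]
      exact (hm _ _).2 ⟨t, rfl⟩

lemma hl_quot_pow {x : B} (hx : IsSMulRegular N x) (j k : ℕ) :
    F.hl (QuotSMulTop (x ^ k) N) j ≤ k * F.hl (QuotSMulTop x N) j := by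
  induction k with
  | zero =>
    have : Subsingleton (QuotSMulTop (x ^ 0) N) := by
      apply Submodule.Quotient.subsingleton_iff.2
      simp
    have h := F.hl_le_length (N := QuotSMulTop (x ^ 0) N) j
    rw [Module.length_eq_zero] at h
    exact h.trans (by simp)
  | succ k ih =>
    rw [pow_succ]
    refine (F.hl_quot_mul hx j).trans ?_
    push_cast
    rw [add_mul, one_mul]
    gcongr

end
section charp
variable {A : Type} [CommRing A] [IsNoetherianRing A] [IsLocalRing A] (p : ℕ) [Fact p.Prime] [CharP A p]

/-- Frobenius twist. -/
noncomputable def frob (F : FC A) (e : ℕ) : FC A := F.map (iterateFrobenius A p e)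

/-- The growth bound. -/
def Bnd (F : FC A) (s r : ℕ) (N : Type) [AddCommGroup N] [Module A N] : Prop :=
  ∃ C : ℕ, ∀ e j : ℕ, (F.frob p e).hl N j ≤ C * (p ^ e : ℕ) ^ r ∧
    (s < j + r → (p ^ e : ℕ) * (F.frob p e).hl N j ≤ C * (p ^ e : ℕ) ^ r)

lemma Bnd_all (F : FC A) (s : ℕ) (hs : ∀ i, F.deg i ≤ s)
    (hF : ∀ x ∈ IsLocalRing.maximalIdeal A, ∃ M : ℕ, F.NullHtp (x ^ M)) (r : ℕ) :
    ∀ (N : Type) [AddCommGroup N] [Module A N] [Module.Finite A N],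
      Module.supportDim A N ≤ r → F.Bnd p s r N := by
  have hp : 0 < p := (Fact.out : p.Prime).pos
  have hs' : ∀ e, ∀ i, (F.frob p e).deg i ≤ s := fun e i => hs i
  induction r using Nat.strong_induction_on with
  | _ r ih =>
  intro N _ _ hN
  induction hN using IsNoetherianRing.induction_on_isQuotientEquivQuotientPrime A with
  | subsingleton N =>
    intro _
    refine ⟨0, fun e j => ?_⟩
    have h := (F.frob p e).hl_le_length (N := N) j
    rw [Module.length_eq_zero, nonpos_iff_eq_zero] at h
    simp [h]
  | exact N₁ N₂ N₃ f g hf hg hfg ih₁ ih₃ =>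
    intro h
    obtain ⟨C₁, h₁⟩ := ih₁ ((Module.supportDim_le_of_injective f hf).trans h)
    obtain ⟨C₃, h₃⟩ := ih₃ ((Module.supportDim_le_of_surjective g hg).trans h)
    refine ⟨C₁ + C₃, fun e j => ?_⟩
    have h2 := (F.frob p e).hl_ses f g hf hg hfg j
    push_cast
    refine ⟨h2.trans ?_, fun hj => (mul_le_mul_right h2 _).trans ?_⟩
    · rw [add_mul]
      exact add_le_add (by simpa using (h₁ e j).1) (by simpa using (h₃ e j).1)
    · rw [add_mul, mul_add]
      exact add_le_add (by simpa using (h₁ e j).2 hj) (by simpa using (h₃ e j).2 hj)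
  | quotient N P eq =>
    intro h
    by_cases hP : P.1 = IsLocalRing.maximalIdeal A
    · refine ⟨Fintype.card F.ι, fun e j => ?_⟩
      have hlen : (F.frob p e).hl N j ≤ Fintype.card F.ι := by
        refine ((F.frob p e).hl_le_length (N := N) j).trans ?_
        rw [Module.length_pi_of_fintype]
        have : Module.length A N = 1 := by
          rw [eq.length_eq, Module.length_eq_one_iff, isSimpleModule_iff_isCoatom]
          rw [hP]; exact (IsLocalRing.maximalIdeal.isMaximal A).out
        simp [this]
        rfl
      have hq : (1 : ℕ∞) ≤ (p ^ e : ℕ) := by exact_mod_cast Nat.pos_of_ne_zero (by positivity)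
      refine ⟨?_, fun hj => ?_⟩
      · calc _ ≤ (Fintype.card F.ι : ℕ∞) * 1 := by simpa using hlen
          _ ≤ _ := by gcongr; exact one_le_pow₀ hq
      · by_cases hjs : s < j
        · rw [(F.frob p e).hl_eq_zero (hs' e) hjs]; simp
        · obtain ⟨r', rfl⟩ : ∃ r', r = r' + 1 := ⟨r - 1, by omega⟩
          rw [mul_comm, pow_succ, ← mul_assoc]
          gcongr
          calc _ ≤ (Fintype.card F.ι : ℕ∞) * 1 := by simpa using hlen
            _ ≤ _ := by gcongr; exact one_le_pow₀ hq
    · obtain ⟨x, hxm, hxP⟩ : ∃ x ∈ IsLocalRing.maximalIdeal A, x ∉ P.1 := by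
        by_contra! hcon
        exact hP (le_antisymm (IsLocalRing.le_maximalIdeal P.2.ne_top) hcon)
      obtain ⟨M, hM⟩ := hF x hxm
      have hreg : IsSMulRegular N x := by
        intro a b hab
        apply eq.injective
        have := congrArg eq hab
        simp only [map_smul] at this
        rw [← sub_eq_zero] at this ⊢
        rw [← smul_sub] at this
        obtain ⟨c, hc⟩ := Ideal.Quotient.mk_surjective (eq a - eq b)
        rw [← hc] at this ⊢
        have h' : Ideal.Quotient.mk P.1 (x * c) = 0 := this
        rw [Ideal.Quotient.eq_zero_iff_mem] at h' ⊢
        exact (P.2.mem_or_mem h').resolve_left hxP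
      haveI : Nontrivial N := by
        haveI := Ideal.Quotient.nontrivial_iff.2 P.2.ne_top
        exact eq.toEquiv.nontrivial
      haveI : Module.Finite A N := Module.Finite.equiv eq.symm
      have hdim := Module.supportDim_quotSMulTop_succ_eq_supportDim hreg hxm
      have hnt : Nontrivial (QuotSMulTop x N) :=
        nontrivial_quotSMulTop_of_mem_maximalIdeal N hxm
      have hnb := Module.supportDim_ne_bot_of_nontrivial A (QuotSMulTop x N)
      obtain ⟨u, hu⟩ := WithBot.ne_bot_iff_exists.1 hnb
      rw [← hdim, ← hu] at h
      have h' : u + 1 ≤ (r : ℕ∞) := by exact_mod_cast h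
      obtain ⟨r', rfl⟩ : ∃ r', r = r' + 1 := by
        refine ⟨r - 1, ?_⟩
        have : (1 : ℕ∞) ≤ r := le_trans (by simp) h'
        have : 1 ≤ r := by exact_mod_cast this
        omega
      have hle : Module.supportDim A (QuotSMulTop x N) ≤ r' := by
        rw [← hu]
        push_cast at h'
        have : u ≤ r' := (ENat.add_le_add_iff_right (by simp)).1 h'
        exact_mod_cast this
      obtain ⟨C, hC⟩ := ih r' (by omega) _ hle
      refine ⟨M * C, fun e j => ?_⟩
      have hnull : (F.frob p e).NullHtp (x ^ (M * p ^ e)) := by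
        have := hM.map (iterateFrobenius A p e)
        rwa [iterateFrobenius_def, ← pow_mul] at this
      have hreg' : IsSMulRegular N (x ^ (M * p ^ e)) := hreg.pow _
      have h1 := ((F.frob p e).hl_le_quot hnull hreg' j).trans ((F.frob p e).hl_quot_pow hreg _ _)
      refine ⟨h1.trans ?_, fun hj => (mul_le_mul_right h1 _).trans ?_⟩
      · have := (hC e (j+1)).1
        calc _ ≤ ((M * p ^ e : ℕ) : ℕ∞) * (C * (p ^ e : ℕ) ^ r') := by gcongr
          _ = _ := by push_cast; ring
      · have := (hC e (j+1)).2 (by omega)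
        calc _ = ((M * p ^ e : ℕ) : ℕ∞) * ((p ^ e : ℕ) * (F.frob p e).hl (QuotSMulTop x N) (j + 1)) := by ring
          _ ≤ ((M * p ^ e : ℕ) : ℕ∞) * (C * (p ^ e : ℕ) ^ r') := by gcongr
          _ = _ := by push_cast; ring

end charp
end FC

section hilbert
variable {A : Type} [CommRing A] [IsNoetherianRing A] [IsLocalRing A]
open IsLocalRing

/-- Hilbert function of `A/I`. -/
noncomputable def hf (I : Ideal A) (n : ℕ) : ℕ∞ := Module.length A (A ⧸ (I ⊔ maximalIdeal A ^ n))

lemma length_quot_mono {I J : Ideal A} (h : I ≤ J) : Module.length A (A ⧸ J) ≤ Module.length A (A ⧸ I) :=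
  Module.length_le_of_surjective (Submodule.factor h) (Submodule.factor_surjective h)

lemma hf_anti {I J : Ideal A} (h : I ≤ J) (n : ℕ) : hf J n ≤ hf I n :=
  length_quot_mono (sup_le_sup_right h _)

lemma hf_mono {I : Ideal A} {n k : ℕ} (h : n ≤ k) : hf I n ≤ hf I k :=
  length_quot_mono (sup_le_sup_left (Ideal.pow_le_pow_right h) _)

lemma hf_pos {I : Ideal A} (hI : I ≤ maximalIdeal A) {n : ℕ} (h : 1 ≤ n) : 1 ≤ hf I n := by
  rw [Order.one_le_iff_pos, hf, Module.length_pos_iff]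
  apply Ideal.Quotient.nontrivial_iff.2
  intro h'
  have : I ⊔ maximalIdeal A ^ n ≤ maximalIdeal A := sup_le hI (Ideal.pow_le_self (by omega))
  rw [h'] at this
  exact (maximalIdeal.isMaximal A).ne_top (top_le_iff.1 this)

lemma hf_step (P : Ideal A) [P.IsPrime] (x : A) (hx : x ∉ P) :
    ∃ k, ∀ n ≥ k, hf P (n - k) + hf (P ⊔ Ideal.span {x}) n ≤ hf P n := by
  obtain ⟨k, hk⟩ := Ideal.exists_pow_inf_eq_pow_smul (M := A ⧸ P) (maximalIdeal A)
    (Submodule.span A {(Ideal.Quotient.mk P x)})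
  refine ⟨k, fun n hn => ?_⟩
  have hk' := hk n hn
  have key : ∀ a, a * x ∈ P ⊔ maximalIdeal A ^ n → a ∈ P ⊔ maximalIdeal A ^ (n - k) := by
    intro a ha
    obtain ⟨u, hu, v, hv, huv⟩ := Submodule.mem_sup.1 ha
    have h1 : Ideal.Quotient.mk P (a * x) ∈ (maximalIdeal A ^ n • ⊤ : Submodule A (A ⧸ P)) ⊓
        Submodule.span A {(Ideal.Quotient.mk P x)} := by
      constructor
      · have : Ideal.Quotient.mk P (a * x) = v • (1 : A ⧸ P) := by
          rw [← huv, map_add, Ideal.Quotient.eq_zero_iff_mem.2 hu, zero_add]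
          rw [Algebra.smul_def, mul_one]; rfl
        rw [this]
        exact Submodule.smul_mem_smul hv trivial
      · exact Submodule.mem_span_singleton.2 ⟨a, by rw [map_mul, Algebra.smul_def]; rfl⟩
    rw [hk'] at h1
    have h2 : Ideal.Quotient.mk P (a * x) ∈
        (maximalIdeal A ^ (n-k) • Submodule.span A {(Ideal.Quotient.mk P x)}) :=
      Submodule.smul_mono le_rfl inf_le_right h1
    obtain ⟨b, hb, hb'⟩ := Submodule.mem_smul_span_singleton.1 h2
    have h3 : Ideal.Quotient.mk P ((b - a) * x) = 0 := by
      rw [sub_mul, map_sub, ← hb', sub_eq_zero, map_mul, Algebra.smul_def]; rfl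
    rw [Ideal.Quotient.eq_zero_iff_mem] at h3
    have h4 := (‹P.IsPrime›.mem_or_mem h3).resolve_right hx
    have : a = -(b - a) + b := by ring
    rw [this]
    exact Submodule.add_mem_sup (neg_mem h4) hb
  set J := P ⊔ maximalIdeal A ^ n with hJ
  let L : A →ₗ[A] (A ⧸ J) := (Submodule.mkQ J).comp (LinearMap.mulRight A x)
  have hL : ∀ a, L a = Ideal.Quotient.mk J (a * x) := fun a => rfl
  have e := Module.length_eq_add_of_exact (R := A)
    (LinearMap.range L).subtype (LinearMap.range L).mkQ
    (Submodule.subtype_injective _) (Submodule.mkQ_surjective _)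
    (by rw [LinearMap.exact_iff]; simp)
  change _ ≤ Module.length A (A ⧸ J)
  rw [e]
  refine add_le_add ?_ ?_
  · rw [← L.quotKerEquivRange.length_eq]
    apply length_quot_mono
    intro a ha
    apply key
    rw [LinearMap.mem_ker, hL, Ideal.Quotient.eq_zero_iff_mem] at ha
    exact ha
  · let J' := P ⊔ Ideal.span {x} ⊔ maximalIdeal A ^ n
    have hJJ : J ≤ J' := sup_le_sup_right le_sup_left _
    let f : (A ⧸ J) →ₗ[A] (A ⧸ J') := Submodule.factor hJJ
    have hf : Function.Surjective f := Submodule.factor_surjective hJJ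
    have hr : LinearMap.range L ≤ LinearMap.ker f := by
      rintro _ ⟨a, rfl⟩
      change Ideal.Quotient.mk J' (a * x) = 0
      rw [Ideal.Quotient.eq_zero_iff_mem]
      exact J'.mul_mem_left _ ((le_trans le_sup_right le_sup_left : Ideal.span {x} ≤ J') (Ideal.mem_span_singleton_self x))
    refine Module.length_le_of_surjective ((LinearMap.range L).liftQ f hr) ?_
    intro y
    obtain ⟨y, rfl⟩ := hf y
    exact ⟨Submodule.Quotient.mk y, rfl⟩

lemma hilbert_lower (D : ℕ) : ∀ P : PrimeSpectrum A, (D : ℕ∞) ≤ Order.coheight P →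
    ∃ K : ℕ, ∀ n ≥ 1, ((n ^ D : ℕ) : ℕ∞) ≤ K * hf P.1 n := by
  induction D with
  | zero =>
    intro P _
    refine ⟨1, fun n hn => ?_⟩
    simpa using hf_pos (le_maximalIdeal P.2.ne_top) hn
  | succ D ih =>
    intro P hP
    obtain ⟨P', hPP', hP'⟩ : ∃ P' > P, (D : ℕ∞) ≤ Order.coheight P' := by
      by_contra! hcon
      have := hP.trans (Order.coheight_le_coe_iff.2 hcon)
      have : D + 1 ≤ D := by exact_mod_cast this
      omega
    obtain ⟨K, hK⟩ := ih P' hP'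
    obtain ⟨x, hx', hx⟩ := SetLike.exists_of_lt (show P.1 < P'.1 from hPP')
    have := P.2
    obtain ⟨k, hk⟩ := hf_step P.1 x hx
    have h0 : ∀ n, hf P'.1 n ≤ hf (P.1 ⊔ Ideal.span {x}) n := fun n => hf_anti
      (sup_le hPP'.le ((Ideal.span_singleton_le_iff_mem _).2 hx')) n
    have hone : ∀ n ≥ 1, 1 ≤ hf P.1 n := fun n hn => hf_pos (le_maximalIdeal P.2.ne_top) hn
    set k' := k + 1 with hk'
    have hrec : ∀ n ≥ k', hf P.1 (n - k') + hf P'.1 n ≤ hf P.1 n := fun n hn =>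
      le_trans (add_le_add (hf_mono (by omega)) (h0 n)) (hk n (by omega))
    have hmul : ∀ j : ℕ, ((j ^ (D+1) : ℕ) : ℕ∞) ≤ (K * (D+1) : ℕ) * hf P.1 (j * k') := by
      intro j
      induction j with
      | zero => simp
      | succ j ihj =>
        have h1 := hrec ((j+1)*k') (Nat.le_mul_of_pos_left _ (by omega))
        have h2 : (j+1) * k' - k' = j * k' := by rw [add_mul, one_mul, Nat.add_sub_cancel]
        rw [h2] at h1
        have h3 := hK ((j+1)*k') (Nat.mul_pos (by omega) (by omega))
        have h4 : ((j+1)^(D+1) : ℕ) ≤ j^(D+1) + (D+1) * (j+1)^D := by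
          clear * -
          induction D with
          | zero => simp
          | succ D ih =>
            have : j ^ (D+1) ≤ (j+1)^(D+1) := Nat.pow_le_pow_left (by omega) _
            calc (j+1)^(D+1+1) = (j+1) * (j+1)^(D+1) := by ring
              _ ≤ (j+1) * (j^(D+1) + (D+1) * (j+1)^D) := by gcongr
              _ = j^(D+1+1) + j^(D+1) + (D+1) * (j+1)^(D+1) := by ring
              _ ≤ _ := by nlinarith
        calc (((j+1)^(D+1) : ℕ) : ℕ∞) ≤ (j^(D+1) : ℕ) + (D+1 : ℕ) * (((j+1)*k')^D : ℕ) := by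
              have : (j+1)^D ≤ ((j+1)*k')^D := Nat.pow_le_pow_left (Nat.le_mul_of_pos_right _ (by omega)) _
              exact_mod_cast h4.trans (by gcongr)
          _ ≤ (K * (D+1) : ℕ) * hf P.1 (j * k') + (D+1 : ℕ) * (K * hf P'.1 ((j+1)*k')) := by gcongr
          _ = (K * (D+1) : ℕ) * (hf P.1 (j * k') + hf P'.1 ((j+1)*k')) := by push_cast; ring
          _ ≤ _ := by gcongr
    refine ⟨(K * (D+1) + 1) * (2*k')^(D+1), fun n hn => ?_⟩
    by_cases hnk : n < k'
    · calc ((n^(D+1) : ℕ) : ℕ∞) ≤ ((2*k')^(D+1) : ℕ) := by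
            exact_mod_cast Nat.pow_le_pow_left (by omega) _
        _ ≤ (((K * (D+1) + 1) * (2*k')^(D+1) : ℕ) : ℕ∞) := by
            exact_mod_cast Nat.le_mul_of_pos_left _ (by omega)
        _ = (((K * (D+1) + 1) * (2*k')^(D+1) : ℕ) : ℕ∞) * 1 := by rw [mul_one]
        _ ≤ _ := by gcongr; exact hone n hn
    · have hn2 : n ≤ 2 * k' * (n / k') := by
        have h1 := Nat.div_add_mod n k'
        have h2 := Nat.mod_lt n (show k' > 0 by omega)
        have h3 : k' ≤ k' * (n / k') := Nat.le_mul_of_pos_right _ (Nat.div_pos (by omega) (by omega))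
        nlinarith
      calc ((n^(D+1) : ℕ) : ℕ∞) ≤ ((2*k')^(D+1) * (n/k')^(D+1) : ℕ) := by
            rw [← mul_pow]; exact_mod_cast Nat.pow_le_pow_left hn2 _
        _ = ((2*k')^(D+1) : ℕ) * (((n/k')^(D+1) : ℕ) : ℕ∞) := by push_cast; rfl
        _ ≤ ((2*k')^(D+1) : ℕ) * ((K * (D+1) : ℕ) * hf P.1 (n/k' * k')) := by gcongr; exact hmul _
        _ ≤ ((2*k')^(D+1) : ℕ) * ((K * (D+1) + 1 : ℕ) * hf P.1 n) := by
            gcongr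
            · omega
            · exact hf_mono (Nat.div_mul_le_self _ _)
        _ = _ := by push_cast; ring

lemma hilbert_lower' (D : ℕ) (hD : (D : WithBot ℕ∞) ≤ ringKrullDim A) :
    ∃ K : ℕ, ∀ n ≥ 1, ((n ^ D : ℕ) : ℕ∞) ≤ K * Module.length A (A ⧸ maximalIdeal A ^ n) := by
  obtain ⟨P, hP⟩ : ∃ P : PrimeSpectrum A, (D : ℕ∞) ≤ Order.coheight P := by
    obtain ⟨l, hl⟩ := Order.le_krullDim_iff.1 hD
    exact ⟨l.head, hl ▸ Order.length_le_coheight_head⟩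
  obtain ⟨K, hK⟩ := hilbert_lower D P hP
  exact ⟨K, fun n hn => (hK n hn).trans (by gcongr; exact length_quot_mono le_sup_right)⟩

end hilbert
namespace FC
section
variable {A : Type} [CommRing A] [IsNoetherianRing A] [IsLocalRing A]
open IsLocalRing

lemma hl_zero_ge (G : FC A) (a : G.ι) (ha : G.deg a = 0) (n : ℕ)
    (hd : ∀ j, G.d a j ∈ maximalIdeal A ^ n) :
    Module.length A (A ⧸ maximalIdeal A ^ n) ≤ G.hl A 0 := by
  let f : (G.ι → A) →ₗ[A] (A ⧸ maximalIdeal A ^ n) := (Submodule.mkQ _).comp (LinearMap.proj a)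
  let f' : G.Z A 0 →ₗ[A] (A ⧸ maximalIdeal A ^ n) := f.comp (Submodule.subtype _)
  have h : (G.Bd A 0).submoduleOf (G.Z A 0) ≤ LinearMap.ker f' := by
    rintro ⟨z, hz⟩ ⟨w, hw, hw'⟩
    change D G A w = z at hw'
    change Ideal.Quotient.mk _ (z a) = 0
    rw [Ideal.Quotient.eq_zero_iff_mem, ← hw', mact_apply]
    exact Ideal.sum_mem _ fun j _ => Ideal.mul_mem_right _ _ (hd j)
  refine Module.length_le_of_surjective (Submodule.liftQ _ f' h) ?_
  intro y
  obtain ⟨y, rfl⟩ := Ideal.Quotient.mk_surjective y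
  have hz : (Pi.single a y : G.ι → A) ∈ G.supp A 0 := by
    intro i hi
    rw [Pi.single_apply, if_neg]
    rintro rfl; exact hi ha
  refine ⟨Submodule.Quotient.mk ⟨Pi.single a y, G.mem_Z.2 ⟨hz, G.D_supp_zero hz⟩⟩, ?_⟩
  change Ideal.Quotient.mk _ ((Pi.single a y : G.ι → A) a) = _
  simp

variable (p : ℕ) [Fact p.Prime] [CharP A p]

lemma frob_zero_ge (F : FC A) (a : F.ι) (ha : F.deg a = 0)
    (hd : ∀ j, F.d a j ∈ maximalIdeal A) (e : ℕ) :
    Module.length A (A ⧸ maximalIdeal A ^ (p ^ e)) ≤ (F.frob p e).hl A 0 := by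
  refine (F.frob p e).hl_zero_ge a ha _ fun j => ?_
  change iterateFrobenius A p e (F.d a j) ∈ _
  rw [iterateFrobenius_def]
  exact Ideal.pow_mem_pow (hd j) _

/-- Asymptotic form: over a ring of dimension `≥ D ≥ s`... the zeroth homology dominates. -/
lemma frob_asymp (F : FC A) (s : ℕ) (hs : ∀ i, F.deg i ≤ s)
    (hF : ∀ x ∈ maximalIdeal A, ∃ M : ℕ, F.NullHtp (x ^ M))
    (a : F.ι) (ha : F.deg a = 0) (hd : ∀ j, F.d a j ∈ maximalIdeal A)
    (r : ℕ) (hr : ringKrullDim A = r) :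
    ∃ C K : ℕ, (∀ e j, s < j + r → (p ^ e : ℕ) * (F.frob p e).hl A j ≤ C * (p ^ e : ℕ) ^ r) ∧
      (∀ e j, (F.frob p e).hl A j ≤ C * (p ^ e : ℕ) ^ r) ∧
      (∀ e, ((p ^ e : ℕ) : ℕ∞) ^ r ≤ K * (F.frob p e).hl A 0) := by
  obtain ⟨C, hC⟩ := F.Bnd_all p s hs hF r A (by rw [Module.supportDim_self_eq_ringKrullDim, hr])
  obtain ⟨K, hK⟩ := hilbert_lower' (A := A) r hr.ge
  refine ⟨C, K, fun e j => (hC e j).2, fun e j => (hC e j).1, fun e => ?_⟩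
  have hp : 0 < p := (Fact.out : p.Prime).pos
  refine le_trans ?_ ((hK (p ^ e) (Nat.pos_of_ne_zero (by positivity))).trans ?_)
  · push_cast; rfl
  · gcongr; exact F.frob_zero_ge p a ha hd e

/-- New intersection theorem in characteristic `p`. -/
theorem nit_charP (p : ℕ) [Fact p.Prime] [CharP A p] (F : FC A) (s : ℕ) (hs : ∀ i, F.deg i ≤ s)
    (hF : ∀ x ∈ maximalIdeal A, ∃ M : ℕ, F.NullHtp (x ^ M))
    (a : F.ι) (ha : F.deg a = 0) (hd : ∀ j, F.d a j ∈ maximalIdeal A) :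
    ringKrullDim A ≤ s := by
  obtain ⟨r, hr⟩ : ∃ r : ℕ, ringKrullDim A = r := by
    have h1 : ringKrullDim A ≠ ⊤ := ringKrullDim_ne_top
    have h2 : ringKrullDim A ≠ ⊥ := ringKrullDim_ne_bot
    obtain ⟨u, hu⟩ := WithBot.ne_bot_iff_exists.1 h2
    rw [← hu] at h1 ⊢
    have h3 : u ≠ ⊤ := fun h => h1 (by rw [h]; rfl)
    obtain ⟨v, rfl⟩ := ENat.ne_top_iff_exists.1 h3
    exact ⟨v, rfl⟩
  obtain ⟨C, K, h1, -, h2⟩ := F.frob_asymp p s hs hF a ha hd r hr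
  rw [hr]
  by_contra hcon
  have hcon : s < r := by
    have : ¬ (r ≤ s) := fun h => hcon (by exact_mod_cast h)
    omega
  have h3 : ∀ e, p ^ e ≤ K * C := by
    intro e
    have hp : 0 < p := (Fact.out : p.Prime).pos
    have h4 : ((p ^ e : ℕ) : ℕ∞) * ((p ^ e : ℕ) : ℕ∞) ^ r ≤ (K * C) * ((p ^ e : ℕ) : ℕ∞) ^ r := by
      calc _ ≤ ((p ^ e : ℕ) : ℕ∞) * (K * (F.frob p e).hl A 0) := by gcongr; exact h2 e
        _ = K * (((p ^ e : ℕ) : ℕ∞) * (F.frob p e).hl A 0) := by ring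
        _ ≤ K * (C * (p ^ e : ℕ) ^ r) := mul_le_mul_right (h1 e 0 (by omega)) _
        _ = _ := by ring
    have h5 : p ^ e * (p ^ e) ^ r ≤ (K * C) * (p ^ e) ^ r := by exact_mod_cast h4
    exact Nat.le_of_mul_le_mul_right h5 (by positivity)
  have h4 := h3 (K * C)
  have h5 := Nat.lt_pow_self (n := K * C) (Fact.out : p.Prime).one_lt
  omega

end
end FC
end NIT

-- Part 2

namespace NIT

/-- `w = e + κ G(w)` is always solvable, and `1+κt` is a unit. -/
def HenselAt {S : Type} [CommRing S] (κ : S) : Prop :=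
  (∀ t : S, IsUnit (1 + κ * t)) ∧ ∀ (e : S) (G : Polynomial S), ∃ w, w = e + κ * G.eval w

/-- Approximation property of a ring homomorphism. -/
def PropB {R0 L : Type} [CommRing R0] [CommRing L] (ev : R0 →+* L) : Prop :=
  ∃ δ : R0, ev δ ≠ 0 ∧ ∃ M : ℕ, ∀ (S : Type) [CommRing S] [IsDomain S] (κ : S), HenselAt κ →
    ∀ a : S, a ≠ 0 → ∀ N : ℕ, ∀ θ : R0 →+* S, (∀ r, ev r = 0 → a ^ (M + N) * κ ∣ θ r) →
      θ δ ∣ a → ∃ θ' : R0 →+* S, (∀ r, a ^ N * κ ∣ θ' r - θ r) ∧ ∀ r, ev r = 0 → θ' r = 0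

lemma propB_int {L : Type} [CommRing L] [Nontrivial L] [CharZero L] (ev : ℤ →+* L) : PropB ev := by
  refine ⟨1, by simp, 0, fun S _ _ κ _ a _ N θ h _ => ⟨θ, by simp, fun r hr => ?_⟩⟩
  have : r = 0 := by
    have : ev r = (r : L) := by simp
    rw [this] at hr
    exact_mod_cast hr
  simp [this]

lemma propB_equiv {R0 R1 L : Type} [CommRing R0] [CommRing R1] [CommRing L] (ev : R0 →+* L)
    (E : R1 ≃+* R0) (h : PropB ev) : PropB (ev.comp (E : R1 →+* R0)) := by
  obtain ⟨δ, hδ, M, H⟩ := h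
  refine ⟨E.symm δ, by simpa using hδ, M, fun S _ _ κ hκ a ha N θ h1 h2 => ?_⟩
  obtain ⟨θ', h3, h4⟩ := H S κ hκ a ha N (θ.comp (E.symm : R0 →+* R1))
    (fun r hr => by simpa using h1 (E.symm r) (by simpa using hr)) (by simpa using h2)
  refine ⟨θ'.comp (E : R1 →+* R0), fun r => ?_, fun r hr => ?_⟩
  · simpa using h3 (E r)
  · simpa using h4 (E r) (by simpa using hr)

open Polynomial in
lemma eval2_congr {R S : Type} [CommRing R] [CommRing S] (f g : R →+* S) (x y c : S)
    (h : ∀ r, c ∣ f r - g r) (hxy : c ∣ x - y) (p : R[X]) : c ∣ p.eval₂ f x - p.eval₂ g y := by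
  rw [← Ideal.mem_span_singleton, ← Ideal.Quotient.eq] at hxy ⊢
  have hfg : (Ideal.Quotient.mk (Ideal.span {c})).comp f = (Ideal.Quotient.mk (Ideal.span {c})).comp g := by
    ext r
    have := h r
    rw [← Ideal.mem_span_singleton, ← Ideal.Quotient.eq] at this
    exact this
  rw [hom_eval₂, hom_eval₂, hxy, hfg]

open Polynomial in
/-- all polynomial relations of small degree are trivial -/
lemma coeff_ker_of_lt {R L : Type} [CommRing R] [CommRing L] (ev : R →+* L) (y : L) (k : ℕ)
    (hk : ∀ q : R[X], q.eval₂ ev y = 0 → ev q.leadingCoeff ≠ 0 → k ≤ q.natDegree) :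
    ∀ (n : ℕ) (q : R[X]), q.natDegree = n → q.natDegree < k → q.eval₂ ev y = 0 → ∀ i, ev (q.coeff i) = 0 := by
  intro n
  induction n using Nat.strong_induction_on with
  | _ n ih =>
    intro q hq hlt h0 i
    have hl : ev q.leadingCoeff = 0 := by
      by_contra hc
      exact absurd (hk q h0 hc) (by omega)
    rcases Nat.eq_zero_or_pos n with hn | hn
    · rw [eq_C_of_natDegree_eq_zero (hq.trans hn)] at hl ⊢
      rw [leadingCoeff_C] at hl
      rw [coeff_C]; split_ifs <;> simp [hl]
    · have h1 : q.eraseLead.eval₂ ev y = 0 := by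
        have := congrArg (eval₂ ev y) q.eraseLead_add_monomial_natDegree_leadingCoeff
        rw [eval₂_add, eval₂_monomial, hl, zero_mul, add_zero] at this
        rw [this, h0]
      have hd : q.eraseLead.natDegree < n := by
        have := q.eraseLead_natDegree_le
        omega
      have := ih _ hd q.eraseLead rfl (by omega) h1 i
      rw [eraseLead_coeff] at this
      split_ifs at this with hi
      · rw [hi]; exact hl
      · exact this

open Polynomial in
lemma ker_of_root {R L S : Type} [CommRing R] [CommRing L] [CommRing S] [IsDomain S]
    (ev : R →+* L) (y : L) (q : R[X]) (hq : q.eval₂ ev y = 0)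
    (hk : ∀ q' : R[X], q'.eval₂ ev y = 0 → ev q'.leadingCoeff ≠ 0 → q.natDegree ≤ q'.natDegree)
    (φ : R →+* S) (hφ : ∀ r, ev r = 0 → φ r = 0) (η : S) (hη : q.eval₂ φ η = 0)
    (hl : φ q.leadingCoeff ≠ 0) :
    ∀ (n : ℕ) (r : R[X]), r.natDegree = n → r.eval₂ ev y = 0 → r.eval₂ φ η = 0 := by
  intro n
  induction n using Nat.strong_induction_on with
  | _ n ih =>
    intro r hr h0
    have hsmall : ∀ r : R[X], r.eval₂ ev y = 0 → r.natDegree < q.natDegree → r.eval₂ φ η = 0 := by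
      intro r h0 hlt
      rw [eval₂_eq_sum_range]
      refine Finset.sum_eq_zero fun i _ => ?_
      rw [hφ _ (coeff_ker_of_lt ev y _ hk _ r rfl hlt h0 i), zero_mul]
    rcases lt_or_ge r.natDegree q.natDegree with hlt | hge
    · exact hsmall r h0 hlt
    · set t : R[X] := C q.leadingCoeff * r - C r.leadingCoeff * X ^ (r.natDegree - q.natDegree) * q with ht
      have ht0 : t.eval₂ ev y = 0 := by
        simp [ht, eval₂_sub, eval₂_mul, h0, hq]
      have htη : t.eval₂ φ η = φ q.leadingCoeff * r.eval₂ φ η := by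
        simp [ht, eval₂_sub, eval₂_mul, hη]
      have hdeg : t.natDegree ≤ r.natDegree := by
        refine (natDegree_sub_le _ _).trans (max_le ?_ ?_)
        · exact natDegree_C_mul_le _ _
        · refine natDegree_mul_le.trans ?_
          have := natDegree_C_mul_X_pow_le r.leadingCoeff (r.natDegree - q.natDegree)
          omega
      have hc : t.coeff r.natDegree = 0 := by
        rw [ht, coeff_sub, coeff_C_mul, mul_assoc, coeff_C_mul]
        have : (X ^ (r.natDegree - q.natDegree) * q).coeff r.natDegree = q.leadingCoeff := by
          conv_lhs => rw [show r.natDegree = q.natDegree + (r.natDegree - q.natDegree) by omega]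
          rw [show q.natDegree + (r.natDegree - q.natDegree) - q.natDegree = r.natDegree - q.natDegree by omega, coeff_X_pow_mul]
          rfl
        rw [this]; change _ * r.leadingCoeff - _ = 0; ring
      have key : t.eval₂ φ η = 0 := by
        rcases Nat.eq_zero_or_pos n with hn | hn
        · have : t.natDegree = 0 := by omega
          rw [eq_C_of_natDegree_eq_zero this]
          have h2 : r.natDegree = 0 := by omega
          rw [h2] at hc
          simp [hc]
        · refine ih t.natDegree ?_ t rfl ht0
          rcases Nat.lt_or_ge t.natDegree n with h | h
          · exact h
          · have h3 : t.natDegree = r.natDegree := by omega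
            have : t = 0 := by
              rw [← leadingCoeff_eq_zero, leadingCoeff, h3, hc]
            rw [this, natDegree_zero] at h3
            omega
      rw [htη] at key
      exact (mul_eq_zero.1 key).resolve_left hl

open Polynomial in
lemma propB_poly {R0 L : Type} [CommRing R0] [CommRing L] [IsDomain L] [CharZero L] (ev : R0 →+* L)
    (h : PropB ev) (y : L) : PropB (Polynomial.eval₂RingHom ev y) := by
  classical
  obtain ⟨δ, hδ, M, H⟩ := h
  by_cases hex : ∃ k : ℕ, ∃ q : R0[X], q.natDegree = k ∧ q.eval₂ ev y = 0 ∧ ev q.leadingCoeff ≠ 0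
  · obtain ⟨q, hqk, hq, hl⟩ := Nat.find_spec hex
    have hk : ∀ q' : R0[X], q'.eval₂ ev y = 0 → ev q'.leadingCoeff ≠ 0 → q.natDegree ≤ q'.natDegree := by
      intro q' h1 h2
      rw [hqk]
      exact Nat.find_min' hex ⟨q', rfl, h1, h2⟩
    have hpos : 0 < q.natDegree := by
      by_contra hc
      have h0 : q.natDegree = 0 := by omega
      rw [eq_C_of_natDegree_eq_zero h0] at hq hl
      simp at hq hl
      exact hl hq
    have hder : q.derivative.eval₂ ev y ≠ 0 := by
      intro hc
      have := coeff_ker_of_lt ev y _ hk _ q.derivative rfl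
        (natDegree_derivative_lt (by omega)) hc (q.natDegree - 1)
      rw [coeff_derivative, Nat.sub_add_cancel hpos] at this
      rw [map_mul] at this
      rcases mul_eq_zero.1 this with h | h
      · exact hl h
      · simp only [map_add, map_natCast, map_one] at h
        exact absurd h (by exact_mod_cast Nat.succ_ne_zero (q.natDegree - 1))
    refine ⟨C δ * C q.leadingCoeff * q.derivative, ?_, M + 2, ?_⟩
    · simp only [map_mul, coe_eval₂RingHom, eval₂_C]
      exact mul_ne_zero (mul_ne_zero hδ hl) hder
    intro S _ _ κ hκ a ha N θ h1 h2
    set θ0 : R0 →+* S := θ.comp C with hθ0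
    have hθ : ∀ p : R0[X], θ p = p.eval₂ θ0 (θ X) := by
      intro p
      have : θ = eval₂RingHom θ0 (θ X) := by
        ext <;> simp [hθ0]
      conv_lhs => rw [this]
      rfl
    simp only [map_mul] at h2
    have hd1 : θ0 δ ∣ a := (Dvd.intro _ (mul_assoc _ _ _).symm).trans h2
    have hd2 : θ0 q.leadingCoeff ∣ a := (Dvd.intro_left _ rfl : _ ∣ θ (C δ) * θ (C q.leadingCoeff)).trans ((Dvd.intro _ rfl).trans h2)
    have hd3 : θ q.derivative ∣ a := (Dvd.intro_left _ rfl).trans h2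
    obtain ⟨θ1, h3, h4⟩ := H S κ hκ a ha (N + 2) θ0 (fun r hr => by
      have := h1 (C r) (by simpa using hr)
      rwa [show M + 2 + N = M + (N + 2) by ring] at this) hd1
    set η := θ X with hη
    set f := q.map θ1 with hf
    have hcong : ∀ p : R0[X], a ^ (N + 2) * κ ∣ p.eval₂ θ1 η - θ p := by
      intro p; rw [hθ]
      exact eval2_congr _ _ _ _ _ h3 (by simp) p
    -- perturbation of divisors of `a`
    have hpert : ∀ u v : S, a ^ (N + 2) * κ ∣ u - v → v ∣ a → u ∣ a := by
      rintro u v ⟨t, ht⟩ ⟨c, hc⟩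
      obtain ⟨w, hw⟩ := hκ.1 (c * a ^ (N + 1) * t)
      have hu : u = v * w := by
        rw [hw]
        calc u = v + a ^ (N + 2) * κ * t := by rw [← ht]; ring
          _ = v + a * (a ^ (N+1) * κ * t) := by ring
          _ = v + (v * c) * (a ^ (N+1) * κ * t) := by rw [← hc]
          _ = _ := by ring
      rw [hu]
      exact (Units.mul_right_dvd).2 (Dvd.intro c hc.symm)
    have hD : q.derivative.eval₂ θ1 η ∣ a := hpert _ _ (hcong _) hd3
    have hl1 : θ1 q.leadingCoeff ∣ a := hpert _ _ (h3 _) hd2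
    have hl1' : θ1 q.leadingCoeff ≠ 0 := fun h => ha (by rwa [h, zero_dvd_iff] at hl1)
    set Dv := q.derivative.eval₂ θ1 η with hDv
    have hDf : f.derivative.eval η = Dv := by
      rw [hf, derivative_map, Polynomial.eval_map]
    have hfη : a ^ (N + 2) * κ ∣ f.eval η := by
      rw [hf, Polynomial.eval_map]
      have e1 := hcong q
      have e2 : a ^ (N + 2) * κ ∣ θ q := by
        refine dvd_trans ?_ (h1 q hq)
        exact mul_dvd_mul (pow_dvd_pow _ (by omega)) dvd_rfl
      exact (dvd_sub_left e2).1 e1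
    obtain ⟨t0, ht0⟩ := hfη
    obtain ⟨c, hc⟩ := hD
    -- Taylor expansion
    obtain ⟨G, hG⟩ : ∃ G : S[X], ∀ z : S, f.eval (η + z) = f.eval η + f.derivative.eval η * z + z ^ 2 * G.eval z := by
      refine ⟨(taylor η f).divX.divX, fun z => ?_⟩
      have e := congrArg (eval z) (taylor η f).divX_mul_X_add
      have e' := congrArg (eval z) (taylor η f).divX.divX_mul_X_add
      simp only [eval_add, eval_mul, eval_X, eval_C] at e e'
      have e0 : (taylor η f).coeff 0 = f.eval η := taylor_coeff_zero η f
      have e1 : (taylor η f).divX.coeff 0 = f.derivative.eval η := by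
        rw [coeff_divX, zero_add, taylor_coeff_one]
      rw [e0] at e
      rw [e1] at e'
      have e2 : eval z (taylor η f) = f.eval (η + z) := by
        rw [taylor_eval, add_comm]
      rw [e2] at e
      rw [← e, ← e']
      ring
    obtain ⟨w, hw⟩ := hκ.2 (- (c ^ 2 * t0)) (- (C (a ^ N) * X ^ 2 * G.comp (C (Dv * (a ^ N * κ)) * X)))
    simp only [eval_neg, eval_mul, eval_C, eval_pow, eval_X, eval_comp] at hw
    have hroot : f.eval (η + Dv * (a ^ N * κ) * w) = 0 := by
      rw [hG, hDf, ht0]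
      have : a ^ (N + 2) * κ * t0 = Dv ^ 2 * (a ^ N * κ) * (c ^ 2 * t0) := by
        have : a ^ (N + 2) = Dv ^ 2 * c ^ 2 * a ^ N := by rw [pow_add, hc]; ring
        rw [this]; ring
      rw [this]
      set g := eval (Dv * (a ^ N * κ) * w) G
      linear_combination (Dv ^ 2 * (a ^ N * κ)) * hw
    refine ⟨eval₂RingHom θ1 (η + Dv * (a ^ N * κ) * w), fun r => ?_, fun r hr => ?_⟩
    · rw [hθ r, coe_eval₂RingHom]
      refine eval2_congr _ _ _ _ _ (fun r => dvd_trans ?_ (h3 r)) ?_ r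
      · exact mul_dvd_mul (pow_dvd_pow _ (by omega)) dvd_rfl
      · exact ⟨Dv * w, by ring⟩
    · refine ker_of_root ev y q hq hk θ1 h4 _ ?_ hl1' _ r rfl hr
      rw [← Polynomial.eval_map]; exact hroot
  · push Not at hex
    have hco : ∀ r : R0[X], r.eval₂ ev y = 0 → ∀ i, ev (r.coeff i) = 0 := by
      intro r hr
      refine coeff_ker_of_lt ev y (r.natDegree + 1) (fun q h1 h2 => absurd (hex _ q rfl h1) h2) _ r rfl (by omega) hr
    refine ⟨C δ, by simpa using hδ, M, ?_⟩
    intro S _ _ κ hκ a ha N θ h1 h2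
    obtain ⟨θ1, h3, h4⟩ := H S κ hκ a ha N (θ.comp C) (fun r hr => h1 (C r) (by simpa using hr)) h2
    refine ⟨eval₂RingHom θ1 (θ X), fun r => ?_, fun r hr => ?_⟩
    · have : θ r = r.eval₂ (θ.comp C) (θ X) := by
        have : θ = eval₂RingHom (θ.comp C) (θ X) := by
          ext <;> simp
        conv_lhs => rw [this]
        rfl
      rw [this, coe_eval₂RingHom]
      exact eval2_congr _ _ _ _ _ h3 (by simp) r
    · rw [coe_eval₂RingHom, eval₂_eq_sum_range]
      refine Finset.sum_eq_zero fun i _ => ?_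
      rw [h4 _ (hco r hr i), zero_mul]

lemma propB_mv {L : Type} [CommRing L] [IsDomain L] [CharZero L] (n : ℕ)
    (ev : MvPolynomial (Fin n) ℤ →+* L) : PropB ev := by
  induction n with
  | zero =>
    have := propB_equiv (Int.castRingHom L) (MvPolynomial.isEmptyRingEquiv ℤ (Fin 0)) (propB_int _)
    convert this using 1
    apply MvPolynomial.ringHom_ext
    · intro r; simp
    · intro i; exact i.elim0
  | succ n ih =>
    have := propB_equiv _ ((MvPolynomial.finSuccEquiv ℤ n).toRingEquiv)
      (propB_poly (ev.comp (MvPolynomial.rename Fin.succ).toRingHom) (ih _) (ev (MvPolynomial.X 0)))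
    convert this using 1
    apply MvPolynomial.ringHom_ext
    · intro r; simp
    · intro i
      refine Fin.cases ?_ (fun i => ?_) i <;> simp [MvPolynomial.finSuccEquiv_X_zero, MvPolynomial.finSuccEquiv_X_succ]

end NIT

-- Part 3

namespace NIT
open IsLocalRing

lemma henselAt_of_complete {S : Type} [CommRing S] (I : Ideal S) [IsAdicComplete I S] (κ : S)
    (hκ : κ ∈ I) : HenselAt κ := by
  constructor
  · intro t
    have h1 : κ * t ∈ I := I.mul_mem_right _ hκ
    have h2 := IsAdicComplete.le_jacobson_bot I h1
    rw [Ideal.mem_jacobson_bot] at h2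
    simpa [add_comm] using h2 1
  · intro e G
    let w : ℕ → S := fun n => Nat.rec e (fun _ x => e + κ * G.eval x) n
    have hw : ∀ n, w (n + 1) = e + κ * G.eval (w n) := fun n => rfl
    have hstep : ∀ n, w (n + 1) - w n ∈ I ^ n := by
      intro n
      induction n with
      | zero => simp
      | succ n ih =>
        rw [hw (n + 1)]
        conv in (_ - w (n + 1)) => rw [hw n]
        have : e + κ * G.eval (w (n + 1)) - (e + κ * G.eval (w n)) =
          κ * (G.eval (w (n + 1)) - G.eval (w n)) := by ring
        rw [this, pow_succ']
        obtain ⟨c, hc⟩ := G.sub_dvd_eval_sub (w (n + 1)) (w n)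
        rw [hc]
        exact Ideal.mul_mem_mul hκ (Ideal.mul_mem_right _ _ ih)
    have hcau : ∀ {m n}, m ≤ n → w m ≡ w n [SMOD (I ^ m • ⊤ : Submodule S S)] := by
      intro m n hmn
      induction n, hmn using Nat.le_induction with
      | base => rfl
      | succ n hmn ih =>
        refine ih.trans ?_
        symm
        rw [SModEq.sub_mem]
        simp only [smul_eq_mul, Ideal.mul_top]
        exact Ideal.pow_le_pow_right hmn (hstep n)
    obtain ⟨x, hx⟩ := IsPrecomplete.prec (I := I) inferInstance hcau
    refine ⟨x, ?_⟩
    have : x - (e + κ * G.eval x) = 0 := by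
      refine IsHausdorff.haus (I := I) inferInstance _ fun n => ?_
      have h1 := hx (n + 1)
      have h2 := hx n
      rw [SModEq.sub_mem] at h1 h2
      rw [SModEq.zero]
      simp only [smul_eq_mul, Ideal.mul_top] at h1 h2 ⊢
      have : x - (e + κ * G.eval x) = -(w (n + 1) - x) + κ * (G.eval (w n) - G.eval x) := by
        rw [hw]; ring
      rw [this]
      refine Ideal.add_mem _ (neg_mem (Ideal.pow_le_pow_right (Nat.le_succ n) h1)) ?_
      obtain ⟨c, hc⟩ := G.sub_dvd_eval_sub (w n) x
      rw [hc]
      exact Ideal.mul_mem_left _ _ (Ideal.mul_mem_right _ _ h2)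
    exact sub_eq_zero.1 this

lemma mvps_mem_span {K : Type} [CommRing K] : ∀ (d : ℕ) (F : MvPowerSeries (Fin d) K),
    MvPowerSeries.constantCoeff F = 0 → F ∈ Ideal.span (Set.range (MvPowerSeries.X : Fin d → MvPowerSeries (Fin d) K)) := by
  intro d
  induction d with
  | zero =>
    intro F hF
    have : F = 0 := by
      ext m
      have : m = 0 := Subsingleton.elim _ _
      rw [this]
      simpa using hF
    rw [this]; exact zero_mem _
  | succ d ih =>
    intro F hF
    set E := MvPowerSeries.finSuccEquiv K d
    have h0 : MvPowerSeries.constantCoeff (PowerSeries.coeff 0 (E F)) = 0 := by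
      rw [← MvPowerSeries.coeff_zero_eq_constantCoeff_apply, MvPowerSeries.coeff_coeff_finSuccEquiv]
      simpa using hF
    have h1 := ih _ h0
    have h2 : E F = PowerSeries.X * PowerSeries.mk (fun p => PowerSeries.coeff (p + 1) (E F))
        + PowerSeries.C (PowerSeries.coeff 0 (E F)) := by
      simpa using PowerSeries.eq_X_mul_shift_add_const (E F)
    have h3 : F = MvPowerSeries.X 0 * E.symm (PowerSeries.mk (fun p => PowerSeries.coeff (p + 1) (E F)))
        + E.symm (PowerSeries.C (PowerSeries.coeff 0 (E F))) := by
      apply E.injective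
      simp only [map_add, map_mul, AlgEquiv.apply_symm_apply]
      rw [MvPowerSeries.finSuccEquiv_X_zero]
      exact h2
    rw [h3]
    refine Ideal.add_mem _ (Ideal.mul_mem_right _ _ (Ideal.subset_span ⟨0, rfl⟩)) ?_
    have h4 := Ideal.mem_map_of_mem ((E.symm : _ →+* MvPowerSeries (Fin (d + 1)) K).comp PowerSeries.C) h1
    rw [Ideal.map_span, ← Set.range_comp] at h4
    refine Ideal.span_mono ?_ h4
    rintro _ ⟨i, rfl⟩
    refine ⟨i.succ, ?_⟩
    simp only [Function.comp_apply, RingHom.comp_apply]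
    change _ = E.symm _
    rw [AlgEquiv.eq_symm_apply]
    exact MvPowerSeries.finSuccEquiv_X_succ i

lemma mvps_maximalIdeal {K : Type} [Field K] (d : ℕ) : maximalIdeal (MvPowerSeries (Fin d) K) =
    Ideal.span (Set.range (MvPowerSeries.X : Fin d → MvPowerSeries (Fin d) K)) := by
  apply le_antisymm
  · intro F hF
    apply mvps_mem_span
    by_contra h
    rw [mem_maximalIdeal, mem_nonunits_iff, MvPowerSeries.isUnit_iff_constantCoeff] at hF
    exact hF (isUnit_iff_ne_zero.2 h)
  · rw [Ideal.span_le]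
    rintro _ ⟨i, rfl⟩
    rw [SetLike.mem_coe, mem_maximalIdeal, mem_nonunits_iff, MvPowerSeries.isUnit_iff_constantCoeff]
    simp

instance mvps_complete {K : Type} [Field K] (d : ℕ) :
    IsAdicComplete (maximalIdeal (MvPowerSeries (Fin d) K)) (MvPowerSeries (Fin d) K) := by
  rw [mvps_maximalIdeal]; infer_instance

/-- generic coordinate change -/
lemma exists_coord {K : Type} [Field K] [Infinite K] (d : ℕ) (f : MvPowerSeries (Fin (d + 1)) K) (hf : f ≠ 0) :
    ∃ (α : MvPowerSeries (Fin (d + 1)) K →+* PowerSeries (MvPowerSeries (Fin d) K)) (c : Fin (d + 1) → K),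
      c 0 ≠ 0 ∧ α (MvPowerSeries.X 0) = PowerSeries.C (MvPowerSeries.C (c 0)) * PowerSeries.X ∧
      (∀ i : Fin d, α (MvPowerSeries.X i.succ) = PowerSeries.C (MvPowerSeries.X i)
        + PowerSeries.C (MvPowerSeries.C (c i.succ)) * PowerSeries.X) ∧
      (α f).map (residue (MvPowerSeries (Fin d) K)) ≠ 0 := by
  classical
  obtain ⟨m0, hm0⟩ : ∃ m, MvPowerSeries.coeff m f ≠ 0 := by
    by_contra h; push Not at h
    exact hf (MvPowerSeries.ext (by simpa using h))
  set k := m0.degree with hk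
  have hfin : Set.Finite {m : Fin (d + 1) →₀ ℕ | m.degree = k} := by
    exact (Finsupp.finite_of_degree_le (σ := Fin (d+1)) k).subset (fun m hm => le_of_eq hm)
  -- the homogeneous part
  set h : MvPolynomial (Fin (d + 1)) K := ∑ m ∈ hfin.toFinset, MvPolynomial.monomial m (MvPowerSeries.coeff m f) with hh
  have hh0 : h ≠ 0 := by
    intro hc
    have := congrArg (MvPolynomial.coeff m0) hc
    rw [hh, MvPolynomial.coeff_sum] at this
    simp only [MvPolynomial.coeff_monomial, MvPolynomial.coeff_zero] at this
    rw [Finset.sum_ite_eq' , if_pos (by simp [hk])] at this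
    exact hm0 this
  obtain ⟨c, hc⟩ : ∃ c, MvPolynomial.eval c (h * MvPolynomial.X 0) ≠ 0 := by
    by_contra hc; push Not at hc
    have : h * MvPolynomial.X 0 = 0 := MvPolynomial.funext (fun c => by simpa using hc c)
    exact mul_ne_zero hh0 (MvPolynomial.X_ne_zero 0) this
  rw [map_mul, MvPolynomial.eval_X] at hc
  have hc0 := right_ne_zero_of_mul hc
  have hch := left_ne_zero_of_mul hc
  let a : Fin (d + 1) → MvPowerSeries (Fin (d + 1)) K :=
    Fin.cons (MvPowerSeries.C (c 0) * MvPowerSeries.X 0)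
      (fun i => MvPowerSeries.X i.succ + MvPowerSeries.C (c i.succ) * MvPowerSeries.X 0)
  have ha : MvPowerSeries.HasSubst a := by
    refine MvPowerSeries.hasSubst_of_constantCoeff_zero fun i => ?_
    refine Fin.cases ?_ (fun i => ?_) i <;> simp [a]
  let γ : MvPowerSeries (Fin (d + 1)) K →+* PowerSeries K :=
    (PowerSeries.map (MvPowerSeries.constantCoeff)).comp
      (MvPowerSeries.finSuccEquiv K d : MvPowerSeries (Fin (d + 1)) K →+* PowerSeries (MvPowerSeries (Fin d) K))
  have hγ : ∀ F j, PowerSeries.coeff j (γ F) = MvPowerSeries.coeff (Finsupp.cons j 0) F := by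
    intro F j
    rw [← MvPowerSeries.coeff_coeff_finSuccEquiv]
    simp [γ]
  have hγa : ∀ i, γ (a i) = PowerSeries.C (c i) * PowerSeries.X := by
    intro i
    refine Fin.cases ?_ (fun i => ?_) i <;>
    simp [a, γ, MvPowerSeries.finSuccEquiv_X_zero, MvPowerSeries.finSuccEquiv_X_succ, MvPowerSeries.finSuccEquiv_C]
  refine ⟨(MvPowerSeries.finSuccEquiv K d : MvPowerSeries (Fin (d + 1)) K →+* PowerSeries (MvPowerSeries (Fin d) K)).comp
    (MvPowerSeries.substAlgHom ha (R := K)).toRingHom, c, hc0, ?_, fun i => ?_, ?_⟩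
  · change MvPowerSeries.finSuccEquiv K d (MvPowerSeries.substAlgHom ha (MvPowerSeries.X 0)) = _
    rw [MvPowerSeries.substAlgHom_X]
    simp [a, MvPowerSeries.finSuccEquiv_X_zero, MvPowerSeries.finSuccEquiv_C]
  · change MvPowerSeries.finSuccEquiv K d (MvPowerSeries.substAlgHom ha (MvPowerSeries.X i.succ)) = _
    rw [MvPowerSeries.substAlgHom_X]
    simp [a, MvPowerSeries.finSuccEquiv_X_zero, MvPowerSeries.finSuccEquiv_C, MvPowerSeries.finSuccEquiv_X_succ]
  · intro hz
    have h1 : PowerSeries.coeff k (γ (MvPowerSeries.subst a f)) = 0 := by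
      have := congrArg (PowerSeries.coeff k) hz
      rw [PowerSeries.coeff_map, map_zero, residue_eq_zero_iff] at this
      rw [mem_maximalIdeal, mem_nonunits_iff, MvPowerSeries.isUnit_iff_constantCoeff, isUnit_iff_ne_zero, not_not] at this
      simpa [γ, MvPowerSeries.coe_substAlgHom] using this
    rw [hγ, MvPowerSeries.coeff_subst ha] at h1
    have h2 : ∀ m : Fin (d + 1) →₀ ℕ, MvPowerSeries.coeff (Finsupp.cons k 0) (m.prod fun s e => a s ^ e) =
        if m.degree = k then m.prod (fun s e => c s ^ e) else 0 := by
      intro m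
      rw [← hγ, Finsupp.prod, map_prod]
      have : ∏ x ∈ m.support, γ (a x ^ m x) = PowerSeries.C (m.prod (fun s e => c s ^ e)) * PowerSeries.X ^ m.degree := by
        simp only [map_pow, hγa, mul_pow, Finset.prod_mul_distrib, Finset.prod_pow_eq_pow_sum]
        simp [Finsupp.prod, Finsupp.degree_apply]
      rw [this, PowerSeries.coeff_C_mul, PowerSeries.coeff_X_pow]
      simp [eq_comm]
    simp only [h2] at h1
    rw [finsum_eq_sum_of_support_subset (s := hfin.toFinset)] at h1
    · apply hch
      rw [hh, map_sum, ← h1]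
      refine Finset.sum_congr rfl fun m hm => ?_
      rw [if_pos (by simpa using hm), MvPolynomial.eval_monomial, smul_eq_mul]
    · intro m hm
      simp only [Function.mem_support] at hm
      simp only [Set.Finite.coe_toFinset, Set.mem_ofPred_eq]
      by_contra hne
      rw [if_neg hne] at hm
      simp at hm

end NIT

-- Part 4

namespace NIT
open IsLocalRing

/-- Specialization statement for subrings of power series rings, presented. -/
def TP (d : ℕ) : Prop :=
  ∀ (K : Type) [Field K] [CharZero K] (n : ℕ)
    (ev : MvPolynomial (Fin n) ℤ →+* MvPowerSeries (Fin d) K) (ξ : Fin d → MvPolynomial (Fin n) ℤ)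
    (_ : ∀ i, ev (ξ i) = MvPowerSeries.X i) (g : MvPolynomial (Fin n) ℤ) (_ : ev g ≠ 0),
    ∃ (S : Type) (_ : CommRing S) (_ : IsDomain S) (_ : IsLocalRing S) (_ : IsNoetherianRing S)
      (p : ℕ) (_ : Fact p.Prime) (_ : CharP S p), (d : WithBot ℕ∞) ≤ ringKrullDim S ∧
      ∃ θ : MvPolynomial (Fin n) ℤ →+* S, (∀ r, ev r = 0 → θ r = 0) ∧
        maximalIdeal S = Ideal.span (Set.range fun i => θ (ξ i)) ∧ θ g ≠ 0

lemma tp_sub {d : ℕ} (hT : TP d) (K : Type) [Field K] [CharZero K] (s : Finset (MvPowerSeries (Fin d) K))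
    (hX : ∀ i, MvPowerSeries.X i ∈ Algebra.adjoin ℤ (s : Set (MvPowerSeries (Fin d) K)))
    (g : Algebra.adjoin ℤ (s : Set (MvPowerSeries (Fin d) K))) (hg : g ≠ 0) :
    ∃ (S : Type) (_ : CommRing S) (_ : IsDomain S) (_ : IsLocalRing S) (_ : IsNoetherianRing S)
      (p : ℕ) (_ : Fact p.Prime) (_ : CharP S p), (d : WithBot ℕ∞) ≤ ringKrullDim S ∧
      ∃ θ : Algebra.adjoin ℤ (s : Set (MvPowerSeries (Fin d) K)) →+* S,
        maximalIdeal S = Ideal.span (Set.range fun i => θ ⟨_, hX i⟩) ∧ θ g ≠ 0 := by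
  classical
  let y : Fin s.card → MvPowerSeries (Fin d) K := fun i => (s.equivFin.symm i : MvPowerSeries (Fin d) K)
  have hy : Set.range y = (s : Set (MvPowerSeries (Fin d) K)) := by
    ext x; constructor
    · rintro ⟨i, rfl⟩; exact (s.equivFin.symm i).2
    · intro hx; exact ⟨s.equivFin ⟨x, hx⟩, by simp [y]⟩
  have hr : (MvPolynomial.aeval y : MvPolynomial (Fin s.card) ℤ →ₐ[ℤ] _).range = Algebra.adjoin ℤ (s : Set (MvPowerSeries (Fin d) K)) := by
    rw [← hy, Algebra.adjoin_range_eq_range_aeval]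
  have hmem : ∀ x : Algebra.adjoin ℤ (s : Set (MvPowerSeries (Fin d) K)), ∃ r : MvPolynomial (Fin s.card) ℤ, (MvPolynomial.aeval y r : MvPowerSeries (Fin d) K) = x.1 := by
    rintro ⟨x, hx⟩
    rw [← hr] at hx
    exact hx
  choose l hl using hmem
  obtain ⟨S, i1, i2, i3, i4, p, hp, hc, hdim, θ, h1, h2, h3⟩ := hT K s.card (MvPolynomial.aeval y).toRingHom
    (fun i => l ⟨_, hX i⟩) (fun i => by simpa using hl ⟨_, hX i⟩) (l g) (by
      intro h; apply hg; apply Subtype.ext; rw [← hl g]; exact h)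
  refine ⟨S, i1, i2, i3, i4, p, hp, hc, hdim, ?_⟩
  have hker : ∀ r r' : MvPolynomial (Fin s.card) ℤ, (MvPolynomial.aeval y r : MvPowerSeries (Fin d) K) = MvPolynomial.aeval y r' → θ r = θ r' := by
    intro r r' h
    rw [← sub_eq_zero, ← map_sub]
    refine h1 _ ?_
    change (MvPolynomial.aeval y (r - r') : MvPowerSeries (Fin d) K) = 0
    rw [map_sub, h, sub_self]
  refine ⟨{ toFun := fun x => θ (l x)
            map_one' := ?_
            map_zero' := ?_
            map_mul' := ?_
            map_add' := ?_ }, ?_, ?_⟩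
  · rw [← map_one θ]; apply hker; rw [hl]; simp
  · intro x x'; rw [← map_mul θ]; apply hker; rw [hl, map_mul, hl, hl]; simp
  · rw [← map_zero θ]; apply hker; rw [hl]; simp
  · intro x x'; rw [← map_add θ]; apply hker; rw [hl, map_add, hl, hl]; simp
  · exact h2
  · exact h3

instance jacobson_int : IsJacobsonRing ℤ := by
  rw [isJacobsonRing_iff_prime_eq]
  intro P hP
  by_cases h : P = ⊥
  · subst h
    refine le_antisymm ?_ Ideal.le_jacobson
    intro x hx
    by_contra hx0
    have hx0 : x ≠ 0 := hx0
    obtain ⟨p, hp1, hp⟩ := Nat.exists_infinite_primes (x.natAbs + 1)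
    have hpp : Prime (p : ℤ) := Nat.prime_iff_prime_int.1 hp
    have hm : (Ideal.span {(p : ℤ)}).IsMaximal := PrincipalIdealRing.isMaximal_of_irreducible hpp.irreducible
    have := (Ideal.mem_sInf.1 hx) ⟨bot_le, hm⟩
    rw [Ideal.mem_span_singleton] at this
    have h2 := Int.natAbs_dvd_natAbs.2 this
    have := Nat.le_of_dvd (Int.natAbs_pos.2 hx0) h2
    simp at this
    omega
  · haveI := hP.isMaximal h
    exact Ideal.jacobson_eq_self_of_isMaximal

lemma charP_of_finiteType (S : Type) [Field S] (hS : (Int.castRingHom S).FiniteType) :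
    ∃ p : ℕ, Fact p.Prime ∧ CharP S p := by
  have : Algebra.FiniteType ℤ S := RingHom.finiteType_algebraMap.1 hS
  have : Module.Finite ℤ S := finite_of_finite_type_of_isJacobsonRing ℤ S
  obtain ⟨p, hp⟩ := CharP.exists S
  have hp0 : p ≠ 0 := by
    rintro rfl
    have := CharP.charP_to_charZero S
    have : IsField ℤ := isField_of_isIntegral_of_isField (R := ℤ) (S := S) (RingHom.injective_int _) (Field.toIsField S)
    exact Int.not_isField this
  exact ⟨p, ⟨(CharP.char_is_prime_or_zero S p).resolve_right hp0⟩, hp⟩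

lemma tp_zero : TP 0 := by
  intro K _ _ n ev ξ _ g hg
  let D := MvPolynomial (Fin n) ℤ ⧸ RingHom.ker ev
  let gD : D := Ideal.Quotient.mk _ g
  have hgnil : ¬ IsNilpotent gD := by
    rintro ⟨k, hk⟩
    rw [← map_pow, Ideal.Quotient.eq_zero_iff_mem, RingHom.mem_ker, map_pow] at hk
    exact hg (eq_zero_of_pow_eq_zero hk)
  let W := Localization.Away gD
  haveI : Nontrivial W := by
    rw [← not_subsingleton_iff_nontrivial]
    intro h
    have h0 := (IsLocalization.subsingleton_iff (S := W) (M := Submonoid.powers gD)).1 h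
    obtain ⟨k, hk⟩ := h0
    exact hgnil ⟨k, hk⟩
  obtain ⟨m, hm⟩ := Ideal.exists_maximal W
  let S := W ⧸ m
  letI : Field S := Ideal.Quotient.field m
  have hS : (Int.castRingHom S).FiniteType := by
    have : Algebra.FiniteType ℤ W := by
      have : Algebra.FiniteType ℤ D := inferInstance
      have : Algebra.FiniteType D W := inferInstance
      exact Algebra.FiniteType.trans (S := D) inferInstance inferInstance
    have h2 : (algebraMap ℤ W).FiniteType := RingHom.finiteType_algebraMap.2 this
    have h3 := RingHom.FiniteType.comp_surjective h2 (Ideal.Quotient.mk_surjective (I := m))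
    convert h3 using 1
    exact RingHom.ext_int _ _
  obtain ⟨p, hpp, hp⟩ := charP_of_finiteType S hS
  let θ : MvPolynomial (Fin n) ℤ →+* S := (Ideal.Quotient.mk m).comp ((algebraMap D W).comp (Ideal.Quotient.mk _))
  refine ⟨S, inferInstance, inferInstance, inferInstance, inferInstance, p, inferInstance, hp, ?_, θ, ?_, ?_, ?_⟩
  · simp [ringKrullDim_eq_zero_of_field]
  · intro r hr
    have : (Ideal.Quotient.mk (RingHom.ker ev)) r = 0 := by
      rw [Ideal.Quotient.eq_zero_iff_mem]; exact hr
    simp [θ, this]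
  · simp [IsLocalRing.maximalIdeal_eq_bot, Set.range_eq_empty]
  · have : IsUnit (θ g) := by
      refine IsUnit.map (Ideal.Quotient.mk m) ?_
      exact IsLocalization.Away.algebraMap_isUnit gD
    exact this.ne_zero

end NIT

-- Part 5

namespace NIT
open IsLocalRing

lemma henselAt_X_sq (S : Type) [CommRing S] : HenselAt ((PowerSeries.X : PowerSeries S) ^ 2) := by
  have : IsAdicComplete (Ideal.span (Set.range (MvPowerSeries.X : Unit → MvPowerSeries Unit S))) (MvPowerSeries Unit S) :=
    inferInstance
  refine henselAt_of_complete (S := PowerSeries S) (Ideal.span (Set.range (MvPowerSeries.X : Unit → MvPowerSeries Unit S))) _ ?_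
  rw [pow_two]
  exact Ideal.mul_mem_left _ _ (Ideal.subset_span ⟨(), rfl⟩)

lemma ps_maximalIdeal {S : Type} [CommRing S] [IsLocalRing S] {d : ℕ} (y : Fin d → S)
    (hy : maximalIdeal S = Ideal.span (Set.range y)) :
    maximalIdeal (PowerSeries S) ≤ Ideal.span {PowerSeries.X} ⊔ Ideal.span (Set.range fun i => PowerSeries.C (y i)) := by
  intro f hf
  have h1 : PowerSeries.constantCoeff f ∈ maximalIdeal S := by
    rw [mem_maximalIdeal, mem_nonunits_iff] at hf ⊢
    intro h; exact hf (PowerSeries.isUnit_iff_constantCoeff.2 h)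
  have h2 : f = PowerSeries.X * PowerSeries.mk (fun p => PowerSeries.coeff (p+1) f) + PowerSeries.C (PowerSeries.constantCoeff f) :=
    PowerSeries.eq_X_mul_shift_add_const f
  rw [h2]
  refine Ideal.add_mem _ (Ideal.mem_sup_left (Ideal.mul_mem_right _ _ (Ideal.subset_span rfl))) (Ideal.mem_sup_right ?_)
  rw [hy] at h1
  have := Ideal.mem_map_of_mem (PowerSeries.C : S →+* PowerSeries S) h1
  rw [Ideal.map_span, ← Set.range_comp] at this
  exact this

lemma tp_lemB {K : Type} [CommRing K] {d n : ℕ} (ev : MvPolynomial (Fin n) ℤ →+* K)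
    (ξ : Fin (d+1) → MvPolynomial (Fin n) ℤ) (g δ : MvPolynomial (Fin n) ℤ) (M : ℕ)
    (hB : ∀ (S : Type) [CommRing S] [IsDomain S] (κ : S), HenselAt κ →
    ∀ a : S, a ≠ 0 → ∀ N : ℕ, ∀ θ : MvPolynomial (Fin n) ℤ →+* S, (∀ r, ev r = 0 → a ^ (M + N) * κ ∣ θ r) →
      θ δ ∣ a → ∃ θ' : MvPolynomial (Fin n) ℤ →+* S, (∀ r, a ^ N * κ ∣ θ' r - θ r) ∧ ∀ r, ev r = 0 → θ' r = 0)
    (S : Type) [CommRing S] [IsDomain S] [IsLocalRing S] [IsNoetherianRing S]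
    (y : Fin d → S) (hy : maximalIdeal S = Ideal.span (Set.range y))
    (c : Fin (d+1) → S) (hc : IsUnit (c 0)) (θ : MvPolynomial (Fin n) ℤ →+* PowerSeries S)
    (a : PowerSeries S) (ha : a ≠ 0) (h1 : ∀ r, ev r = 0 → a ^ (M + 1) * PowerSeries.X ^ 2 ∣ θ r)
    (v s : PowerSeries S) (h2 : θ (δ * g) * v = a + a ^ (M+1) * PowerSeries.X ^ 2 * s)
    (h3 : a ^ (M+1) * PowerSeries.X ^ 2 ∣ θ (ξ 0) - PowerSeries.C (c 0) * PowerSeries.X)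
    (h4 : ∀ i : Fin d, a ^ (M+1) * PowerSeries.X ^ 2 ∣ θ (ξ i.succ) - (PowerSeries.C (y i) + PowerSeries.C (c i.succ) * PowerSeries.X)) :
    ∃ ψ : MvPolynomial (Fin n) ℤ →+* PowerSeries S, (∀ r, ev r = 0 → ψ r = 0) ∧
        maximalIdeal (PowerSeries S) = Ideal.span (Set.range fun i => ψ (ξ i)) ∧ ψ g ≠ 0 := by
  have hH := henselAt_X_sq S
  obtain ⟨w, hw⟩ : IsUnit (1 + PowerSeries.X ^ 2 * (a ^ M * s)) := hH.1 _
  have h2' : θ δ * (θ g * v) = a * w := by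
    rw [hw]; rw [map_mul] at h2; rw [← mul_assoc, h2]; ring
  have hδ : θ δ ∣ a := ⟨θ g * v * (w⁻¹ : Units _), by
    rw [← mul_assoc, h2', mul_assoc, Units.mul_inv, mul_one]⟩
  obtain ⟨ψ, hψ1, hψ2⟩ := hB (PowerSeries S) (PowerSeries.X ^ 2) hH a ha 1 θ h1 hδ
  simp only [pow_one] at hψ1
  have hXd : ∀ r, (PowerSeries.X : PowerSeries S) ^ 2 ∣ ψ r - θ r := fun r => (Dvd.intro_left _ rfl).trans (hψ1 r)
  have hXnu : ¬ IsUnit (PowerSeries.X ^ 2 : PowerSeries S) := by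
    intro h; have := (PowerSeries.isUnit_iff_constantCoeff.1 h); simp at this
  refine ⟨ψ, hψ2, ?_, ?_⟩
  · set m := maximalIdeal (PowerSeries S) with hm
    set J := Ideal.span (Set.range fun i => ψ (ξ i)) with hJ
    have hXm : (PowerSeries.X : PowerSeries S) ∈ m := by
      rw [hm, mem_maximalIdeal, mem_nonunits_iff]
      intro h; exact hXnu (h.pow 2)
    have hym : ∀ i, PowerSeries.C (y i) ∈ m := by
      intro i
      rw [hm, mem_maximalIdeal, mem_nonunits_iff]
      intro h; have := (PowerSeries.isUnit_iff_constantCoeff.1 h)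
      rw [PowerSeries.constantCoeff_C] at this
      have h3 : y i ∈ maximalIdeal S := by rw [hy]; exact Ideal.subset_span ⟨i, rfl⟩
      exact h3 this
    have hX2 : ∀ z : PowerSeries S, PowerSeries.X ^ 2 ∣ z → z ∈ m • m := by
      rintro z ⟨t, rfl⟩
      rw [pow_two]
      exact Ideal.mul_mem_right _ _ (Ideal.mul_mem_mul hXm hXm)
    have k0 : ψ (ξ 0) - PowerSeries.C (c 0) * PowerSeries.X ∈ m • m := by
      apply hX2
      have := dvd_add (hXd (ξ 0)) ((Dvd.intro_left _ rfl).trans h3)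
      simpa using this
    have k1 : ∀ i : Fin d, ψ (ξ i.succ) - (PowerSeries.C (y i) + PowerSeries.C (c i.succ) * PowerSeries.X) ∈ m • m := by
      intro i
      apply hX2
      have := dvd_add (hXd (ξ i.succ)) ((Dvd.intro_left _ rfl).trans (h4 i))
      simpa using this
    have hψm : ∀ i, ψ (ξ i) ∈ J := fun i => Ideal.subset_span ⟨i, rfl⟩
    have hmm : m • m ≤ m := Ideal.mul_le_left
    apply le_antisymm
    · have hfg : m.FG := IsNoetherian.noetherian m
      refine Submodule.le_of_le_smul_of_le_jacobson_bot hfg (le_of_eq (IsLocalRing.jacobson_eq_maximalIdeal ⊥ bot_ne_top).symm) ?_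
      have hXJ : (PowerSeries.X : PowerSeries S) ∈ J ⊔ m • m := by
        obtain ⟨u, hu⟩ := hc
        have e : (PowerSeries.X : PowerSeries S) = PowerSeries.C ((u⁻¹ : Units S) : S) * ψ (ξ 0) -
          PowerSeries.C ((u⁻¹ : Units S) : S) * (ψ (ξ 0) - PowerSeries.C (c 0) * PowerSeries.X) := by
          rw [← mul_sub, sub_sub_cancel, ← mul_assoc, ← map_mul, ← hu, Units.inv_mul, map_one, one_mul]
        rw [e]
        exact Ideal.sub_mem _ (Ideal.mem_sup_left (Ideal.mul_mem_left _ _ (hψm 0))) (Ideal.mem_sup_right (Ideal.mul_mem_left _ _ k0))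
      refine (ps_maximalIdeal y hy).trans (sup_le ?_ ?_)
      · rw [Ideal.span_le, Set.singleton_subset_iff]; exact hXJ
      · rw [Ideal.span_le]; rintro _ ⟨i, rfl⟩
        have e : PowerSeries.C (y i) = ψ (ξ i.succ) - (ψ (ξ i.succ) - (PowerSeries.C (y i) + PowerSeries.C (c i.succ) * PowerSeries.X)) - PowerSeries.C (c i.succ) * PowerSeries.X := by ring
        change PowerSeries.C (y i) ∈ J ⊔ m • m
        rw [e]
        exact Ideal.sub_mem _ (Ideal.sub_mem _ (Ideal.mem_sup_left (hψm _)) (Ideal.mem_sup_right (k1 i))) (Ideal.mul_mem_left _ _ hXJ)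
    · rw [hJ, Ideal.span_le]; rintro _ ⟨i, rfl⟩
      change ψ (ξ i) ∈ m
      refine Fin.cases ?_ (fun i => ?_) i
      · have := Ideal.add_mem m (hmm k0) (Ideal.mul_mem_left m (PowerSeries.C (c 0)) hXm)
        simpa using this
      · have := Ideal.add_mem m (hmm (k1 i)) (Ideal.add_mem m (hym i) (Ideal.mul_mem_left m (PowerSeries.C (c i.succ)) hXm))
        simpa using this
  · intro h0
    have h := hψ1 g
    rw [h0, zero_sub, dvd_neg] at h
    have h5 : a * PowerSeries.X ^ 2 ∣ a * w := by
      rw [← h2']; exact (h.mul_right v).mul_left _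
    have h6 := (mul_dvd_mul_iff_left ha).1 h5
    exact hXnu (isUnit_of_dvd_unit h6 w.isUnit)

lemma dist_exists_poly {R : Type} [CommRing R] (I : Ideal R) [IsAdicComplete I R] (b : Polynomial R)
    (hb : b.IsDistinguishedAt I) (F : PowerSeries R) : ∃ ρ : Polynomial R, (b : PowerSeries R) ∣ F - ρ := by
  obtain ⟨z, hz⟩ := hb.algEquivQuotient.surjective (Ideal.Quotient.mk _ F)
  obtain ⟨ρ, rfl⟩ := Ideal.Quotient.mk_surjective z
  refine ⟨ρ, ?_⟩
  rw [← Ideal.mem_span_singleton, ← Ideal.Quotient.mk_eq_mk_iff_sub_mem, ← hz]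
  simp

lemma dist_dvd {R : Type} [CommRing R] (I : Ideal R) [IsAdicComplete I R] (b h : Polynomial R)
    (hb : b.IsDistinguishedAt I) (hh : (b : PowerSeries R) ∣ (h : PowerSeries R)) : b ∣ h := by
  rw [← Ideal.mem_span_singleton, ← Ideal.Quotient.eq_zero_iff_mem] at hh ⊢
  apply hb.algEquivQuotient.injective
  rw [map_zero, ← hh]
  simp

end NIT

-- Part 6

namespace NIT
open IsLocalRing

lemma tp_data {K : Type} [Field K] [CharZero K] {d n : ℕ} (ev : MvPolynomial (Fin n) ℤ →+* MvPowerSeries (Fin (d+1)) K)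
    (ξ : Fin (d+1) → MvPolynomial (Fin n) ℤ) (hξ : ∀ i, ev (ξ i) = MvPowerSeries.X i)
    (f : MvPolynomial (Fin n) ℤ) (hf : ev f ≠ 0) (M : ℕ) :
    ∃ (Ψ : MvPolynomial (Fin n) ℤ →+* Polynomial (MvPowerSeries (Fin d) K)) (a v : Polynomial (MvPowerSeries (Fin d) K))
      (c : Fin (d+1) → K), c 0 ≠ 0 ∧ a.Monic ∧
      (∀ r, ev r = 0 → a ^ (M+1) * Polynomial.X ^ 2 ∣ Ψ r) ∧
      a ^ (M+1) * Polynomial.X ^ 2 ∣ Ψ f * v - a ∧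
      a ^ (M+1) * Polynomial.X ^ 2 ∣ Ψ (ξ 0) - Polynomial.C (MvPowerSeries.C (c 0)) * Polynomial.X ∧
      ∀ i : Fin d, a ^ (M+1) * Polynomial.X ^ 2 ∣ Ψ (ξ i.succ) - (Polynomial.C (MvPowerSeries.X i) + Polynomial.C (MvPowerSeries.C (c i.succ)) * Polynomial.X) := by
  obtain ⟨α, c, hc0, hα0, hα1, hα2⟩ := exists_coord d (ev f) hf
  obtain ⟨a, u, hau⟩ := PowerSeries.exists_isWeierstrassFactorization hα2
  have ha := hau.isDistinguishedAt
  obtain ⟨u, rfl⟩ := hau.isUnit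
  have heq := hau.eq_mul
  have hXd : (Polynomial.X : Polynomial (MvPowerSeries (Fin d) K)).IsDistinguishedAt (maximalIdeal _) := by
    refine ⟨⟨?_⟩, Polynomial.monic_X⟩
    intro k hk
    rw [Polynomial.natDegree_X] at hk
    obtain rfl : k = 0 := by omega
    simp
  have hpow : ∀ (q : Polynomial (MvPowerSeries (Fin d) K)) (k : ℕ), q.IsDistinguishedAt (maximalIdeal _) →
      (q ^ (k+1)).IsDistinguishedAt (maximalIdeal _) := by
    intro q k hq
    induction k with
    | zero => simpa using hq
    | succ k ih => rw [pow_succ]; exact ih.mul hq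
  set b := a ^ (M+1) * Polynomial.X ^ 2 with hb
  have hbd : b.IsDistinguishedAt (maximalIdeal _) := (hpow a M ha).mul (hpow _ 1 hXd)
  choose ρ hρ using fun F => dist_exists_poly (maximalIdeal _) b hbd F
  let Ψ : MvPolynomial (Fin n) ℤ →+* Polynomial (MvPowerSeries (Fin d) K) :=
    (MvPolynomial.aeval (fun i => ρ (α (ev (MvPolynomial.X i))))).toRingHom
  let I := Ideal.span {(b : PowerSeries (MvPowerSeries (Fin d) K))}
  have hΨ : ∀ r, (b : PowerSeries (MvPowerSeries (Fin d) K)) ∣ α (ev r) - Ψ r := by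
    intro r
    rw [← Ideal.mem_span_singleton, ← Ideal.Quotient.mk_eq_mk_iff_sub_mem]
    have : ((Ideal.Quotient.mk I).comp (α.comp ev)) = (Ideal.Quotient.mk I).comp (Polynomial.coeToPowerSeries.ringHom.comp Ψ) := by
      apply MvPolynomial.ringHom_ext
      · intro k; simp
      · intro i
        simp only [RingHom.comp_apply]
        rw [Ideal.Quotient.mk_eq_mk_iff_sub_mem, Ideal.mem_span_singleton]
        simpa [Ψ] using hρ (α (ev (MvPolynomial.X i)))
    exact RingHom.congr_fun this r
  have hρ' : ∀ F, (b : PowerSeries (MvPowerSeries (Fin d) K)) ∣ F - ρ F := hρ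
  refine ⟨Ψ, a, ρ (u⁻¹ : Units _), c, hc0, ha.monic, ?_, ?_, ?_, ?_⟩
  · intro r hr
    apply dist_dvd _ _ _ hbd
    have := hΨ r
    rwa [hr, map_zero, zero_sub, dvd_neg] at this
  · apply dist_dvd _ _ _ hbd
    have e1 := hΨ f
    have e2 := hρ' (u⁻¹ : Units _)
    have e : ((Ψ f * ρ (u⁻¹ : Units _) - a : Polynomial _) : PowerSeries (MvPowerSeries (Fin d) K)) =
       -((α (ev f) - Ψ f) * ρ (u⁻¹ : Units _)) - α (ev f) * ((u⁻¹ : Units _) - ρ (u⁻¹ : Units _)) := by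
      have : α (ev f) * (u⁻¹ : Units _) = a := by rw [heq, mul_assoc, Units.mul_inv, mul_one]
      simp only [Polynomial.coe_sub, Polynomial.coe_mul]
      linear_combination this
    rw [e]
    exact dvd_sub ((e1.mul_right _).neg_right) (e2.mul_left _)
  · apply dist_dvd _ _ _ hbd
    have := hΨ (ξ 0)
    rw [hξ, hα0] at this
    rw [← dvd_neg]
    simpa using this
  · intro i
    apply dist_dvd _ _ _ hbd
    have := hΨ (ξ i.succ)
    rw [hξ, hα1] at this
    rw [← dvd_neg]
    simpa using this

lemma exists_poly_lift {R k : Type} [CommRing R] [CommRing k] [Algebra k R] (D : Subalgebra k R) (p : Polynomial R) (hp : ∀ k, p.coeff k ∈ D) :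
    ∃ q : Polynomial D, q.map (algebraMap D R) = p := by
  have : p ∈ Polynomial.lifts (algebraMap D R) := by
    rw [Polynomial.lifts_iff_coeff_lifts]
    intro k; exact ⟨⟨_, hp k⟩, rfl⟩
  exact (Polynomial.mem_lifts _).1 this

lemma tp_succ (d : ℕ) (hT : TP d) : TP (d+1) := by
  classical
  intro K _ _ n ev ξ hξ g hg
  haveI : IsDomain (MvPowerSeries (Fin (d + 1)) K) := NoZeroDivisors.to_isDomain _
  haveI : CharZero (MvPowerSeries (Fin (d + 1)) K) := charZero_of_injective_ringHom (MvPowerSeries.C : K →+* MvPowerSeries (Fin (d+1)) K).injective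
  obtain ⟨δ, hδ, M, hB⟩ := propB_mv n ev
  obtain ⟨Ψ, a, v, c, hc0, ha, h1, h2, h3, h4⟩ := tp_data ev ξ hξ (δ * g) (by rw [map_mul]; exact mul_ne_zero hδ hg) M
  obtain ⟨G, hG⟩ := IsNoetherian.noetherian (RingHom.ker ev)
  have h1' : ∀ r : G, ∃ s, Ψ r = a ^ (M+1) * Polynomial.X ^ 2 * s := fun r => h1 r (by
    have : (r : MvPolynomial (Fin n) ℤ) ∈ RingHom.ker ev := by rw [← hG]; exact Submodule.subset_span r.2
    exact this)
  choose s hs using h1'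
  obtain ⟨s', hs'⟩ := h2
  obtain ⟨t0, ht0⟩ := h3
  choose t ht using h4
  let R := MvPowerSeries (Fin d) K
  let P : Finset (Polynomial R) := {a, v, s', t0} ∪ Finset.univ.image t ∪ Finset.univ.image s ∪
    Finset.univ.image (fun i => Ψ (MvPolynomial.X i))
  let W : Finset R := P.biUnion (fun p => p.coeffs) ∪ Finset.univ.image (fun i => MvPowerSeries.C (c i)) ∪
    Finset.univ.image (fun i => MvPowerSeries.X i) ∪ {MvPowerSeries.C (c 0)⁻¹}
  set D := Algebra.adjoin ℤ (W : Set R) with hD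
  have hWD : ∀ w ∈ W, w ∈ D := fun w hw => Algebra.subset_adjoin hw
  have hPD : ∀ p ∈ P, ∀ k, p.coeff k ∈ D := by
    intro p hp k
    by_cases hk : p.coeff k = 0
    · rw [hk]; exact zero_mem D
    · apply hWD
      simp only [W, Finset.mem_union, Finset.mem_biUnion]
      exact Or.inl (Or.inl (Or.inl ⟨p, hp, Polynomial.coeff_mem_coeffs hk⟩))
  have hXD : ∀ i, MvPowerSeries.X i ∈ D := fun i => hWD _ (by simp [W])
  have hcD : ∀ i, MvPowerSeries.C (c i) ∈ D := fun i => hWD _ (by simp [W])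
  have hiD : MvPowerSeries.C (c 0)⁻¹ ∈ D := hWD _ (by simp [W])
  have hlift : ∀ p ∈ P, ∃ q : Polynomial D, q.map (algebraMap D R) = p := fun p hp => exists_poly_lift D p (hPD p hp)
  obtain ⟨a1, ha1⟩ := hlift a (by simp [P])
  obtain ⟨v1, hv1⟩ := hlift v (by simp [P])
  obtain ⟨s1', hs1'⟩ := hlift s' (by simp [P])
  obtain ⟨t01, ht01⟩ := hlift t0 (by simp [P])
  choose t1 ht1 using fun i => hlift (t i) (by simp [P])
  choose s1 hs1 using fun i => hlift (s i) (by simp [P])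
  choose r1 hr1 using fun i => hlift (Ψ (MvPolynomial.X i)) (by simp [P])
  have hinjD : Function.Injective (algebraMap D R) := Subtype.val_injective
  have hinj : Function.Injective (Polynomial.map (algebraMap D R)) := Polynomial.map_injective _ hinjD
  let Ψ1 : MvPolynomial (Fin n) ℤ →+* Polynomial D := (MvPolynomial.aeval r1).toRingHom
  have hΨ1 : ∀ r, (Ψ1 r).map (algebraMap D R) = Ψ r := by
    have : (Polynomial.mapRingHom (algebraMap D R)).comp Ψ1 = Ψ := by
      apply MvPolynomial.ringHom_ext
      · intro k; simp
      · intro i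
        have := hr1 i
        simpa [Ψ1] using this
    intro r
    exact RingHom.congr_fun this r
  have ha1m : a1.Monic := by
    apply Polynomial.monic_of_injective hinjD; rw [ha1]; exact ha
  have e1 : ∀ r : G, Ψ1 r = a1 ^ (M+1) * Polynomial.X ^ 2 * s1 r := by
    intro r; apply hinj
    simp only [Polynomial.map_mul, Polynomial.map_pow, Polynomial.map_X, hΨ1, ha1, hs1]; exact hs r
  have e2 : Ψ1 (δ * g) * v1 = a1 + a1 ^ (M+1) * Polynomial.X ^ 2 * s1' := by
    apply hinj
    simp only [Polynomial.map_mul, Polynomial.map_pow, Polynomial.map_X, hΨ1, ha1, hs1', hv1, Polynomial.map_add, ← hs']; ring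
  have e3 : Ψ1 (ξ 0) - Polynomial.C ⟨_, hcD 0⟩ * Polynomial.X = a1 ^ (M+1) * Polynomial.X ^ 2 * t01 := by
    apply hinj
    simp only [Polynomial.map_mul, Polynomial.map_pow, Polynomial.map_X, hΨ1, ha1, ht01, Polynomial.map_sub, ← ht0, Polynomial.map_C]
    rfl
  have e4 : ∀ i : Fin d, Ψ1 (ξ i.succ) - (Polynomial.C ⟨_, hXD i⟩ + Polynomial.C ⟨_, hcD i.succ⟩ * Polynomial.X) = a1 ^ (M+1) * Polynomial.X ^ 2 * t1 i := by
    intro i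
    apply hinj
    simp only [Polynomial.map_mul, Polynomial.map_pow, Polynomial.map_X, hΨ1, ha1, ht1, Polynomial.map_sub, Polynomial.map_add, ← ht, Polynomial.map_C]
    rfl
  obtain ⟨S, i1, i2, i3, i4, p, hp, hcp, hdim, θ, hθ1, -⟩ := tp_sub hT K W hXD 1 one_ne_zero
  let τ : Polynomial D →+* PowerSeries S := Polynomial.coeToPowerSeries.ringHom.comp (Polynomial.mapRingHom θ)
  have hτX : τ Polynomial.X = PowerSeries.X := by simp [τ]
  have hτC : ∀ x, τ (Polynomial.C x) = PowerSeries.C (θ x) := by intro x; simp [τ]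
  have hunit : IsUnit (θ ⟨_, hcD 0⟩) := by
    refine IsUnit.of_mul_eq_one (θ ⟨_, hiD⟩) ?_
    rw [← map_mul, ← map_one θ]
    congr 1
    apply Subtype.ext
    change MvPowerSeries.C (c 0) * MvPowerSeries.C (c 0)⁻¹ = 1
    rw [← map_mul, mul_inv_cancel₀ hc0, map_one]
  obtain ⟨ψ, hψ1, hψ2, hψ3⟩ := tp_lemB ev ξ g δ M hB S (fun i => θ ⟨_, hXD i⟩) hθ1 (fun i => θ ⟨_, hcD i⟩) hunit
    (τ.comp Ψ1) (τ a1) (by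
      intro h
      have h' : ((a1.map θ : Polynomial S) : PowerSeries S) = 0 := h
      rw [Polynomial.coe_eq_zero_iff] at h'
      exact (ha1m.map θ).ne_zero h') (by
      intro r hr
      have hr : r ∈ Ideal.span (G : Set (MvPolynomial (Fin n) ℤ)) := by
        change r ∈ Submodule.span _ _
        rw [hG]; exact hr
      have hle : Ideal.span (G : Set (MvPolynomial (Fin n) ℤ)) ≤ Ideal.comap (τ.comp Ψ1) (Ideal.span {τ a1 ^ (M+1) * PowerSeries.X ^ 2}) := by
        rw [Ideal.span_le]
        intro x hx
        have ee : Ψ1 x = _ := e1 ⟨x, hx⟩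
        change τ (Ψ1 x) ∈ Ideal.span {τ a1 ^ (M+1) * PowerSeries.X ^ 2}
        rw [ee, Ideal.mem_span_singleton, map_mul, map_mul, map_pow, map_pow, hτX]
        exact Dvd.intro _ rfl
      exact Ideal.mem_span_singleton.1 (hle hr)) (τ v1) (τ s1') (by
      rw [RingHom.comp_apply, ← map_mul, e2]; simp only [map_add, map_mul, map_pow, hτX]) (by
      refine ⟨τ t01, ?_⟩
      rw [← hτX, ← hτC, RingHom.comp_apply, ← map_mul, ← map_sub, e3]
      simp only [map_mul, map_pow]) (by
      intro i
      refine ⟨τ (t1 i), ?_⟩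
      rw [← hτX, ← hτC, ← hτC, RingHom.comp_apply, ← map_mul, ← map_add, ← map_sub, e4]
      simp only [map_mul, map_pow])
  refine ⟨PowerSeries S, inferInstance, inferInstance, inferInstance, inferInstance, p, hp,
    charP_of_injective_ringHom (PowerSeries.C_injective (R := S)) p, ?_, ψ, hψ1, hψ2, hψ3⟩
  refine le_trans ?_ (ringKrullDim_succ_le_ringKrullDim_powerseries (R := S))
  push_cast
  exact add_le_add_left hdim 1

theorem tp_all (d : ℕ) : TP d := by
  induction d with
  | zero => exact tp_zero
  | succ d ih => exact tp_succ d ih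

end NIT

-- Part 7

namespace NIT
open IsLocalRing

lemma exists_alg_ext {D B Ω : Type} [CommRing D] [CommRing B] [Field Ω] [IsAlgClosed Ω]
    [Algebra D B] [Algebra.IsIntegral D B] (hinj : Function.Injective (algebraMap D B))
    (θ : D →+* Ω) : ∃ φ : B →+* Ω, φ.comp (algebraMap D B) = θ := by
  have hp : (RingHom.ker θ).IsPrime := RingHom.ker_isPrime θ
  obtain ⟨Q, -, hQ, hQc⟩ := Ideal.exists_ideal_over_prime_of_isIntegral (S := B) (RingHom.ker θ) ⊥
    (by rw [Ideal.comap_bot_of_injective _ hinj]; exact bot_le)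
  let D1 := D ⧸ RingHom.ker θ
  let f : D1 →+* B ⧸ Q := Ideal.quotientMap Q (algebraMap D B) hQc.ge
  have hf : Function.Injective f := Ideal.quotientMap_injective' hQc.le
  letI : Algebra D1 (B ⧸ Q) := f.toAlgebra
  letI : Algebra D1 Ω := (RingHom.kerLift θ).toAlgebra
  have h1 : Function.Injective (algebraMap D1 Ω) := RingHom.kerLift_injective θ
  haveI : Algebra.IsIntegral D1 (B ⧸ Q) := by
    constructor
    intro y
    obtain ⟨b, rfl⟩ := Ideal.Quotient.mk_surjective y
    have := (Algebra.IsIntegral.isIntegral (R := D) b)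
    obtain ⟨q, hq, hq0⟩ := this
    refine ⟨q.map (Ideal.Quotient.mk _), hq.map _, ?_⟩
    rw [Polynomial.eval₂_map]
    have e : (algebraMap D1 (B ⧸ Q)).comp (Ideal.Quotient.mk (RingHom.ker θ)) =
        (Ideal.Quotient.mk Q).comp (algebraMap D B) := by
      ext x; rfl
    rw [e, ← Polynomial.hom_eval₂, hq0, map_zero]
  haveI : FaithfulSMul D1 (B ⧸ Q) := (faithfulSMul_iff_algebraMap_injective _ _).2 hf
  haveI : FaithfulSMul D1 Ω := (faithfulSMul_iff_algebraMap_injective _ _).2 h1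
  haveI : IsDomain D1 := Ideal.Quotient.isDomain _
  haveI : IsDomain (B ⧸ Q) := Ideal.Quotient.isDomain _
  haveI : Module.IsTorsionFree D1 (B ⧸ Q) := .trans_faithfulSMul D1 (B ⧸ Q) (B ⧸ Q)
  haveI : Module.IsTorsionFree D1 Ω := .trans_faithfulSMul D1 Ω Ω
  haveI : Algebra.IsAlgebraic D1 (B ⧸ Q) := inferInstance
  let ψ : (B ⧸ Q) →ₐ[D1] Ω := IsAlgClosed.lift
  refine ⟨(ψ : (B ⧸ Q) →+* Ω).comp (Ideal.Quotient.mk Q), ?_⟩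
  ext x
  exact ψ.commutes (Ideal.Quotient.mk _ x)

lemma dim_le_of_int {S R : Type} [CommRing S] [CommRing R] [Algebra S R] [Algebra.IsIntegral S R]
    (hinj : Function.Injective (algebraMap S R)) : ringKrullDim S ≤ ringKrullDim R := by
  refine iSup_le fun l => ?_
  have hk : (l.head.asIdeal).IsPrime := l.head.2
  obtain ⟨P, -, hP, hPc⟩ := Ideal.exists_ideal_over_prime_of_isIntegral (S := R) l.head.asIdeal ⊥
    (by rw [Ideal.comap_bot_of_injective _ hinj]; exact bot_le)
  haveI : P.LiesOver (RelSeries.head l).asIdeal := ⟨hPc.symm⟩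
  obtain ⟨L, hL, -, -⟩ := Ideal.exists_ltSeries_of_hasGoingUp (S := R) l P
  rw [← hL]
  exact le_iSup (fun p : LTSeries (PrimeSpectrum R) => (p.length : WithBot ℕ∞)) L

lemma exists_max_height {R : Type} [CommRing R] [Nontrivial R] (d : ℕ)
    (h : (d : WithBot ℕ∞) ≤ ringKrullDim R) :
    ∃ n : Ideal R, n.IsMaximal ∧ (d : ℕ∞) ≤ n.height := by
  obtain ⟨l, hl⟩ := Order.le_krullDim_iff.1 h
  obtain ⟨n, hn, hle⟩ := Ideal.exists_le_maximal l.last.asIdeal l.last.2.ne_top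
  refine ⟨n, hn, ?_⟩
  have h1 := Order.length_le_height_last (p := l)
  rw [hl] at h1
  have := hn.isPrime
  rw [show n.height = _ from PrimeSpectrum.height_eq_orderHeight ⟨n, this⟩]
  exact h1.trans (Order.height_mono (show l.last ≤ ⟨n, hn.isPrime⟩ from hle))

lemma core_fin {D B S : Type} [CommRing D] [CommRing B] [Algebra D B] [Module.Finite D B]
    (hinj : Function.Injective (algebraMap D B)) [CommRing S] [IsDomain S] [IsLocalRing S]
    [IsNoetherianRing S] (p : ℕ) [Fact p.Prime] [CharP S p] (d : ℕ)
    (hdim : (d : WithBot ℕ∞) ≤ ringKrullDim S) (θ : D →+* S) {ι : Type} (x : ι → D)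
    (hx : maximalIdeal S = Ideal.span (Set.range fun i => θ (x i)))
    (F : FC B) (s : ℕ) (hs : ∀ i, F.deg i ≤ s)
    (hF : ∀ k, ∃ M : ℕ, F.NullHtp (algebraMap D B (x k) ^ M))
    (a : F.ι) (ha : F.deg a = 0)
    (hd : ∀ j, ∃ N : ℕ, F.d a j ^ N ∈ Ideal.span (Set.range fun i => algebraMap D B (x i))) :
    d ≤ s := by
  let Ω := AlgebraicClosure (FractionRing S)
  letI : Algebra S Ω := ((algebraMap (FractionRing S) Ω).comp (algebraMap S (FractionRing S))).toAlgebra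
  have hSΩ : Function.Injective (algebraMap S Ω) :=
    (algebraMap (FractionRing S) Ω).injective.comp (IsFractionRing.injective S (FractionRing S))
  obtain ⟨φ, hφ⟩ := exists_alg_ext hinj ((algebraMap S Ω).comp θ)
  have hφ' : ∀ y, φ (algebraMap D B y) = algebraMap S Ω (θ y) := fun y => RingHom.congr_fun hφ y
  obtain ⟨E, hE⟩ := Module.Finite.fg_top (R := D) (M := B)
  let R : Subalgebra S Ω := Algebra.adjoin S (φ '' (E : Set B))
  have hintg : ∀ b : B, IsIntegral S (φ b) := by
    intro b
    obtain ⟨q, hq, hq0⟩ := (Algebra.IsIntegral.isIntegral (R := D) b)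
    refine ⟨q.map θ, hq.map _, ?_⟩
    rw [Polynomial.eval₂_map, ← hφ, ← Polynomial.hom_eval₂, hq0, map_zero]
  haveI : Module.Finite S R :=
    Algebra.finite_adjoin_of_finite_of_isIntegral (E.finite_toSet.image φ) (by
      rintro _ ⟨b, -, rfl⟩; exact hintg b)
  have hmem : ∀ b : B, φ b ∈ R := by
    intro b
    have hb : b ∈ Submodule.span D (E : Set B) := by rw [hE]; trivial
    induction hb using Submodule.span_induction with
    | mem x h => exact Algebra.subset_adjoin ⟨x, h, rfl⟩
    | zero => rw [map_zero]; exact R.zero_mem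
    | add x y _ _ h1 h2 => rw [map_add]; exact R.add_mem h1 h2
    | smul c y _ h =>
      rw [Algebra.smul_def, map_mul, hφ']
      exact R.mul_mem (R.algebraMap_mem _) h
  let φR : B →+* R := φ.codRestrict R.toSubring hmem
  have hφR : ∀ y, φR (algebraMap D B y) = algebraMap S R (θ y) := fun y => Subtype.ext (hφ' y)
  have hSR : Function.Injective (algebraMap S R) := fun u v h =>
    hSΩ (congrArg Subtype.val h)
  haveI : IsNoetherianRing R := IsNoetherianRing.of_finite S R
  haveI : Algebra.IsIntegral S R := inferInstance
  obtain ⟨n, hn, hnd⟩ := exists_max_height d (hdim.trans (dim_le_of_int hSR))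
  have hnp := hn.isPrime
  let T := Localization.AtPrime n
  haveI : CharP R p := charP_of_injective_algebraMap hSR p
  have hRT : Function.Injective (algebraMap R T) :=
    IsLocalization.injective T n.primeCompl_le_nonZeroDivisors
  haveI : CharP T p := charP_of_injective_algebraMap hRT p
  let ψ : B →+* T := (algebraMap R T).comp φR
  -- n contracts to the maximal ideal
  have hnc : n.comap (algebraMap S R) = maximalIdeal S :=
    IsLocalRing.eq_maximalIdeal (Ideal.isMaximal_comap_of_isIntegral_of_isMaximal n)
  have hxn : ∀ i, φR (algebraMap D B (x i)) ∈ n := by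
    intro i
    rw [hφR, ← Ideal.mem_comap, hnc, hx]
    exact Ideal.subset_span ⟨i, rfl⟩
  have hxT : ∀ i, ψ (algebraMap D B (x i)) ∈ maximalIdeal T := fun i =>
    (IsLocalization.AtPrime.to_map_mem_maximal_iff T n _).2 (hxn i)
  have key : ringKrullDim T ≤ s := by
    refine FC.nit_charP p (F.map ψ) s hs ?_ a ha ?_
    · -- m is the radical
      have hrad : maximalIdeal T ≤ (F.map ψ).nullIdeal.radical := by
        rw [Ideal.radical_eq_sInf]
        refine le_sInf ?_
        rintro P ⟨hP, hPp⟩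
        have h1 : ∀ i, θ (x i) ∈ P.comap ((algebraMap R T).comp (algebraMap S R)) := by
          intro i
          rw [Ideal.mem_comap, RingHom.comp_apply, ← hφR]
          obtain ⟨M, hM⟩ := hF i
          have h2 := hM.map ψ
          rw [map_pow] at h2
          exact hPp.mem_of_pow_mem M (hP h2)
        have h2 : maximalIdeal S ≤ (P.comap (algebraMap R T)).comap (algebraMap S R) := by
          rw [hx, Ideal.span_le]
          rintro _ ⟨i, rfl⟩
          exact h1 i
        have h3 : ((P.comap (algebraMap R T)).comap (algebraMap S R)).IsMaximal := by
          have h4 : ((P.comap (algebraMap R T)).comap (algebraMap S R)).IsPrime := inferInstance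
          have := (maximalIdeal.isMaximal S).eq_of_le h4.ne_top h2
          rw [← this]; infer_instance
        have h5 : (P.comap (algebraMap R T)).IsMaximal :=
          Ideal.isMaximal_of_isIntegral_of_isMaximal_comap _ h3
        have h6 : P.comap (algebraMap R T) ≤ n := by
          intro y hy
          have := IsLocalRing.le_maximalIdeal hPp.ne_top hy
          exact (IsLocalization.AtPrime.to_map_mem_maximal_iff T n _).1 this
        have h7 := h5.eq_of_le hn.ne_top h6
        rw [← Localization.AtPrime.map_eq_maximalIdeal, Ideal.map_le_iff_le_comap, h7]
      intro y hy
      obtain ⟨M, hM⟩ := hrad hy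
      exact ⟨M, hM⟩
    · intro j
      obtain ⟨N, hN⟩ := hd j
      have : ψ (F.d a j) ^ N ∈ maximalIdeal T := by
        rw [← map_pow]
        have h1 : Ideal.span (Set.range fun i => algebraMap D B (x i)) ≤ (maximalIdeal T).comap ψ := by
          rw [Ideal.span_le]; rintro _ ⟨i, rfl⟩; exact hxT i
        exact h1 hN
      exact (maximalIdeal.isMaximal T).isPrime.mem_of_pow_mem N this
  rw [IsLocalization.AtPrime.ringKrullDim_eq_height n T] at key
  have : (d : ℕ∞) ≤ s := hnd.trans (by exact_mod_cast key)
  exact_mod_cast this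

end NIT

-- Part 8

namespace NIT
open IsLocalRing

/-- Descend a complex to a subring containing its entries. -/
def FC.descend {B : Type} [CommRing B] (F : FC B) (B1 : Subring B) (h : ∀ i j, F.d i j ∈ B1) : FC B1 where
  ι := F.ι
  deg := F.deg
  d := Matrix.of fun i j => ⟨F.d i j, h i j⟩
  d_deg i j hij := F.d_deg i j fun h0 => hij (Subtype.ext h0)
  d_sq := by
    apply Matrix.map_injective B1.subtype_injective
    beta_reduce
    rw [Matrix.map_mul]
    refine Eq.trans ?_ (F.d_sq.trans ?_)
    · rfl
    · ext i j; simp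

lemma FC.descend_null {B : Type} [CommRing B] (F : FC B) (B1 : Subring B) (hB : ∀ i j, F.d i j ∈ B1)
    (y : B1) (h : Matrix F.ι F.ι B) (hh : ∀ i j, h i j ∈ B1)
    (hdeg : ∀ i j, h i j ≠ 0 → F.deg i = F.deg j + 1)
    (he : F.d * h + h * F.d = (y : B) • (1 : Matrix F.ι F.ι B)) :
    (F.descend B1 hB).NullHtp y := by
  refine ⟨Matrix.of fun i j => ⟨h i j, hh i j⟩, fun i j hij => hdeg i j fun h0 => hij (Subtype.ext h0), ?_⟩
  apply Matrix.map_injective B1.subtype_injective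
  beta_reduce
  rw [Matrix.map_add _ (map_add _), Matrix.map_mul, Matrix.map_mul]
  refine Eq.trans ?_ (he.trans ?_)
  · rfl
  · ext i j
    by_cases hij : i = j
    · subst hij
      change _ = B1.subtype ((y • (1 : Matrix F.ι F.ι B1)) i i)
      simp
    · change _ = B1.subtype ((y • (1 : Matrix F.ι F.ι B1)) i j)
      simp [hij]

lemma eqz_core {d : ℕ} (K : Type) [Field K] [CharZero K] {B : Type} [CommRing B]
    (f : MvPowerSeries (Fin d) K →+* B) (hf : Function.Injective f) (hintg : f.IsIntegral)
    (F : FC B) (s : ℕ) (hs : ∀ i, F.deg i ≤ s)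
    (hF : ∀ k, ∃ M : ℕ, F.NullHtp (f (MvPowerSeries.X k) ^ M))
    (a : F.ι) (ha : F.deg a = 0)
    (hd : ∀ j, ∃ N : ℕ, F.d a j ^ N ∈ Ideal.span (Set.range fun i => f (MvPowerSeries.X i))) :
    d ≤ s := by
  classical
  choose M h hdeg he using hF
  choose N hN using hd
  have hc : ∀ j, ∃ c : Fin d → B, ∑ i, c i * f (MvPowerSeries.X i) = F.d a j ^ N j := by
    intro j
    exact Ideal.mem_span_range_iff_exists_fun.1 (hN j)
  choose c hc using hc
  let E : Set B := Set.range (fun ij : F.ι × F.ι => F.d ij.1 ij.2) ∪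
    Set.range (fun kij : Fin d × F.ι × F.ι => h kij.1 kij.2.1 kij.2.2) ∪
    Set.range (fun jk : F.ι × Fin d => c jk.1 jk.2)
  have hE : E.Finite := ((Set.finite_range _).union (Set.finite_range _)).union (Set.finite_range _)
  choose q hq hq0 using hintg
  let s0 : Finset (MvPowerSeries (Fin d) K) :=
    (Finset.univ.image fun i : Fin d => MvPowerSeries.X i) ∪
      hE.toFinset.biUnion fun e => (q e).support.image (q e).coeff
  let D := Algebra.adjoin ℤ (s0 : Set (MvPowerSeries (Fin d) K))
  have hX : ∀ i, MvPowerSeries.X i ∈ D := fun i => Algebra.subset_adjoin (by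
    simp only [s0, Finset.coe_union, Finset.coe_image]
    exact Or.inl ⟨i, by simp, rfl⟩)
  have hco : ∀ e ∈ E, ∀ k, (q e).coeff k ∈ D := by
    intro e he k
    by_cases hk : (q e).coeff k = 0
    · rw [hk]; exact D.zero_mem
    refine Algebra.subset_adjoin ?_
    simp only [s0, Finset.coe_union]
    refine Or.inr ?_
    rw [Finset.mem_coe, Finset.mem_biUnion]
    exact ⟨e, hE.mem_toFinset.2 he, Finset.mem_image.2 ⟨k, Polynomial.mem_support_iff.2 hk, rfl⟩⟩
  letI : Algebra D B := (f.comp (algebraMap D (MvPowerSeries (Fin d) K))).toAlgebra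
  have hDint : ∀ e ∈ E, IsIntegral D e := by
    intro e he
    obtain ⟨r, hr⟩ := exists_poly_lift D (q e) (hco e he)
    have hinj : Function.Injective (algebraMap D (MvPowerSeries (Fin d) K)) := Subtype.val_injective
    refine ⟨r, ?_, ?_⟩
    · refine Polynomial.monic_of_injective hinj ?_
      rw [hr]; exact hq e
    · change Polynomial.eval₂ (f.comp (algebraMap D (MvPowerSeries (Fin d) K))) e r = 0
      rw [← Polynomial.eval₂_map, hr]; exact hq0 e
  let B1 : Subalgebra D B := Algebra.adjoin D E
  have hEB : ∀ e ∈ E, e ∈ B1.toSubring := fun e he => Algebra.subset_adjoin he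
  haveI : Module.Finite D B1 := Algebra.finite_adjoin_of_finite_of_isIntegral hE hDint
  have hdB : ∀ i j, F.d i j ∈ B1.toSubring := fun i j => hEB _ (Or.inl (Or.inl ⟨(i, j), rfl⟩))
  have hhB : ∀ k i j, h k i j ∈ B1.toSubring := fun k i j => hEB _ (Or.inl (Or.inr ⟨(k, i, j), rfl⟩))
  have hcB : ∀ j k, c j k ∈ B1.toSubring := fun j k => hEB _ (Or.inr ⟨(j, k), rfl⟩)
  have hinj : Function.Injective (algebraMap D B1) := by
    intro u v huv
    exact Subtype.ext (hf (congrArg Subtype.val huv))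
  haveI : Nontrivial D := ⟨⟨0, 1, fun h =>
    zero_ne_one (α := MvPowerSeries (Fin d) K) (congrArg Subtype.val h)⟩⟩
  obtain ⟨S, _, _, _, _, p, _, _, hdim, θ, hm, -⟩ := tp_sub (tp_all d) K s0 hX 1 one_ne_zero
  refine core_fin (B := B1) hinj p d hdim θ (fun i => ⟨_, hX i⟩) hm
    (F.descend B1.toSubring hdB) s hs ?_ a ha ?_
  · intro k
    refine ⟨M k, ?_⟩
    exact F.descend_null B1.toSubring hdB _ (h k) (hhB k) (hdeg k) (he k)
  · intro j
    refine ⟨N j, ?_⟩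
    refine Ideal.mem_span_range_iff_exists_fun.2 ⟨fun k => ⟨c j k, hcB j k⟩, ?_⟩
    refine Subtype.ext ?_
    refine Eq.trans ?_ (hc j)
    change B1.val _ = _
    rw [map_sum]
    rfl

end NIT

-- Part 9

namespace NIT
open IsLocalRing

lemma formallySmooth_char0 (K : Type) [Field K] [Algebra ℚ K] : Algebra.FormallySmooth ℚ K := by
  obtain ⟨s, hs⟩ := exists_isTranscendenceBasis ℚ K
  haveI : Algebra.IsAlgebraic (IntermediateField.adjoin ℚ (Set.range ((↑) : s → K))) K := hs.isAlgebraic_field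
  exact Algebra.FormallySmooth.of_algebraicIndependent_of_isSeparable hs.1

lemma coeff_field (R : Type) [CommRing R] [IsLocalRing R] [IsAdicComplete (maximalIdeal R) R]
    [Algebra ℚ R] : ∃ σ : (R ⧸ maximalIdeal R) →+* R,
      ∀ y, Ideal.Quotient.mk (maximalIdeal R) (σ y) = y := by
  letI : Field (R ⧸ maximalIdeal R) := Ideal.Quotient.field _
  haveI := formallySmooth_char0 (R ⧸ maximalIdeal R)
  obtain ⟨g, hg⟩ := Algebra.FormallySmooth.exists_mkₐ_comp_eq_of_isAdicComplete (R := ℚ)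
    (I := maximalIdeal R) (AlgHom.id ℚ (R ⧸ maximalIdeal R))
  exact ⟨g, fun y => DFunLike.congr_fun hg y⟩

lemma mvps_lift {d : ℕ} {K R : Type} [Field K] [CommRing R] [IsLocalRing R]
    [IsAdicComplete (maximalIdeal R) R] (σ : K →+* R) (x : Fin d → R)
    (hx : ∀ i, x i ∈ maximalIdeal R) :
    ∃ f : MvPowerSeries (Fin d) K →+* R, (∀ i, f (MvPowerSeries.X i) = x i) ∧
      ∀ c, f (MvPowerSeries.C c) = σ c := by
  let I := MvPolynomial.idealOfVars (Fin d) K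
  let e : MvPolynomial (Fin d) K →+* R := MvPolynomial.eval₂Hom σ x
  have hI : ∀ n, I ^ n ≤ (maximalIdeal R ^ n).comap e := by
    intro n
    have h1 : I ≤ (maximalIdeal R).comap e := by
      change Ideal.span _ ≤ _
      rw [Ideal.span_le]
      rintro _ ⟨i, rfl⟩
      change e (MvPolynomial.X i) ∈ maximalIdeal R
      simpa [e] using hx i
    exact (Ideal.pow_right_mono h1 n).trans (Ideal.le_comap_pow _ _)
  let g : ∀ n, MvPowerSeries (Fin d) K →+* R ⧸ maximalIdeal R ^ n := fun n =>
    (Ideal.quotientMap (maximalIdeal R ^ n) e (hI n)).comp (MvPowerSeries.truncTotalAlgHom (Fin d) K n).toRingHom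
  have hg : ∀ n (q : MvPolynomial (Fin d) K), g n (q : MvPowerSeries (Fin d) K) = Ideal.Quotient.mk _ (e q) := by
    intro n q
    have h2 := (MvPowerSeries.truncTotalAlgHom (Fin d) K n).commutes q
    have h3 : algebraMap (MvPolynomial (Fin d) K) (MvPowerSeries (Fin d) K) q = q := rfl
    rw [h3] at h2
    change Ideal.quotientMap (maximalIdeal R ^ n) e (hI n) (MvPowerSeries.truncTotalAlgHom (Fin d) K n q) = _
    rw [h2]
    rfl
  have hcomp : ∀ {m n : ℕ} (hle : m ≤ n), (Ideal.Quotient.factorPow (maximalIdeal R) hle).comp (g n) = g m := by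
    intro m n hle
    ext p
    change Ideal.Quotient.mk (maximalIdeal R ^ m) (e (MvPowerSeries.truncTotal n p)) =
      Ideal.Quotient.mk (maximalIdeal R ^ m) (e (MvPowerSeries.truncTotal m p))
    rw [Ideal.Quotient.mk_eq_mk_iff_sub_mem, ← map_sub]
    exact hI m (MvPowerSeries.truncTotal_sub_truncTotal_mem_pow_idealOfVars hle le_rfl p)
  let f := IsAdicComplete.liftRingHom (maximalIdeal R) g hcomp
  have hf : ∀ q : MvPolynomial (Fin d) K, f (q : MvPowerSeries (Fin d) K) = e q := by
    intro q
    rw [IsHausdorff.eq_iff_smodEq (I := maximalIdeal R)]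
    intro n
    have := IsAdicComplete.mk_liftRingHom (maximalIdeal R) g hcomp n q
    rw [hg, Ideal.Quotient.mk_eq_mk_iff_sub_mem] at this
    rw [SModEq.sub_mem]
    simpa using this
  refine ⟨f, fun i => ?_, fun c => ?_⟩
  · have := hf (MvPolynomial.X i)
    simpa [e] using this
  · have := hf (MvPolynomial.C c)
    simpa [e] using this

end NIT

-- Part 10

namespace NIT
open IsLocalRing

lemma exists_nat_dim (R : Type) [CommRing R] [IsLocalRing R] [IsNoetherianRing R] :
    ∃ r : ℕ, ringKrullDim R = r := by
  have h1 : ringKrullDim R ≠ ⊤ := ringKrullDim_ne_top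
  have h2 : ringKrullDim R ≠ ⊥ := ringKrullDim_ne_bot
  obtain ⟨u, hu⟩ := WithBot.ne_bot_iff_exists.1 h2
  rw [← hu] at h1 ⊢
  have h3 : u ≠ ⊤ := fun h => h1 (by rw [h]; rfl)
  obtain ⟨v, rfl⟩ := ENat.ne_top_iff_exists.1 h3
  exact ⟨v, rfl⟩

lemma pow_le_of_minimal {R : Type} [CommRing R] [IsLocalRing R] [IsNoetherianRing R] (I : Ideal R)
    (h : maximalIdeal R ∈ I.minimalPrimes) : ∃ N, maximalIdeal R ^ N ≤ I := by
  have h1 : maximalIdeal R ≤ I.radical := by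
    rw [Ideal.radical_eq_sInf]
    refine le_sInf ?_
    rintro P ⟨hP, hPp⟩
    exact h.2 ⟨hPp, hP⟩ (le_maximalIdeal hPp.ne_top)
  obtain ⟨N, hN⟩ := Ideal.exists_radical_pow_le_of_fg I (IsNoetherian.noetherian _)
  exact ⟨N, (Ideal.pow_right_mono h1 N).trans hN⟩

lemma sop_exists {R : Type} [CommRing R] [IsLocalRing R] [IsNoetherianRing R] {d : ℕ}
    (hd : ringKrullDim R = d) : ∃ x : Fin d → R, (∀ i, x i ∈ maximalIdeal R) ∧
      ∃ N, maximalIdeal R ^ N ≤ Ideal.span (Set.range x) := by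
  obtain ⟨s, hs, hc⟩ := Ideal.exists_finset_card_eq_height_of_isNoetherianRing (maximalIdeal R)
  have hc' : s.card = d := by
    have := maximalIdeal_height_eq_ringKrullDim (R := R)
    rw [← hc, hd] at this
    exact_mod_cast this
  have e := s.equivFinOfCardEq hc'
  have hr : Set.range (fun i => (e.symm i : R)) = (s : Set R) := by
    ext y; constructor
    · rintro ⟨i, rfl⟩; exact (e.symm i).2
    · intro hy; exact ⟨e ⟨y, hy⟩, by simp⟩
  refine ⟨fun i => (e.symm i : R), fun i => hs.1.2 (Ideal.subset_span (e.symm i).2), ?_⟩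
  rw [hr]
  exact pow_le_of_minimal _ hs

lemma dim_le_of_sop {R : Type} [CommRing R] [IsLocalRing R] [IsNoetherianRing R] {k : ℕ}
    (x : Fin k → R) (hx : ∀ i, x i ∈ maximalIdeal R) (N : ℕ)
    (hN : maximalIdeal R ^ N ≤ Ideal.span (Set.range x)) : ringKrullDim R ≤ k := by
  classical
  have h1 : maximalIdeal R ∈ (Ideal.span ((Finset.univ.image x : Finset R) : Set R)).minimalPrimes := by
    rw [Finset.coe_image, Finset.coe_univ, Set.image_univ]
    refine ⟨⟨inferInstance, ?_⟩, ?_⟩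
    · rw [Ideal.span_le]; rintro _ ⟨i, rfl⟩; exact hx i
    · rintro Q ⟨hQ, hQ'⟩ -
      exact hQ.le_of_pow_le (hN.trans hQ')
  have h2 := Ideal.height_le_card_of_mem_minimalPrimes_span_finset h1
  rw [← maximalIdeal_height_eq_ringKrullDim]
  have h3 : (Finset.univ.image x).card ≤ k := Finset.card_image_le.trans (by simp)
  have h4 : (maximalIdeal R).height ≤ (k : ℕ∞) := h2.trans (by exact_mod_cast h3)
  exact_mod_cast h4

/-- every complete-type local ring with coefficient field: finite spanning sets modulo powers -/
lemma exists_span_mod {P R : Type} [CommRing P] [CommRing R] [IsLocalRing R] [Algebra P R]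
    (hfg : (maximalIdeal R).FG)
    (hres : ∀ y : R, ∃ c : P, y - algebraMap P R c ∈ maximalIdeal R) (n : ℕ) :
    ∃ W : Submodule P R, W.FG ∧ W ⊔ (maximalIdeal R ^ n).restrictScalars P = ⊤ := by
  induction n with
  | zero => exact ⟨⊥, Submodule.fg_bot, by simp⟩
  | succ n ih =>
    obtain ⟨W, hW, hWt⟩ := ih
    obtain ⟨G, hG⟩ := hfg.pow (n := n)
    refine ⟨W ⊔ Submodule.span P (G : Set R), hW.sup ⟨G, rfl⟩, ?_⟩
    rw [eq_top_iff, ← hWt, sup_assoc]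
    refine sup_le_sup_left ?_ _
    intro z hz
    have hz' : z ∈ Submodule.span R (G : Set R) := by
      have : z ∈ maximalIdeal R ^ n := hz
      rw [← hG] at this; exact this
    have hGm : ∀ g ∈ (G : Set R), g ∈ maximalIdeal R ^ n := fun g hg => by
      rw [← hG]; exact Ideal.subset_span hg
    clear hz
    induction hz' using Submodule.span_induction with
    | mem x h => exact Submodule.mem_sup_left (Submodule.subset_span h)
    | zero => exact Submodule.zero_mem _
    | add x y _ _ h1 h2 => exact Submodule.add_mem _ h1 h2
    | smul b y hy h =>
      obtain ⟨c, hc⟩ := hres b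
      have e : b • y = c • y + (b - algebraMap P R c) * y := by
        rw [smul_eq_mul, Algebra.smul_def]; ring
      rw [e]
      refine Submodule.add_mem _ (Submodule.smul_mem _ _ h) (Submodule.mem_sup_right ?_)
      change _ ∈ maximalIdeal R ^ (n + 1)
      rw [pow_succ']
      have hy' : y ∈ maximalIdeal R ^ n := by rw [← hG]; exact hy
      exact Ideal.mul_mem_mul hc hy'

lemma pi_precomplete {P : Type} [CommRing P] (I : Ideal P) [IsPrecomplete I P] (n : ℕ) :
    IsPrecomplete I (Fin n → P) := by
  have key : ∀ (k : ℕ) (v : Fin n → P), v ∈ (I ^ k • ⊤ : Submodule P (Fin n → P)) ↔ ∀ i, v i ∈ I ^ k := by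
    intro k v
    constructor
    · intro hv i
      have : (I ^ k • ⊤ : Submodule P (Fin n → P)) ≤ Submodule.comap (LinearMap.proj i : (Fin n → P) →ₗ[P] P) (I ^ k) := by
        rw [Submodule.smul_le]
        intro r hr m _
        exact Ideal.mul_mem_right _ _ hr
      exact this hv
    · intro hv
      have e : v = ∑ i, v i • (Pi.single i 1 : Fin n → P) := by
        ext j; simp [Finset.sum_apply, Pi.single_apply]
      rw [e]
      exact Submodule.sum_mem _ fun i _ => Submodule.smul_mem_smul (hv i) trivial
  constructor
  intro f hf
  have h1 : ∀ i, ∃ L : P, ∀ m, f m i ≡ L [SMOD (I ^ m • ⊤ : Submodule P P)] := by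
    intro i
    refine IsPrecomplete.prec ‹_› fun {m k} hmk => ?_
    have := hf hmk
    rw [SModEq.sub_mem, key] at this
    rw [SModEq.sub_mem]
    simpa using this i
  choose L hL using h1
  refine ⟨L, fun m => ?_⟩
  rw [SModEq.sub_mem, key]
  intro i
  have := hL i m
  rw [SModEq.sub_mem] at this
  simpa using this

lemma finite_of_complete {P R : Type} [CommRing P] [CommRing R] [IsLocalRing R] [Algebra P R]
    (I : Ideal P) [IsAdicComplete I P] [IsHausdorff (maximalIdeal R) R]
    (hfg : (maximalIdeal R).FG)
    (hres : ∀ y : R, ∃ c : P, y - algebraMap P R c ∈ maximalIdeal R)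
    (hI : I.map (algebraMap P R) ≤ maximalIdeal R) (N : ℕ)
    (hN : maximalIdeal R ^ N ≤ I.map (algebraMap P R)) : Module.Finite P R := by
  obtain ⟨W, ⟨G, hG⟩, hWt⟩ := exists_span_mod hfg hres N
  have hsm : (I • ⊤ : Submodule P R) = (I.map (algebraMap P R)).restrictScalars P :=
    Ideal.smul_top_eq_map I
  haveI : IsHausdorff I R := by
    constructor
    intro x hx
    apply IsHausdorff.haus (I := maximalIdeal R) ‹_›
    intro n
    have := hx n
    rw [SModEq.sub_mem] at this ⊢
    rw [Ideal.smul_top_eq_map] at this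
    have h2 : x - 0 ∈ (I ^ n).map (algebraMap P R) := this
    rw [Ideal.map_pow] at h2
    simpa using Ideal.pow_right_mono hI n h2
  let e := G.equivFin
  let g : (Fin G.card → P) →ₗ[P] R := Fintype.linearCombination P fun i => ((e.symm i : G) : R)
  have hg : LinearMap.range g = W := by
    rw [Fintype.range_linearCombination, ← hG]
    congr 1
    ext y; constructor
    · rintro ⟨i, rfl⟩; exact (e.symm i).2
    · intro hy; exact ⟨e ⟨y, hy⟩, by simp⟩
  haveI := pi_precomplete I G.card
  have hs : Function.Surjective g := by
    apply surjective_of_mkQ_comp_surjective (I := I)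
    rw [← LinearMap.range_eq_top, LinearMap.range_comp, hg, eq_top_iff]
    rintro y -
    obtain ⟨y, rfl⟩ := Submodule.mkQ_surjective _ y
    have hy : y ∈ W ⊔ (maximalIdeal R ^ N).restrictScalars P := by rw [hWt]; trivial
    obtain ⟨w, hw, z, hz, rfl⟩ := Submodule.mem_sup.1 hy
    refine ⟨w, hw, ?_⟩
    rw [map_add, left_eq_add, Submodule.mkQ_apply, Submodule.Quotient.mk_eq_zero, hsm]
    exact hN hz
  exact Module.Finite.of_surjective g hs

end NIT

-- Part 11

namespace NIT
open IsLocalRing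

lemma dim_le_of_sop_completion {B : Type} [CommRing B] [IsLocalRing B] [IsNoetherianRing B] {r : ℕ}
    (y : Fin r → AdicCompletion (maximalIdeal B) B)
    (hy : ∀ i, y i ∈ maximalIdeal (AdicCompletion (maximalIdeal B) B)) (M : ℕ)
    (hM : maximalIdeal (AdicCompletion (maximalIdeal B) B) ^ M ≤ Ideal.span (Set.range y)) :
    ringKrullDim B ≤ r := by
  have hs := AdicCompletion.surjective_evalₐ (maximalIdeal B) (M + 1)
  have h1 : ∀ i, ∃ b : B, Ideal.Quotient.mk (maximalIdeal B ^ (M+1)) b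
      = AdicCompletion.evalₐ (maximalIdeal B) (M + 1) (y i) := fun i => Ideal.Quotient.mk_surjective _
  choose b hb using h1
  have hle : maximalIdeal B ^ (M+1) ≤ maximalIdeal B := Ideal.pow_le_self (Nat.succ_ne_zero _)
  haveI : Nontrivial (B ⧸ maximalIdeal B ^ (M+1)) :=
    Ideal.Quotient.nontrivial_iff.2 fun h => by
      rw [h] at hle; exact (Ideal.IsPrime.ne_top inferInstance) (top_le_iff.1 hle)
  have hbm : ∀ i, b i ∈ maximalIdeal B := by
    intro i
    by_contra h
    have h2 : IsUnit (b i) := by simpa using h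
    have h3 := h2.map (Ideal.Quotient.mk (maximalIdeal B ^ (M+1)))
    rw [hb] at h3
    haveI : IsLocalHom (AdicCompletion.evalₐ (maximalIdeal B) (M + 1)).toRingHom :=
      IsLocalHom.of_surjective _ hs
    exact (mem_maximalIdeal _).1 (hy i) (isUnit_of_map_unit (AdicCompletion.evalₐ (maximalIdeal B) (M + 1)).toRingHom _ h3)
  refine dim_le_of_sop b hbm M ?_
  refine Submodule.le_of_le_smul_of_le_jacobson_bot (I := maximalIdeal B)
    (IsNoetherian.noetherian _) (by rw [IsLocalRing.jacobson_eq_maximalIdeal ⊥ bot_ne_top]) ?_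
  intro z hz
  have h4 : algebraMap B (AdicCompletion (maximalIdeal B) B) z ∈ Ideal.span (Set.range y) := by
    refine hM ?_
    rw [AdicCompletion.maximalIdeal_eq_map, ← Ideal.map_pow]
    exact Ideal.mem_map_of_mem _ hz
  have h5 := Ideal.mem_map_of_mem (AdicCompletion.evalₐ (maximalIdeal B) (M + 1)) h4
  rw [Ideal.map_span, ← Set.range_comp] at h5
  have h6 : (AdicCompletion.evalₐ (maximalIdeal B) (M + 1)) ∘ y
      = (Ideal.Quotient.mk (maximalIdeal B ^ (M+1))) ∘ b := by
    ext i; exact (hb i).symm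
  rw [h6, AlgHom.commutes, Set.range_comp, ← Ideal.map_span] at h5
  change Ideal.Quotient.mk (maximalIdeal B ^ (M+1)) z ∈ _ at h5
  rw [← Ideal.mem_comap, Ideal.comap_map_of_surjective _ Ideal.Quotient.mk_surjective,
    ← RingHom.ker_eq_comap_bot, Ideal.mk_ker] at h5
  rw [smul_eq_mul, ← pow_succ']
  exact h5

lemma mvps_dim_quot {d : ℕ} {K : Type} [Field K] (h : MvPowerSeries (Fin d) K) (h0 : h ≠ 0)
    (hm : h ∈ maximalIdeal (MvPowerSeries (Fin d) K)) :
    ∃ r, r < d ∧ ∃ y : Fin r → MvPowerSeries (Fin d) K,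
      (∀ i, y i ∈ maximalIdeal (MvPowerSeries (Fin d) K)) ∧ ∃ N,
      maximalIdeal (MvPowerSeries (Fin d) K) ^ N ≤ Ideal.span (Set.range y) ⊔ Ideal.span {h} := by
  have e1 : ringKrullDim (MvPowerSeries (Fin d) K) ≤ d := by
    refine dim_le_of_sop (fun i => MvPowerSeries.X i) (fun i => ?_) 1 ?_
    · rw [mvps_maximalIdeal]; exact Ideal.subset_span ⟨i, rfl⟩
    · rw [pow_one, mvps_maximalIdeal]
  have hne : Ideal.span {h} ≠ (⊤ : Ideal (MvPowerSeries (Fin d) K)) := by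
    intro ht
    have : Ideal.span {h} ≤ maximalIdeal (MvPowerSeries (Fin d) K) := by
      rw [Ideal.span_le]; simpa using hm
    rw [ht] at this
    exact (Ideal.IsPrime.ne_top inferInstance) (top_le_iff.1 this)
  haveI : Nontrivial (MvPowerSeries (Fin d) K ⧸ Ideal.span {h}) := Ideal.Quotient.nontrivial_iff.2 hne
  haveI : IsLocalRing (MvPowerSeries (Fin d) K ⧸ Ideal.span {h}) :=
    IsLocalRing.of_surjective' _ Ideal.Quotient.mk_surjective
  have e2 := ringKrullDim_quotient_succ_le_of_nonZeroDivisor (mem_nonZeroDivisors_of_ne_zero h0)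
  obtain ⟨r, hr⟩ := exists_nat_dim (MvPowerSeries (Fin d) K ⧸ Ideal.span {h})
  obtain ⟨y, hy, N, hN⟩ := sop_exists hr
  have hrd : r < d := by
    rw [hr] at e2
    have := e2.trans e1
    exact_mod_cast this
  choose z hz using fun i => Ideal.Quotient.mk_surjective (y i)
  haveI : IsLocalHom (Ideal.Quotient.mk (Ideal.span {h})) :=
      IsLocalHom.of_surjective _ Ideal.Quotient.mk_surjective
  refine ⟨r, hrd, z, fun i => ?_, N, ?_⟩
  · by_contra hc
    have h2 : IsUnit (z i) := by simpa using hc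
    have := h2.map (Ideal.Quotient.mk (Ideal.span {h}))
    rw [hz] at this
    exact (mem_maximalIdeal _).1 (hy i) this
  · have e3 : (maximalIdeal (MvPowerSeries (Fin d) K)).map (Ideal.Quotient.mk (Ideal.span {h}))
        ≤ maximalIdeal _ := by
      rw [Ideal.map_le_iff_le_comap, IsLocalRing.maximalIdeal_comap]
    have e4 := Ideal.pow_right_mono e3 N
    rw [← Ideal.map_pow] at e4
    have e5 := Ideal.map_le_iff_le_comap.1 (e4.trans hN)
    have e6 : Set.range y = (Ideal.Quotient.mk (Ideal.span {h})) '' Set.range z := by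
      rw [← Set.range_comp]; congr 1; ext i; exact (hz i).symm
    rw [e6, ← Ideal.map_span, Ideal.comap_map_of_surjective _ Ideal.Quotient.mk_surjective,
      ← RingHom.ker_eq_comap_bot, Ideal.mk_ker] at e5
    exact e5

theorem nit_eqz {B : Type} [CommRing B] [IsLocalRing B] [IsNoetherianRing B] [Algebra ℚ B]
    (F : FC B) (s : ℕ) (hs : ∀ i, F.deg i ≤ s)
    (hF : ∀ x ∈ maximalIdeal B, ∃ M, F.NullHtp (x ^ M)) (a : F.ι) (ha : F.deg a = 0)
    (hd : ∀ j, F.d a j ∈ maximalIdeal B) : ringKrullDim B ≤ s := by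
  obtain ⟨d, hdim⟩ := exists_nat_dim B
  obtain ⟨x, hx, N, hN⟩ := sop_exists hdim
  let R := AdicCompletion (maximalIdeal B) B
  let g : B →+* R := algebraMap B R
  letI : Algebra ℚ R := (g.comp (algebraMap ℚ B)).toAlgebra
  obtain ⟨σ, hσ⟩ := coeff_field R
  letI : Field (R ⧸ maximalIdeal R) := Ideal.Quotient.field _
  haveI : CharZero (R ⧸ maximalIdeal R) := algebraRat.charZero _
  have hgx : ∀ i, g (x i) ∈ maximalIdeal R := fun i => by
    rw [AdicCompletion.maximalIdeal_eq_map]; exact Ideal.mem_map_of_mem _ (hx i)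
  obtain ⟨f, hf, hfC⟩ := mvps_lift σ (fun i => g (x i)) hgx
  letI : Algebra (MvPowerSeries (Fin d) (R ⧸ maximalIdeal R)) R := f.toAlgebra
  have hmap : (maximalIdeal (MvPowerSeries (Fin d) (R ⧸ maximalIdeal R))).map f
      = Ideal.span (Set.range fun i => g (x i)) := by
    rw [mvps_maximalIdeal, Ideal.map_span, ← Set.range_comp]
    congr 2; funext i; exact hf i
  have hle : (maximalIdeal (MvPowerSeries (Fin d) (R ⧸ maximalIdeal R))).map f ≤ maximalIdeal R := by
    rw [hmap, Ideal.span_le]; rintro _ ⟨i, rfl⟩; exact hgx i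
  have hN' : maximalIdeal R ^ N ≤ Ideal.span (Set.range fun i => g (x i)) := by
    rw [AdicCompletion.maximalIdeal_eq_map, ← Ideal.map_pow]
    refine (Ideal.map_mono hN).trans ?_
    rw [Ideal.map_span, ← Set.range_comp]; exact le_rfl
  have hfin : Module.Finite (MvPowerSeries (Fin d) (R ⧸ maximalIdeal R)) R := by
    refine finite_of_complete (maximalIdeal _) ?_ ?_ hle N (hN'.trans hmap.ge)
    · rw [AdicCompletion.maximalIdeal_eq_map]
      exact Ideal.FG.map (IsNoetherian.noetherian (maximalIdeal B)) _
    · intro y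
      refine ⟨MvPowerSeries.C (Ideal.Quotient.mk _ y), ?_⟩
      rw [← Ideal.Quotient.eq, RingHom.algebraMap_toAlgebra, hfC, hσ]
  have hintg : f.IsIntegral := fun y => Algebra.IsIntegral.isIntegral (R := MvPowerSeries (Fin d) (R ⧸ maximalIdeal R)) y
  have hinj : Function.Injective f := by
    rw [injective_iff_map_eq_zero]
    intro h hh
    by_contra h0
    have hm : h ∈ maximalIdeal (MvPowerSeries (Fin d) (R ⧸ maximalIdeal R)) := by
      by_contra hc
      have h2 : IsUnit h := by simpa using hc
      have := h2.map f
      rw [hh] at this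
      exact not_isUnit_zero this
    obtain ⟨r, hr, y, hy, M, hM⟩ := mvps_dim_quot h h0 hm
    have h3 : ringKrullDim B ≤ r := by
      refine dim_le_of_sop_completion (fun i => f (y i)) (fun i => hle (Ideal.mem_map_of_mem _ (hy i))) (N * M) ?_
      rw [pow_mul]
      refine (Ideal.pow_right_mono (hN'.trans hmap.ge) M).trans ?_
      rw [← Ideal.map_pow]
      refine (Ideal.map_mono hM).trans ?_
      rw [Ideal.map_sup, Ideal.map_span, Ideal.map_span, Set.image_singleton, hh, ← Set.range_comp]
      rw [Ideal.span_singleton_zero, sup_bot_eq]; exact le_rfl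
    rw [hdim] at h3
    have : d ≤ r := by exact_mod_cast h3
    omega
  have := eqz_core (R ⧸ maximalIdeal R) f hinj hintg (F.map g) s hs (fun k => ?_) a ha (fun j => ⟨N, ?_⟩)
  · rw [hdim]; exact_mod_cast this
  · obtain ⟨M, hM⟩ := hF _ (hx k)
    refine ⟨M, ?_⟩
    have := hM.map g
    rw [map_pow] at this
    rw [hf]; exact this
  · simp only [hf]
    refine hN' (Ideal.pow_mem_pow ?_ _)
    rw [AdicCompletion.maximalIdeal_eq_map]; exact Ideal.mem_map_of_mem _ (hd j)

end NIT

-- Part 12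

namespace NIT

section rl
variable {B : Type} [CommRing B]
  {M : Type} [AddCommGroup M] [Module B M] {M' : Type} [AddCommGroup M'] [Module B M']

/-- relative length of two submodules -/
noncomputable def rl (Q Z : Submodule B M) : ℕ∞ := Module.length B (Z ⧸ Q.submoduleOf Z)

lemma rl_equiv (Z Q : Submodule B M) (Z' Q' : Submodule B M') (f : M →ₗ[B] M')
    (h1 : ∀ z ∈ Z, f z ∈ Z') (h2 : ∀ z ∈ Z, f z ∈ Q' ↔ z ∈ Q) (hQ : Q ≤ Z)
    (h3 : ∀ z' ∈ Z', ∃ z ∈ Z, z' - f z ∈ Q') : rl Q Z = rl Q' Z' := by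
  refine le_antisymm (length_quot_le Z Q Z' Q' f h1 fun z hz => (h2 z hz).1) ?_
  have := length_quot_le_add Z' Q' Z Q (⊥ : Submodule B M') ⊥ f 0 (by simp)
    (fun z hz => (h2 z (hQ hz)).2 hz) (fun z hz _ => h3 z hz)
  refine this.trans (le_of_eq ?_)
  have h0 : Module.length B ((⊥ : Submodule B M') ⧸ (⊥ : Submodule B M').submoduleOf ⊥) = 0 := by
    rw [Module.length_eq_zero_iff]
    infer_instance
  rw [h0, add_zero]; rfl

lemma rl_add {Q P Z : Submodule B M} (h1 : Q ≤ P) (h2 : P ≤ Z) : rl Q Z = rl Q P + rl P Z := by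
  have hle : Q.submoduleOf Z ≤ P.submoduleOf Z := fun z hz => h1 hz
  let f : (P ⧸ Q.submoduleOf P) →ₗ[B] (Z ⧸ Q.submoduleOf Z) :=
    Submodule.mapQ _ _ (Submodule.inclusion h2) (fun z hz => hz)
  let g : (Z ⧸ Q.submoduleOf Z) →ₗ[B] (Z ⧸ P.submoduleOf Z) := Submodule.factor hle
  refine Module.length_eq_add_of_exact f g ?_ (Submodule.factor_surjective hle) ?_
  · rw [← LinearMap.ker_eq_bot, eq_bot_iff]
    intro x hx
    induction x using Submodule.Quotient.induction_on with
    | _ x =>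
    have : Submodule.Quotient.mk (Submodule.inclusion h2 x) = (0 : Z ⧸ Q.submoduleOf Z) := hx
    rw [Submodule.Quotient.mk_eq_zero] at this
    exact (Submodule.Quotient.mk_eq_zero _).2 this
  · intro y
    induction y using Submodule.Quotient.induction_on with
    | _ y =>
    constructor
    · intro hy
      have : (Submodule.Quotient.mk y : Z ⧸ P.submoduleOf Z) = 0 := hy
      rw [Submodule.Quotient.mk_eq_zero] at this
      exact ⟨Submodule.Quotient.mk ⟨y.1, this⟩, rfl⟩
    · rintro ⟨x, hx⟩
      rw [← hx]
      induction x using Submodule.Quotient.induction_on with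
      | _ x =>
      change (Submodule.Quotient.mk (Submodule.inclusion h2 x) : Z ⧸ P.submoduleOf Z) = 0
      rw [Submodule.Quotient.mk_eq_zero]
      exact x.2

lemma rl_zero {Q Z : Submodule B M} (h : Z ≤ Q) : rl Q Z = 0 := by
  rw [rl, Module.length_eq_zero_iff]
  rw [Submodule.Quotient.subsingleton_iff]
  rw [eq_top_iff]; intro z _; exact h z.2

/-- length of homology of a family of submodules -/
noncomputable def chl (D : M →ₗ[B] M) (U : ℕ → Submodule B M) (j : ℕ) : ℕ∞ :=
  rl ((U (j+1)).map D) (U j ⊓ LinearMap.ker D)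

lemma chl_les (D : M →ₗ[B] M) (D' : M' →ₗ[B] M')
    (A U : ℕ → Submodule B M) (hDDU : ∀ j, ∀ z ∈ U j, D (D z) = 0)
    (V : ℕ → Submodule B M') (f : M →ₗ[B] M')
    (hU : ∀ j, ∀ z ∈ U (j+1), D z ∈ U j) (hU0 : ∀ z ∈ U 0, D z = 0)
    (hf : ∀ j, ∀ z ∈ U j, f (D z) = D' (f z))
    (hA : ∀ j z, z ∈ A j ↔ z ∈ U j ∧ f z = 0)
    (hV : ∀ j z', z' ∈ V j ↔ ∃ z ∈ U j, f z = z') :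
    ∃ r : ℕ → ℕ∞, (chl D U 0 + r 0 = chl D A 0 + chl D' V 0) ∧
      (∀ j, chl D U (j+1) + r (j+1) + r j = chl D A (j+1) + chl D' V (j+1)) ∧
      (∀ j, r j ≤ chl D A j) ∧ (∀ j, r j ≤ chl D' V (j+1)) := by
  let r : ℕ → ℕ∞ := fun j => rl ((A (j+1)).map D) (A j ⊓ (U (j+1)).map D)
  let aa : ℕ → ℕ∞ := fun j => rl (A j ⊓ (U (j+1)).map D) (A j ⊓ LinearMap.ker D)
  let c : ℕ → ℕ∞ := fun j => rl ((U (j+1)).map D ⊔ (A j ⊓ LinearMap.ker D)) (U j ⊓ LinearMap.ker D)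
  let t : ℕ → ℕ∞ := fun j => rl ((U j ⊓ LinearMap.ker D).map f) (V j ⊓ LinearMap.ker D')
  have hAU : ∀ j, A j ≤ U j := fun j z hz => ((hA j z).1 hz).1
  have hDA : ∀ j, ∀ z ∈ A (j+1), D z ∈ A j := by
    intro j z hz
    obtain ⟨h1, h2⟩ := (hA _ _).1 hz
    exact (hA _ _).2 ⟨hU j z h1, by rw [hf _ z h1, h2, map_zero]⟩
  have e1 : ∀ j, chl D A j = r j + aa j := by
    intro j
    refine rl_add ?_ ?_
    · rintro _ ⟨z, hz, rfl⟩
      exact ⟨hDA j z hz, z, hAU _ hz, rfl⟩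
    · rintro _ ⟨h1, z, hz, rfl⟩
      exact ⟨h1, hDDU _ z hz⟩
  have e2 : ∀ j, chl D U j = aa j + c j := by
    intro j
    have h1 : (U (j+1)).map D ≤ U j ⊓ LinearMap.ker D := by
      rintro _ ⟨z, hz, rfl⟩
      exact ⟨hU j z hz, hDDU _ z hz⟩
    have h2 : A j ⊓ LinearMap.ker D ≤ U j ⊓ LinearMap.ker D := inf_le_inf_right _ (hAU j)
    rw [chl, rl_add (le_sup_left : _ ≤ (U (j+1)).map D ⊔ (A j ⊓ LinearMap.ker D)) (sup_le h1 h2)]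
    congr 1
    symm
    refine rl_equiv _ _ _ _ LinearMap.id ?_ ?_ ?_ ?_
    · intro z hz; exact Submodule.mem_sup_right hz
    · intro z hz
      exact ⟨fun h => ⟨hz.1, h⟩, fun h => h.2⟩
    · intro z hz
      exact ⟨hz.1, (h1 hz.2).2⟩
    · intro z hz
      obtain ⟨u, hu, v, hv, rfl⟩ := Submodule.mem_sup.1 hz
      exact ⟨v, hv, by simpa using hu⟩
  have e3 : ∀ j, chl D' V j = c j + t j := by
    intro j
    have h1 : (V (j+1)).map D' ≤ (U j ⊓ LinearMap.ker D).map f := by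
      rintro _ ⟨v, hv, rfl⟩
      obtain ⟨u, hu, rfl⟩ := (hV _ _).1 hv
      rw [← hf _ u hu]
      exact ⟨D u, ⟨hU j u hu, hDDU _ u hu⟩, rfl⟩
    have h2 : (U j ⊓ LinearMap.ker D).map f ≤ V j ⊓ LinearMap.ker D' := by
      rintro _ ⟨u, hu, rfl⟩
      refine ⟨(hV _ _).2 ⟨u, hu.1, rfl⟩, ?_⟩
      change D' (f u) = 0
      rw [← hf _ u hu.1, (hu.2 : D u = 0), map_zero]
    rw [chl, rl_add h1 h2]
    congr 1
    symm
    refine rl_equiv _ _ _ _ f ?_ ?_ ?_ ?_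
    · intro z hz; exact ⟨z, hz, rfl⟩
    · intro z hz
      constructor
      · rintro ⟨v, hv, hvz⟩
        obtain ⟨u, hu, rfl⟩ := (hV _ _).1 hv
        rw [← hf _ u hu] at hvz
        refine Submodule.mem_sup.2 ⟨D u, ⟨u, hu, rfl⟩, z - D u, ⟨?_, ?_⟩, by abel⟩
        · exact (hA _ _).2 ⟨sub_mem hz.1 (hU j u hu), by rw [map_sub, hvz, sub_self]⟩
        · change D (z - D u) = 0
          rw [map_sub, hDDU _ u hu, (hz.2 : D z = 0), sub_zero]
      · intro h
        obtain ⟨_, ⟨u, hu, rfl⟩, a, ha, rfl⟩ := Submodule.mem_sup.1 h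
        rw [map_add, ((hA _ _).1 ha.1).2, add_zero, hf _ u hu]
        exact ⟨f u, (hV _ _).2 ⟨u, hu, rfl⟩, rfl⟩
    · refine sup_le ?_ (inf_le_inf_right _ (hAU j))
      rintro _ ⟨z, hz, rfl⟩
      exact ⟨hU j z hz, hDDU _ z hz⟩
    · rintro _ ⟨u, hu, rfl⟩
      exact ⟨u, hu, by simp⟩
  have e4 : t 0 = 0 := by
    refine rl_zero ?_
    rintro v ⟨hv, -⟩
    obtain ⟨u, hu, rfl⟩ := (hV _ _).1 hv
    exact ⟨u, ⟨hu, hU0 u hu⟩, rfl⟩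
  have e5 : ∀ j, t (j+1) = r j := by
    intro j
    let Zz : Submodule B M := U (j+1) ⊓ (A j).comap D
    let Qq : Submodule B M := (U (j+1) ⊓ LinearMap.ker D) ⊔ A (j+1)
    have hQZ : Qq ≤ Zz := by
      refine sup_le ?_ ?_
      · rintro z ⟨h1, h2⟩
        refine ⟨h1, ?_⟩
        change D z ∈ A j
        rw [(h2 : D z = 0)]; exact zero_mem _
      · intro z hz; exact ⟨hAU _ hz, hDA j z hz⟩
    have k1 : rl Qq Zz = t (j+1) := by
      refine rl_equiv _ _ _ _ f ?_ ?_ hQZ ?_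
      · rintro z ⟨h1, h2⟩
        refine ⟨(hV _ _).2 ⟨z, h1, rfl⟩, ?_⟩
        change D' (f z) = 0
        rw [← hf _ z h1]
        exact ((hA _ _).1 h2).2
      · rintro z ⟨h1, h2⟩
        constructor
        · rintro ⟨u, hu, he⟩
          refine Submodule.mem_sup.2 ⟨u, hu, z - u, (hA _ _).2 ⟨sub_mem h1 hu.1, ?_⟩, by abel⟩
          rw [map_sub, he, sub_self]
        · intro h
          obtain ⟨u, hu, a, ha, rfl⟩ := Submodule.mem_sup.1 h
          rw [map_add, ((hA _ _).1 ha).2, add_zero]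
          exact ⟨u, hu, rfl⟩
      · rintro v ⟨hv, hv'⟩
        obtain ⟨u, hu, rfl⟩ := (hV _ _).1 hv
        refine ⟨u, ⟨hu, (hA _ _).2 ⟨hU j u hu, ?_⟩⟩, by simp⟩
        rw [hf _ u hu]; exact hv'
    have k2 : rl Qq Zz = r j := by
      refine rl_equiv _ _ _ _ D ?_ ?_ hQZ ?_
      · rintro z ⟨h1, h2⟩
        exact ⟨h2, z, h1, rfl⟩
      · rintro z ⟨h1, h2⟩
        constructor
        · rintro ⟨a, ha, he⟩
          refine Submodule.mem_sup.2 ⟨z - a, ⟨sub_mem h1 (hAU _ ha), ?_⟩, a, ha, by abel⟩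
          change D (z - a) = 0
          rw [map_sub, he, sub_self]
        · intro h
          obtain ⟨u, hu, a, ha, rfl⟩ := Submodule.mem_sup.1 h
          rw [map_add, LinearMap.mem_ker.1 hu.2, zero_add]
          exact ⟨a, ha, rfl⟩
      · rintro _ ⟨h1, u, hu, rfl⟩
        exact ⟨u, ⟨hu, h1⟩, by simp⟩
    rw [← k1, k2]
  refine ⟨r, ?_, ?_, ?_, ?_⟩
  · rw [e1, e2, e3, e4, add_zero]; ring
  · intro j
    rw [e1, e2, e3, e5]; ring
  · intro j; rw [e1]; exact le_self_add
  · intro j; rw [e3, e5]; exact le_add_self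

/-- Euler characteristic (meaningful if all lengths are finite and vanish beyond `L`) -/
noncomputable def chi (D : M →ₗ[B] M) (U : ℕ → Submodule B M) (L : ℕ) : ℤ :=
  ∑ j ∈ Finset.range L, (-1) ^ j * ((chl D U j).toNat : ℤ)

lemma chi_add (D : M →ₗ[B] M) (D' : M' →ₗ[B] M')
    (A U : ℕ → Submodule B M) (hDDU : ∀ j, ∀ z ∈ U j, D (D z) = 0)
    (V : ℕ → Submodule B M') (f : M →ₗ[B] M')
    (hU : ∀ j, ∀ z ∈ U (j+1), D z ∈ U j) (hU0 : ∀ z ∈ U 0, D z = 0)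
    (hf : ∀ j, ∀ z ∈ U j, f (D z) = D' (f z))
    (hA : ∀ j z, z ∈ A j ↔ z ∈ U j ∧ f z = 0)
    (hV : ∀ j z', z' ∈ V j ↔ ∃ z ∈ U j, f z = z')
    (L : ℕ) (hL : ∀ j, L ≤ j → U j = ⊥) (hfin : ∀ j, chl D U j ≠ ⊤) :
    ((∀ j, chl D A j ≠ ⊤) ↔ (∀ j, chl D' V j ≠ ⊤)) ∧
    ((∀ j, chl D A j ≠ ⊤) → chi D U L = chi D A L + chi D' V L) := by
  obtain ⟨r, r0, r1, r2, r3⟩ := chl_les D D' A U hDDU V f hU hU0 hf hA hV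
  have hiff : (∀ j, chl D A j ≠ ⊤) ↔ (∀ j, chl D' V j ≠ ⊤) := by
    constructor
    · intro h j
      have hr : ∀ j, r j ≠ ⊤ := fun j => ne_top_of_le_ne_top (h j) (r2 j)
      cases j with
      | zero =>
        refine ne_top_of_le_ne_top ?_ (r0 ▸ le_add_self : chl D' V 0 ≤ chl D U 0 + r 0)
        exact WithTop.add_ne_top.2 ⟨hfin 0, hr 0⟩
      | succ j =>
        refine ne_top_of_le_ne_top ?_ (r1 j ▸ le_add_self : chl D' V (j+1) ≤ chl D U (j+1) + r (j+1) + r j)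
        exact WithTop.add_ne_top.2 ⟨WithTop.add_ne_top.2 ⟨hfin _, hr _⟩, hr _⟩
    · intro h j
      have hr : ∀ j, r j ≠ ⊤ := fun j => ne_top_of_le_ne_top (h (j+1)) (r3 j)
      cases j with
      | zero =>
        refine ne_top_of_le_ne_top ?_ (r0 ▸ le_self_add : chl D A 0 ≤ chl D U 0 + r 0)
        exact WithTop.add_ne_top.2 ⟨hfin 0, hr 0⟩
      | succ j =>
        refine ne_top_of_le_ne_top ?_ (r1 j ▸ le_self_add : chl D A (j+1) ≤ chl D U (j+1) + r (j+1) + r j)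
        exact WithTop.add_ne_top.2 ⟨WithTop.add_ne_top.2 ⟨hfin _, hr _⟩, hr _⟩
  refine ⟨hiff, fun hAf => ?_⟩
  have hVf := hiff.1 hAf
  have hr : ∀ j, r j ≠ ⊤ := fun j => ne_top_of_le_ne_top (hAf j) (r2 j)
  have hrL : ∀ j, L ≤ j + 1 → r j = 0 := by
    intro j hj
    have hV0 : V (j+1) = ⊥ := by
      rw [eq_bot_iff]
      intro v hv
      obtain ⟨u, hu, rfl⟩ := (hV _ _).1 hv
      rw [hL _ hj] at hu
      rw [(Submodule.mem_bot B).1 hu, map_zero]; exact zero_mem _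
    have : chl D' V (j+1) = 0 := by
      refine rl_zero ?_
      rw [hV0]; simp
    exact le_antisymm (this ▸ r3 j) bot_le
  have key : ∀ n, ∑ j ∈ Finset.range (n+1), (-1 : ℤ) ^ j * ((chl D U j).toNat : ℤ) + (-1)^n * ((r n).toNat : ℤ)
      = ∑ j ∈ Finset.range (n+1), (-1 : ℤ) ^ j * ((chl D A j).toNat : ℤ)
        + ∑ j ∈ Finset.range (n+1), (-1 : ℤ) ^ j * ((chl D' V j).toNat : ℤ) := by
    intro n
    induction n with
    | zero =>
      have := congrArg ENat.toNat r0
      rw [ENat.toNat_add (hfin 0) (hr 0), ENat.toNat_add (hAf 0) (hVf 0)] at this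
      simp only [zero_add, Finset.sum_range_one, pow_zero, one_mul]
      exact_mod_cast this
    | succ n ih =>
      have := congrArg ENat.toNat (r1 n)
      have hne : chl D U (n+1) + r (n+1) ≠ ⊤ := WithTop.add_ne_top.2 ⟨hfin (n+1), hr (n+1)⟩
      rw [ENat.toNat_add hne (hr n), ENat.toNat_add (hfin (n+1)) (hr (n+1)),
        ENat.toNat_add (hAf (n+1)) (hVf (n+1))] at this
      have h2 : ((chl D U (n+1)).toNat : ℤ) + (r (n+1)).toNat + (r n).toNat
        = (chl D A (n+1)).toNat + (chl D' V (n+1)).toNat := by exact_mod_cast this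
      rw [Finset.sum_range_succ _ (n+1), Finset.sum_range_succ _ (n+1), Finset.sum_range_succ _ (n+1)]
      have h3 : (-1 : ℤ)^(n+1) * ((chl D U (n+1)).toNat + (r (n+1)).toNat + (r n).toNat)
        = (-1)^(n+1) * ((chl D A (n+1)).toNat + (chl D' V (n+1)).toNat) := by rw [h2]
      rw [pow_succ] at h3 ⊢
      linear_combination ih + h3
  unfold chi
  cases L with
  | zero => simp
  | succ n =>
    have := key n
    rw [hrL n le_rfl] at this
    simpa using this

end rl
end NIT

-- Part 13

namespace NIT
namespace TPow

section ops
variable (B : Type) [CommRing B] (ι : Type) [Fintype ι]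

/-- index set -/
abbrev X (ι : Type) (n : ℕ) : Type := (Fin n → Bool) × ι
/-- function space -/
abbrev V (n : ℕ) : Type := X ι n → B

variable {ι}
def oc {n : ℕ} (c : Bool) (x : X ι n) : X ι (n+1) := (Fin.cons c x.1, x.2)
def ins {n : ℕ} (i : Fin (n+1)) (x : X ι n) : X ι (n+1) := (i.insertNth false x.1, x.2)
variable (ι)

def oP (n : ℕ) : V B ι (n+1) →ₗ[B] V B ι n := LinearMap.funLeft B B (oc true)
def oQ (n : ℕ) : V B ι (n+1) →ₗ[B] V B ι n := LinearMap.funLeft B B (oc false)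
def oR (n : ℕ) (i : Fin (n+1)) : V B ι (n+1) →ₗ[B] V B ι n := LinearMap.funLeft B B (ins i)

variable {B ι}
def oM (n : ℕ) (m : Matrix ι ι B) : V B ι n →ₗ[B] V B ι n where
  toFun y := fun x => ∑ b', m x.2 b' * y (x.1, b')
  map_add' y z := by ext x; simp [mul_add, Finset.sum_add_distrib]
  map_smul' c y := by
    ext x; simp only [Pi.smul_apply, smul_eq_mul, RingHom.id_apply, Finset.mul_sum]
    exact Finset.sum_congr rfl fun _ _ => by ring

def join {W : Type} [AddCommGroup W] [Module B W] {n : ℕ} (a b : W →ₗ[B] V B ι n) :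
    W →ₗ[B] V B ι (n+1) where
  toFun y := fun x => if x.1 0 then a y (Fin.tail x.1, x.2) else b y (Fin.tail x.1, x.2)
  map_add' y z := by ext x; by_cases h : x.1 0 = true <;> simp [h]
  map_smul' c y := by ext x; by_cases h : x.1 0 = true <;> simp [h]

variable {W : Type} [AddCommGroup W] [Module B W]

lemma P_join {n : ℕ} (a b : W →ₗ[B] V B ι n) (y : W) : oP B ι n (join a b y) = a y := by
  ext x; simp [oP, oc, join, LinearMap.funLeft_apply]
lemma Q_join {n : ℕ} (a b : W →ₗ[B] V B ι n) (y : W) : oQ B ι n (join a b y) = b y := by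
  ext x; simp [oQ, oc, join, LinearMap.funLeft_apply]

lemma ext_PQ {n : ℕ} {y z : V B ι (n+1)} (h1 : oP B ι n y = oP B ι n z)
    (h2 : oQ B ι n y = oQ B ι n z) : y = z := by
  funext x
  obtain ⟨A, b⟩ := x
  have hA : A = Fin.cons (A 0) (Fin.tail A) := (Fin.cons_self_tail A).symm
  rw [hA]
  cases A 0 with
  | true => exact congrFun h1 (Fin.tail A, b)
  | false => exact congrFun h2 (Fin.tail A, b)

variable (B ι) in
def kap : ∀ n, V B ι n →ₗ[B] V B ι n
  | 0 => 0
  | n+1 => join (oQ B ι n - kap n ∘ₗ oP B ι n) (kap n ∘ₗ oQ B ι n)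

lemma P_kap (n : ℕ) (y : V B ι (n+1)) :
    oP B ι n (kap B ι (n+1) y) = oQ B ι n y - kap B ι n (oP B ι n y) := P_join _ _ y
lemma Q_kap (n : ℕ) (y : V B ι (n+1)) :
    oQ B ι n (kap B ι (n+1) y) = kap B ι n (oQ B ι n y) := Q_join _ _ y

lemma kap_kap : ∀ (n : ℕ) (y : V B ι n), kap B ι n (kap B ι n y) = 0
  | 0, y => rfl
  | n+1, y => by
    refine ext_PQ ?_ ?_
    · rw [P_kap, Q_kap, P_kap, map_sub, kap_kap n, map_zero]; simp
    · rw [Q_kap, Q_kap, kap_kap n, map_zero]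

lemma P_M (n : ℕ) (m : Matrix ι ι B) (y : V B ι (n+1)) :
    oP B ι n (oM (n+1) m y) = oM n m (oP B ι n y) := rfl
lemma Q_M (n : ℕ) (m : Matrix ι ι B) (y : V B ι (n+1)) :
    oQ B ι n (oM (n+1) m y) = oM n m (oQ B ι n y) := rfl
lemma R_M (n : ℕ) (i : Fin (n+1)) (m : Matrix ι ι B) (y : V B ι (n+1)) :
    oR B ι n i (oM (n+1) m y) = oM n m (oR B ι n i y) := rfl

lemma kap_M : ∀ (n : ℕ) (m : Matrix ι ι B) (y : V B ι n),
    kap B ι n (oM n m y) = oM n m (kap B ι n y)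
  | 0, m, y => (map_zero _).symm
  | n+1, m, y => by
    refine ext_PQ ?_ ?_
    · rw [P_kap, P_M, P_M, P_kap, map_sub, Q_M, kap_M n]
    · rw [Q_kap, Q_M, Q_M, Q_kap, kap_M n]

lemma M_mul (n : ℕ) (m m' : Matrix ι ι B) (y : V B ι n) :
    oM n (m * m') y = oM n m (oM n m' y) := by
  funext x
  simp only [oM, LinearMap.coe_mk, AddHom.coe_mk, Matrix.mul_apply, Finset.sum_mul, Finset.mul_sum, mul_assoc]
  exact Finset.sum_comm
lemma M_add (n : ℕ) (m m' : Matrix ι ι B) (y : V B ι n) :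
    oM n (m + m') y = oM n m y + oM n m' y := by
  funext x
  simp [oM, add_mul, Finset.sum_add_distrib]
lemma M_one [DecidableEq ι] (n : ℕ) (c : B) (y : V B ι n) :
    oM n (c • (1 : Matrix ι ι B)) y = c • y := by
  funext x
  simp [oM, Matrix.one_apply]
lemma M_zero (n : ℕ) (y : V B ι n) :
    oM n (0 : Matrix ι ι B) y = 0 := by
  funext x
  simp [oM]

lemma R_zero (n : ℕ) : oR B ι n 0 = oQ B ι n := by
  ext y x
  simp [oR, oQ, ins, oc, LinearMap.funLeft_apply]
lemma P_R (n : ℕ) (i : Fin (n+1)) (y : V B ι (n+2)) :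
    oP B ι n (oR B ι (n+1) i.succ y) = oR B ι n i (oP B ι (n+1) y) := by
  ext x
  simp [oR, oP, ins, oc, LinearMap.funLeft_apply, Fin.insertNth_succ_cons]
lemma Q_R (n : ℕ) (i : Fin (n+1)) (y : V B ι (n+2)) :
    oQ B ι n (oR B ι (n+1) i.succ y) = oR B ι n i (oQ B ι (n+1) y) := by
  ext x
  simp [oR, oQ, ins, oc, LinearMap.funLeft_apply, Fin.insertNth_succ_cons]

lemma R_kap : ∀ (n : ℕ) (i : Fin (n+1)) (y : V B ι (n+1)),
    oR B ι n i (kap B ι (n+1) y) = kap B ι n (oR B ι n i y) := by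
  intro n
  induction n with
  | zero =>
    intro i y
    obtain rfl : i = 0 := by ext; omega
    rw [R_zero, Q_kap]
  | succ n ih =>
    intro i y
    refine Fin.cases ?_ (fun i => ?_) i
    · rw [R_zero, Q_kap]
    · refine ext_PQ ?_ ?_
      · rw [P_R, P_kap, map_sub, ih, P_kap, Q_R, P_R]
      · rw [Q_R, Q_kap, ih, Q_kap, Q_R]

/-- face operator -/
def oE (n : ℕ) (d : Matrix ι ι B) : V B ι (n+1) →ₗ[B] V B ι n :=
  oQ B ι n + (oM n d - kap B ι n) ∘ₗ oP B ι n

lemma oE_apply (n : ℕ) (d : Matrix ι ι B) (y : V B ι (n+1)) :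
    oE n d y = oQ B ι n y + (oM n d (oP B ι n y) - kap B ι n (oP B ι n y)) := rfl

lemma E_E (n : ℕ) (d : Matrix ι ι B) (hd : d * d = 0) (y : V B ι (n+2)) :
    oE n d (oE (n+1) d y) = oE n d (oQ B ι (n+1) y) := by
  have h1 : oE n d (oM (n+1) d (oP B ι (n+1) y) - kap B ι (n+1) (oP B ι (n+1) y)) = 0 := by
    rw [oE_apply]
    simp only [map_sub, P_M, Q_M, P_kap, Q_kap, kap_M, kap_kap, ← M_mul, hd, M_zero]
    abel
  rw [oE_apply (n+1), map_add, h1, add_zero]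

lemma R_E (n : ℕ) (i : Fin (n+1)) (d : Matrix ι ι B) (y : V B ι (n+2)) :
    oR B ι n i (oE (n+1) d y) = oE n d (oR B ι (n+1) i.succ y) := by
  simp only [oE_apply, map_add, map_sub, R_M, R_kap, P_R, Q_R]

/-- contraction -/
def oS (n : ℕ) (d h : Matrix ι ι B) : V B ι n →ₗ[B] V B ι (n+1) :=
  join (oM n h) (oM n h ∘ₗ (oM n d + kap B ι n))

lemma P_S (n : ℕ) (d h : Matrix ι ι B) (y : V B ι n) : oP B ι n (oS n d h y) = oM n h y :=
  P_join _ _ _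
lemma Q_S (n : ℕ) (d h : Matrix ι ι B) (y : V B ι n) :
    oQ B ι n (oS n d h y) = oM n h (oM n d y + kap B ι n y) :=
  Q_join _ _ _

lemma E_S [DecidableEq ι] (n : ℕ) (d h : Matrix ι ι B) (c : B) (hc : d * h + h * d = c • 1) (y : V B ι n) :
    oE n d (oS n d h y) = c • y := by
  rw [← M_one n c y, ← hc, M_add, M_mul, M_mul, oE_apply, P_S, Q_S, map_add, kap_M]
  abel

lemma Q_S_eq (n : ℕ) (d h : Matrix ι ι B) (hd : d * d = 0) (y : V B ι (n+1)) :
    oQ B ι (n+1) (oS (n+1) d h y) = oS n d h (oE n d y) := by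
  refine ext_PQ ?_ ?_
  · rw [Q_S, P_M, P_S, map_add, P_M, P_kap, oE_apply]
    congr 1; abel
  · rw [Q_S, Q_M, Q_S, map_add, Q_M, Q_kap, oE_apply]
    simp only [map_add, map_sub, kap_M, kap_kap, ← M_mul, hd, M_zero]
    abel

lemma R_S (n : ℕ) (i : Fin (n+1)) (d h : Matrix ι ι B) (y : V B ι (n+1)) :
    oR B ι (n+1) i.succ (oS (n+1) d h y) = oS n d h (oR B ι n i y) := by
  refine ext_PQ ?_ ?_
  · rw [P_R, P_S, P_S, R_M]
  · rw [Q_R, Q_S, Q_S, R_M, map_add, R_M, R_kap]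

/-! grading -/
def cd {n : ℕ} (A : Fin n → Bool) : ℤ := ∑ i, if A i then 1 else 0

lemma cd_cons {n : ℕ} (c : Bool) (A : Fin n → Bool) :
    cd (Fin.cons c A : Fin (n+1) → Bool) = (if c then 1 else 0) + cd A := by
  rw [cd, Fin.sum_univ_succ]; simp only [Fin.cons_zero, Fin.cons_succ]; rfl

/-- graded functions -/
def Gr {n : ℕ} (deg : ι → ℕ) (k : ℤ) (y : V B ι n) : Prop :=
  ∀ x, y x ≠ 0 → cd x.1 + k = deg x.2

variable {deg : ι → ℕ} {k : ℤ} {n : ℕ}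

lemma Gr.add {y z : V B ι n} (hy : Gr deg k y) (hz : Gr deg k z) : Gr deg k (y + z) := by
  intro x hx
  by_cases h : y x = 0
  · exact hz x (by intro h'; exact hx (by simp [h, h']))
  · exact hy x h
lemma Gr.neg {y : V B ι n} (hy : Gr deg k y) : Gr deg k (-y) := fun x hx => hy x (by simpa using hx)
lemma Gr.sub {y z : V B ι n} (hy : Gr deg k y) (hz : Gr deg k z) : Gr deg k (y - z) := by
  rw [sub_eq_add_neg]; exact hy.add hz.neg
lemma Gr.P {y : V B ι (n+1)} (hy : Gr deg k y) : Gr deg (k+1) (oP B ι n y) := by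
  intro x hx
  have := hy (oc true x) hx
  simp only [oc, cd_cons, if_true] at this
  linarith
lemma Gr.Q {y : V B ι (n+1)} (hy : Gr deg k y) : Gr deg k (oQ B ι n y) := by
  intro x hx
  have := hy (oc false x) hx
  simp only [oc, cd_cons] at this
  simpa using this
lemma Gr.of_PQ {y : V B ι (n+1)} (hP : Gr deg (k+1) (oP B ι n y)) (hQ : Gr deg k (oQ B ι n y)) :
    Gr deg k y := by
  rintro ⟨A, b⟩ hx
  rw [← Fin.cons_self_tail A] at hx ⊢
  simp only [cd_cons]
  cases h : A 0 with
  | true =>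
    rw [h] at hx
    have := hP (Fin.tail A, b) hx
    simp at this ⊢; linarith
  | false =>
    rw [h] at hx
    have := hQ (Fin.tail A, b) hx
    simp at this ⊢; linarith
lemma Gr.kap : ∀ {n : ℕ} {k : ℤ} {y : V B ι n}, Gr deg (k+1) y → Gr deg k (kap B ι n y)
  | 0, k, y, _ => fun x hx => absurd rfl hx
  | n+1, k, y, hy => by
    refine Gr.of_PQ ?_ ?_
    · rw [P_kap]; exact hy.Q.sub (Gr.kap hy.P)
    · rw [Q_kap]; exact Gr.kap hy.Q
lemma Gr.M {y : V B ι n} (a : ℤ) (m : Matrix ι ι B) (hm : ∀ b b', m b b' ≠ 0 → (deg b : ℤ) + a = deg b')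
    (hy : Gr deg (k + a) y) : Gr deg k (oM n m y) := by
  intro x hx
  obtain ⟨b', -, hb'⟩ := Finset.exists_ne_zero_of_sum_ne_zero hx
  have h1 := hm _ _ (left_ne_zero_of_mul hb')
  have h2 := hy _ (right_ne_zero_of_mul hb')
  simp only at h2
  linarith
lemma Gr.E {y : V B ι (n+1)} {d : Matrix ι ι B} (hd : ∀ b b', d b b' ≠ 0 → deg b' = deg b + 1)
    (hy : Gr deg k y) : Gr deg k (oE n d y) := by
  rw [oE_apply]
  exact hy.Q.add ((hy.P.M 1 d (fun b b' h => by rw [hd b b' h]; simp)).sub hy.P.kap)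
lemma Gr.S {y : V B ι n} {d h : Matrix ι ι B} (hd : ∀ b b', d b b' ≠ 0 → deg b' = deg b + 1)
    (hh : ∀ b b', h b b' ≠ 0 → deg b = deg b' + 1)
    (hy : Gr deg k y) : Gr deg k (oS n d h y) := by
  have h' : ∀ b b', h b b' ≠ 0 → (deg b : ℤ) + (-1) = deg b' := fun b b' hb => by
    rw [hh b b' hb]; simp
  refine Gr.of_PQ ?_ ?_
  · rw [P_S]
    exact Gr.M (-1) h h' (by simpa using hy)
  · rw [Q_S]
    refine Gr.M (-1) h h' (Gr.add ?_ ?_)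
    · exact Gr.M 1 d (fun b b' h => by rw [hd b b' h]; simp) (by simpa using hy)
    · exact Gr.kap (by simpa using hy)

lemma QS_zero {y : V B ι 0} {d h : Matrix ι ι B} (hd : ∀ b b', d b b' ≠ 0 → deg b' = deg b + 1)
    (hy : Gr deg 0 y) : oQ B ι 0 (oS 0 d h y) = 0 := by
  have h1 : oM 0 d y = 0 := by
    funext x
    by_contra hx
    have := (Gr.M (deg := deg) (k := -1) 1 d (fun b b' h => by rw [hd b b' h]; simp) (by simpa using hy)) x hx
    simp [cd] at this
  rw [Q_S, h1, kap]
  simp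

lemma E_univ {d : Matrix ι ι B} [DecidableEq ι] (b b' : ι) :
    oE n d (Pi.single (fun _ => true, b') 1) (fun _ => true, b) = d b b' := by
  have hP : oP B ι n (Pi.single ((fun _ => true, b') : X ι (n+1)) (1 : B))
      = Pi.single ((fun _ => true, b') : X ι n) 1 := by
    funext x
    obtain ⟨A, c⟩ := x
    change (Pi.single ((fun _ => true, b') : X ι (n+1)) (1 : B) : V B ι (n+1)) (oc true (A, c)) = _
    rw [Pi.single_apply, Pi.single_apply]
    have : (oc true (A, c) = ((fun _ => true, b') : X ι (n+1))) ↔ (A, c) = ((fun _ => true, b') : X ι n) := by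
      simp only [oc, Prod.mk.injEq]
      refine and_congr_left fun _ => ?_
      constructor
      · intro h; funext i; simpa using congrFun h i.succ
      · rintro rfl; funext i; refine Fin.cases ?_ (fun i => ?_) i <;> simp
    simp only [this]
  have hQ : oQ B ι n (Pi.single ((fun _ => true, b') : X ι (n+1)) (1 : B)) = 0 := by
    funext x
    obtain ⟨A, c⟩ := x
    change (Pi.single ((fun _ => true, b') : X ι (n+1)) (1 : B) : V B ι (n+1)) (oc false (A, c)) = _
    rw [Pi.single_apply, if_neg]; · rfl
    intro h
    have := congrFun (congrArg Prod.fst h) 0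
    simp [oc] at this
  have hk : kap B ι n (Pi.single ((fun _ => true, b') : X ι n) 1) (fun _ => true, b) = 0 := by
    by_contra hx
    have hg : Gr (n := n) (fun _ : ι => n) ((-1 : ℤ) + 1) (Pi.single ((fun _ => true, b') : X ι n) (1 : B)) := by
      intro x hx
      rw [Pi.single_apply] at hx
      have : x = ((fun _ => true, b') : X ι n) := by by_contra h; exact hx (if_neg h)
      subst this; simp [cd]
    have := hg.kap _ hx
    simp [cd] at this
  rw [oE_apply, hP, hQ]
  simp only [Pi.add_apply, Pi.sub_apply, hk, Pi.zero_apply, sub_zero, zero_add]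
  simp only [oM, LinearMap.coe_mk, AddHom.coe_mk, Pi.single_apply]
  simp

end ops
end TPow
end NIT

-- Part 14

namespace NIT
namespace TPow

section tens
variable {B : Type} [CommRing B] {Z : Type} [Fintype Z] [DecidableEq Z]
  {X X' X'' : Type} [Fintype X] [DecidableEq X] [Fintype X'] [DecidableEq X'] [Fintype X''] [DecidableEq X'']

lemma lin_expand (L : (X → B) →ₗ[B] (X' → B)) (y : X → B) (x' : X') :
    L y x' = ∑ x, L (Pi.single x 1) x' * y x := by
  conv_lhs => rw [pi_eq_sum_univ' y, map_sum, Finset.sum_apply]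
  refine Finset.sum_congr rfl fun x _ => ?_
  rw [map_smul, Pi.smul_apply, smul_eq_mul, mul_comm]

variable (Z) in
/-- tensor power of a linear map, acting on functions of words -/
def T (L : (X → B) →ₗ[B] (X' → B)) : ((Z → X) → B) →ₗ[B] ((Z → X') → B) where
  toFun f := fun w => ∑ w' : Z → X, (∏ k, L (Pi.single (w' k) 1) (w k)) * f w'
  map_add' f g := by ext w; simp [mul_add, Finset.sum_add_distrib]
  map_smul' c f := by
    ext w; simp only [Pi.smul_apply, smul_eq_mul, RingHom.id_apply, Finset.mul_sum]
    exact Finset.sum_congr rfl fun _ _ => by ring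

lemma T_apply (L : (X → B) →ₗ[B] (X' → B)) (f : (Z → X) → B) (w : Z → X') :
    T Z L f w = ∑ w' : Z → X, (∏ k, L (Pi.single (w' k) 1) (w k)) * f w' := rfl

lemma T_comp (L : (X' → B) →ₗ[B] (X'' → B)) (L' : (X → B) →ₗ[B] (X' → B)) (f : (Z → X) → B) :
    T Z (L ∘ₗ L') f = T Z L (T Z L' f) := by
  ext w
  simp only [T_apply, Finset.mul_sum]
  rw [Finset.sum_comm]
  refine Finset.sum_congr rfl fun w' _ => ?_
  have : ∀ k, (L ∘ₗ L') (Pi.single (w' k) 1) (w k)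
      = ∑ x, L (Pi.single x 1) (w k) * L' (Pi.single (w' k) 1) x := fun k => by
    rw [LinearMap.comp_apply, lin_expand L]
  simp only [this]
  rw [Finset.prod_univ_sum, Finset.sum_mul]
  simp only [Fintype.piFinset_univ, Finset.prod_mul_distrib, mul_assoc]

lemma T_smul_one (c : B) (f : (Z → X) → B) :
    T Z (c • (LinearMap.id : (X → B) →ₗ[B] (X → B))) f = c ^ Fintype.card Z • f := by
  ext w
  rw [T_apply, Finset.sum_eq_single w]
  · simp
  · intro w' _ hw
    obtain ⟨k, hk⟩ := Function.ne_iff.1 hw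
    rw [Finset.prod_eq_zero (Finset.mem_univ k), zero_mul]
    simp [Pi.single_apply, Ne.symm hk]
  · simp

lemma T_funLeft (φ : X' → X) (f : (Z → X) → B) (w : Z → X') :
    T Z (LinearMap.funLeft B B φ) f w = f (φ ∘ w) := by
  rw [T_apply, Finset.sum_eq_single (φ ∘ w)]
  · simp [LinearMap.funLeft_apply]
  · intro w' _ hw
    obtain ⟨k, hk⟩ := Function.ne_iff.1 hw
    rw [Finset.prod_eq_zero (Finset.mem_univ k), zero_mul]
    rw [LinearMap.funLeft_apply, Pi.single_apply, if_neg]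
    exact Ne.symm hk
  · simp

lemma T_perm (L : (X → B) →ₗ[B] (X' → B)) (e : Z ≃ Z) (f : (Z → X) → B) (w : Z → X') :
    T Z L (fun v => f (v ∘ e)) w = T Z L f (w ∘ e) := by
  rw [T_apply, T_apply]
  refine Fintype.sum_equiv (Equiv.arrowCongr e.symm (Equiv.refl X)) _ _ fun w' => ?_
  have : (Equiv.arrowCongr e.symm (Equiv.refl X)) w' = w' ∘ e := by ext; simp
  rw [this]
  congr 1
  exact (Fintype.prod_equiv e _ _ fun k => rfl).symm

lemma T_supp (L : (X → B) →ₗ[B] (X' → B)) (C : X → Prop) (C' : X' → Prop)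
    (hL : ∀ x, C x → ∀ x', L (Pi.single x 1) x' ≠ 0 → C' x') (f : (Z → X) → B)
    (hf : ∀ w, f w ≠ 0 → ∀ k, C (w k)) (w : Z → X') (hw : T Z L f w ≠ 0) (k : Z) : C' (w k) := by
  rw [T_apply] at hw
  obtain ⟨w', -, hw'⟩ := Finset.exists_ne_zero_of_sum_ne_zero hw
  refine hL _ (hf w' (right_ne_zero_of_mul hw') k) _ ?_
  intro h0
  exact left_ne_zero_of_mul hw' (Finset.prod_eq_zero (Finset.mem_univ k) h0)

lemma T_zero [Nonempty Z] (L : (X → B) →ₗ[B] (X' → B)) (C : X → Prop)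
    (hL : ∀ x, C x → L (Pi.single x 1) = 0) (f : (Z → X) → B)
    (hf : ∀ w, f w ≠ 0 → ∀ k, C (w k)) : T Z L f = 0 := by
  ext w
  by_contra hw
  have k : Z := Classical.arbitrary Z
  refine T_supp L C (fun _ => False) (fun x hx x' h => ?_) f hf w hw k
  rw [hL x hx] at h
  exact h rfl

end tens

section cyc
variable {Ω : Type} (σ : Equiv.Perm Ω) (p e : ℕ) [hp : Fact p.Prime]

lemma exists_lam (hσ : σ ^ (p ^ e) = 1) : ∃ l : Ω → ZMod p, ∀ ω, σ ω ≠ ω → l (σ ω) = l ω + 1 := by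
  classical
  have hrep : ∀ ω : Ω, ∃ k : ℕ, (σ ^ k) (Quotient.mk (Equiv.Perm.SameCycle.setoid σ) ω).out = ω := by
    intro ω
    have h : σ.SameCycle (Quotient.mk (Equiv.Perm.SameCycle.setoid σ) ω).out ω :=
      Quotient.mk_out (s := Equiv.Perm.SameCycle.setoid σ) ω
    obtain ⟨i, hi⟩ := h
    have hq : 0 < p ^ e := pow_pos hp.out.pos _
    refine ⟨(i % (p^e : ℕ)).toNat, ?_⟩
    have h1 : σ ^ ((i % (p^e : ℕ)).toNat) = σ ^ i := by
      rw [← zpow_natCast, Int.toNat_of_nonneg (Int.emod_nonneg _ (by exact_mod_cast hq.ne'))]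
      conv_rhs => rw [← Int.emod_add_mul_ediv i (p^e : ℕ), zpow_add, zpow_mul, zpow_natCast, hσ, one_zpow, mul_one]
    rw [h1, hi]
  choose k hk using hrep
  refine ⟨fun ω => (k ω : ZMod p), fun ω hω => ?_⟩
  have hq : (Quotient.mk (Equiv.Perm.SameCycle.setoid σ) (σ ω)) = Quotient.mk (Equiv.Perm.SameCycle.setoid σ) ω := by
    refine Quotient.sound (?_ : σ.SameCycle _ _)
    exact (Equiv.Perm.SameCycle.refl σ ω).apply_left
  set r := (Quotient.mk (Equiv.Perm.SameCycle.setoid σ) ω).out with hr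
  have h1 : (σ ^ (k (σ ω))) r = (σ ^ (k ω + 1)) r := by
    have := hk (σ ω)
    rw [hq] at this
    rw [this, pow_succ', Equiv.Perm.mul_apply, hk ω]
  have h2 : Function.minimalPeriod σ r ∣ p ^ e := by
    refine Function.IsPeriodicPt.minimalPeriod_dvd ?_
    change σ^[p^e] r = r
    rw [← Equiv.Perm.coe_pow, hσ]; rfl
  have h3 : p ∣ Function.minimalPeriod σ r := by
    obtain ⟨j, -, hj⟩ := (Nat.dvd_prime_pow hp.out).1 h2
    cases j with
    | zero =>
      exfalso
      rw [pow_zero, Function.minimalPeriod_eq_one_iff_isFixedPt] at hj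
      have hj : σ r = r := hj
      apply hω
      have : ∀ m : ℕ, (σ ^ m) r = r := fun m => by
        induction m with
        | zero => rfl
        | succ m ih => rw [pow_succ, Equiv.Perm.mul_apply, hj, ih]
      rw [← hk ω, this, hj]
    | succ j => rw [hj, pow_succ]; exact dvd_mul_left _ _
  have h4 : (k (σ ω)) ≡ (k ω + 1) [MOD Function.minimalPeriod σ r] := by
    have hpos : 0 < Function.minimalPeriod σ r := Nat.pos_of_dvd_of_pos h2 (pow_pos hp.out.pos _)
    refine (Function.iterate_eq_iterate_iff_of_lt_minimalPeriod (Nat.mod_lt _ hpos) (Nat.mod_lt _ hpos)).1 ?_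
    rw [Function.iterate_mod_minimalPeriod_eq, Function.iterate_mod_minimalPeriod_eq,
      ← Equiv.Perm.coe_pow, ← Equiv.Perm.coe_pow]
    exact h1
  have h5 := h4.of_dvd h3
  have := (ZMod.natCast_eq_natCast_iff _ _ p).2 h5
  push_cast at this
  exact this

variable {B : Type} [CommRing B]

lemma lam_iter {l : Ω → ZMod p} (hl : ∀ ω, σ ω ≠ ω → l (σ ω) = l ω + 1) (i : ℕ) (ω : Ω) (hω : σ ω ≠ ω) :
    l ((σ ^ i) ω) = l ω + i ∧ σ ((σ ^ i) ω) ≠ (σ ^ i) ω := by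
  induction i with
  | zero => simpa using hω
  | succ i ih =>
    rw [pow_succ', Equiv.Perm.mul_apply]
    refine ⟨by rw [hl _ ih.2, ih.1]; push_cast; ring, fun h => ih.2 (σ.injective h)⟩

lemma cyc_a (hσ : σ ^ (p ^ e) = 1) (hpB : ∀ b : B, (p : B) * b = 0 → b = 0)
    (f : Ω → B) (hf : ∀ ω, f ((σ ^ p) ω) = f ω) (htr : ∀ ω, ∑ i ∈ Finset.range p, f ((σ ^ i) ω) = 0) :
    ∃ g : Ω → B, (∀ ω, g ((σ ^ p) ω) = g ω) ∧ (∀ ω, g (σ ω) - g ω = f ω) ∧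
      (∀ ω, g ω ≠ 0 → ∃ i : ℕ, f ((σ ^ i) ω) ≠ 0) := by
  classical
  obtain ⟨l, hl⟩ := exists_lam σ p e hσ
  refine ⟨fun ω => if σ ω = ω then 0 else -∑ i ∈ Finset.range (p - (l ω).val), f ((σ ^ i) ω), ?_, ?_, ?_⟩
  · intro ω
    by_cases hω : σ ω = ω
    · have : σ ((σ ^ p) ω) = (σ ^ p) ω := by
        rw [← Equiv.Perm.mul_apply, ← pow_succ', pow_succ, Equiv.Perm.mul_apply, hω]
      simp only [if_pos hω, if_pos this]
    · obtain ⟨h1, h2⟩ := lam_iter σ p hl p ω hω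
      simp only [if_neg hω, if_neg h2]
      rw [h1]
      simp only [CharP.cast_eq_zero, add_zero, neg_inj]
      refine Finset.sum_congr rfl fun i _ => ?_
      rw [← Equiv.Perm.mul_apply, ← pow_add, add_comm, pow_add, Equiv.Perm.mul_apply, hf]
  · intro ω
    by_cases hω : σ ω = ω
    · simp only [hω, sub_self]
      symm
      apply hpB
      have h1 : ∀ m : ℕ, (σ ^ m) ω = ω := fun m => by
        induction m with
        | zero => rfl
        | succ m ih => rw [pow_succ, Equiv.Perm.mul_apply, hω, ih]
      have := htr ω
      simp only [h1] at this
      simpa using this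
    · have h2 : σ (σ ω) ≠ σ ω := fun h => hω (σ.injective h)
      simp only [if_neg hω, if_neg h2]
      have h3 := hl ω hω
      have hpos := hp.out.pos
      haveI : NeZero p := ⟨hpos.ne'⟩
      have hlt := ZMod.val_lt (l ω)
      have hs : ∀ i, f ((σ ^ i) (σ ω)) = f ((σ ^ (i+1)) ω) := fun i => by
        rw [pow_succ, Equiv.Perm.mul_apply]
      by_cases hv : (l ω).val + 1 = p
      · have h4 : l (σ ω) = 0 := by
          rw [h3, ← ZMod.natCast_zmod_val (l ω)]
          exact_mod_cast (by rw [hv]; simp : (((l ω).val + 1 : ℕ) : ZMod p) = 0)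
        rw [h4, ZMod.val_zero, Nat.sub_zero, htr, neg_zero]
        have : p - (l ω).val = 1 := by omega
        rw [this]; simp
      · have h4 : (l (σ ω)).val = (l ω).val + 1 := by
          rw [h3, ← ZMod.natCast_zmod_val (l ω)]
          have : (((l ω).val : ZMod p) + 1) = (((l ω).val + 1 : ℕ) : ZMod p) := by push_cast; rfl
          rw [this, ZMod.val_natCast, ZMod.val_natCast, Nat.mod_eq_of_lt hlt, Nat.mod_eq_of_lt (by omega)]
        rw [h4]
        have : p - (l ω).val = (p - ((l ω).val + 1)) + 1 := by omega
        rw [this, Finset.sum_range_succ']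
        simp only [hs, pow_zero, Equiv.Perm.one_apply]
        ring
  · intro ω hω
    by_contra! hcon
    apply hω
    by_cases h : σ ω = ω
    · simp [h]
    · simp only [if_neg h]
      rw [Finset.sum_eq_zero fun i _ => hcon i, neg_zero]

lemma cyc_b (hσ : σ ^ (p ^ e) = 1) (f : Ω → B) (hf : ∀ ω, f (σ ω) = f ω)
    (hfix : ∀ ω, σ ω = ω → ∃ b, f ω = p * b) :
    ∃ u : Ω → B, (∀ ω, u ((σ ^ p) ω) = u ω) ∧ (∀ ω, ∑ i ∈ Finset.range p, u ((σ ^ i) ω) = f ω) ∧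
      (∀ ω, u ω ≠ 0 → f ω ≠ 0) := by
  classical
  obtain ⟨l, hl⟩ := exists_lam σ p e hσ
  have hfix' : ∀ ω, ∃ b, σ ω = ω → (f ω = p * b ∧ (b ≠ 0 → f ω ≠ 0)) := by
    intro ω
    by_cases h : σ ω = ω
    · by_cases h0 : f ω = 0
      · exact ⟨0, fun _ => ⟨by simp [h0], by simp⟩⟩
      · obtain ⟨b, hb⟩ := hfix ω h
        exact ⟨b, fun _ => ⟨hb, fun _ => h0⟩⟩
    · exact ⟨0, fun h' => absurd h' h⟩
  choose b hb using hfix'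
  have hfi : ∀ (i : ℕ) ω, f ((σ ^ i) ω) = f ω := fun i => by
    induction i with
    | zero => intro ω; rfl
    | succ i ih => intro ω; rw [pow_succ, Equiv.Perm.mul_apply, ih, hf]
  have hfixi : ∀ ω, σ ω = ω → ∀ m : ℕ, (σ ^ m) ω = ω := fun ω hω m => by
    induction m with
    | zero => rfl
    | succ m ih => rw [pow_succ, Equiv.Perm.mul_apply, hω, ih]
  refine ⟨fun ω => if σ ω = ω then b ω else if l ω = 0 then f ω else 0, ?_, ?_, ?_⟩
  · intro ω
    by_cases hω : σ ω = ω
    · simp only [hfixi ω hω]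
    · obtain ⟨h1, h2⟩ := lam_iter σ p hl p ω hω
      simp only [if_neg hω, if_neg h2]
      rw [h1, hfi]; simp
  · intro ω
    by_cases hω : σ ω = ω
    · simp only [hfixi ω hω, if_pos hω]
      simp [(hb ω hω).1]
    · have : ∀ i : ℕ, (if σ ((σ ^ i) ω) = (σ ^ i) ω then b ((σ ^ i) ω) else if l ((σ ^ i) ω) = 0 then f ((σ ^ i) ω) else 0)
          = if l ω + i = 0 then f ω else 0 := fun i => by
        obtain ⟨h1, h2⟩ := lam_iter σ p hl i ω hω
        rw [if_neg h2, h1, hfi]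
      simp only [this]
      haveI : NeZero p := ⟨hp.out.pos.ne'⟩
      rw [Finset.sum_eq_single ((-l ω).val)]
      · rw [if_pos]; simp
      · intro i hi hne
        rw [if_neg]
        intro h
        apply hne
        have : (i : ZMod p) = - l ω := by linear_combination h
        rw [← this, ZMod.val_natCast, Nat.mod_eq_of_lt (Finset.mem_range.1 hi)]
      · intro h
        exact absurd (Finset.mem_range.2 (ZMod.val_lt _)) h
  · intro ω
    by_cases hω : σ ω = ω
    · simp only [if_pos hω]; exact (hb ω hω).2
    · simp only [if_neg hω]
      by_cases h : l ω = 0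
      · simp [h]
      · simp [h]

lemma sum_cyc [Fintype Ω] [DecidableEq Ω] (hσ : σ ^ (p ^ e) = 1) (f : Ω → B) (hf : ∀ ω, f (σ ω) = f ω) :
    ∃ c : B, ∑ ω, f ω = p * c + ∑ ω with σ ω = ω, f ω := by
  obtain ⟨u, h1, h2, -⟩ := cyc_b σ p e hσ (fun ω => if σ ω = ω then 0 else f ω)
    (fun ω => by simp only [hf, EmbeddingLike.apply_eq_iff_eq]) (fun ω h => ⟨0, by simp [h]⟩)
  refine ⟨∑ ω, u ω, ?_⟩
  have h3 : ∑ ω, f ω = ∑ ω, (if σ ω = ω then 0 else f ω) + ∑ ω with σ ω = ω, f ω := by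
    rw [Finset.sum_filter, ← Finset.sum_add_distrib]
    refine Finset.sum_congr rfl fun ω _ => ?_
    by_cases h : σ ω = ω <;> simp [h]
  rw [h3]
  congr 1
  rw [← Finset.sum_congr rfl fun ω _ => h2 ω, Finset.sum_comm]
  have : ∀ i : ℕ, ∑ ω, u ((σ ^ i) ω) = ∑ ω, u ω := fun i => Equiv.sum_comp (σ ^ i) u
  simp [this]

end cyc
end TPow
end NIT

-- Part 15

namespace NIT
namespace TPow
open IsLocalRing

lemma length_ne_top_of_killed {B : Type} [CommRing B] [IsLocalRing B] [IsNoetherianRing B]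
    (N : Type) [AddCommGroup N] [Module B N] [Module.Finite B N]
    (h : ∀ x ∈ maximalIdeal B, ∃ k : ℕ, ∀ z : N, x ^ k • z = 0) : Module.length B N ≠ ⊤ := by
  rename_i hfin
  induction hfin using IsNoetherianRing.induction_on_isQuotientEquivQuotientPrime B with
  | subsingleton N => rw [Module.length_eq_zero]; simp
  | exact N₁ N₂ N₃ f g hf hg hfg ih₁ ih₃ =>
    rw [Module.length_eq_add_of_exact f g hf hg hfg]
    refine WithTop.add_ne_top.2 ⟨ih₁ fun x hx => ?_, ih₃ fun x hx => ?_⟩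
    · obtain ⟨k, hk⟩ := h x hx
      exact ⟨k, fun z => hf (by rw [map_smul, hk, map_zero])⟩
    · obtain ⟨k, hk⟩ := h x hx
      refine ⟨k, fun z => ?_⟩
      obtain ⟨y, rfl⟩ := hg z
      rw [← map_smul, hk, map_zero]
  | quotient N P eq =>
    have hP : P.1 = maximalIdeal B := by
      refine le_antisymm (le_maximalIdeal P.2.ne_top) fun x hx => ?_
      obtain ⟨k, hk⟩ := h x hx
      have h1 := hk (eq.symm (Ideal.Quotient.mk P.1 1))
      rw [← map_smul, LinearEquiv.map_eq_zero_iff] at h1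
      have h2 : Ideal.Quotient.mk P.1 (x ^ k) = 0 := by
        rw [← h1, Algebra.smul_def, map_one, mul_one]; rfl
      exact P.2.mem_of_pow_mem k (Ideal.Quotient.eq_zero_iff_mem.1 h2)
    have : Module.length B N = 1 := by
      rw [eq.length_eq, Module.length_eq_one_iff, isSimpleModule_iff_isCoatom]
      rw [hP]; exact (IsLocalRing.maximalIdeal.isMaximal B).out
    rw [this]; simp

lemma chl_ne_top {B : Type} [CommRing B] [IsLocalRing B] [IsNoetherianRing B]
    {M : Type} [AddCommGroup M] [Module B M] (D : M →ₗ[B] M) (U : ℕ → Submodule B M) (j : ℕ)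
    (hN : IsNoetherian B (U j))
    (h : ∀ x ∈ maximalIdeal B, ∃ k : ℕ, ∀ z ∈ U j, D z = 0 → ∃ u ∈ U (j+1), D u = x ^ k • z) :
    chl D U j ≠ ⊤ := by
  have hN' : IsNoetherian B (U j ⊓ LinearMap.ker D : Submodule B M) :=
    isNoetherian_of_le inf_le_left
  refine length_ne_top_of_killed _ fun x hx => ?_
  obtain ⟨k, hk⟩ := h x hx
  refine ⟨k, fun z => ?_⟩
  induction z using Submodule.Quotient.induction_on with
  | _ z =>
  rw [← Submodule.Quotient.mk_smul, Submodule.Quotient.mk_eq_zero]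
  exact hk z.1 z.2.1 z.2.2

lemma rl_restrict {B R : Type} [CommRing B] [CommRing R] [Algebra B R]
    (hs : Function.Surjective (algebraMap B R)) {M : Type} [AddCommGroup M] [Module B M] [Module R M]
    [IsScalarTower B R M] (Q Z : Submodule R M) (Q' Z' : Submodule B M)
    (hQ : ∀ z, z ∈ Q ↔ z ∈ Q') (hZ : ∀ z, z ∈ Z ↔ z ∈ Z') :
    Module.length R (Z ⧸ Q.submoduleOf Z) = rl Q' Z' := by
  obtain rfl : Q' = Q.restrictScalars B := by ext z; exact (hQ z).symm
  obtain rfl : Z' = Z.restrictScalars B := by ext z; exact (hZ z).symm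
  rw [← Module.length_eq_of_surjective hs]
  exact (Submodule.Quotient.restrictScalarsEquiv B (Q.submoduleOf Z)).length_eq.symm

section main
variable {B : Type} [CommRing B] (F : FC B) (q : ℕ) [NeZero q]

/-- words -/
abbrev Wd (n : ℕ) : Type := ZMod q → X F.ι n
/-- cyclic shift of words -/
def sh (n : ℕ) : Equiv.Perm (Wd F q n) where
  toFun w := fun k => w (k + 1)
  invFun w := fun k => w (k - 1)
  left_inv w := by ext k <;> simp
  right_inv w := by ext k <;> simp

lemma sh_pow (n m : ℕ) (w : Wd F q n) : ((sh F q n) ^ m) w = fun k => w (k + m) := by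
  induction m generalizing w with
  | zero => simp
  | succ m ih =>
    rw [pow_succ, Equiv.Perm.mul_apply, ih]
    funext k
    change w (k + m + 1) = _
    push_cast; rw [add_assoc]

lemma sh_pow_q (n : ℕ) : (sh F q n) ^ q = 1 := by
  ext1 w
  rw [sh_pow]
  simp

/-- ambient module -/
abbrev Am : Type := ∀ n, Wd F q n → B

noncomputable def DD : Am F q →ₗ[B] Am F q :=
  LinearMap.pi fun n => (T (ZMod q) (oE n F.d)) ∘ₗ LinearMap.proj (n+1)

def sg : Am F q →ₗ[B] Am F q :=
  LinearMap.pi fun n => (LinearMap.funLeft B B (sh F q n)) ∘ₗ LinearMap.proj n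

variable {q}
lemma DD_apply (f : Am F q) (n : ℕ) : DD F q f n = T (ZMod q) (oE n F.d) (f (n+1)) := rfl
lemma sg_apply (f : Am F q) (n : ℕ) (w : Wd F q n) : sg F q f n w = f n (sh F q n w) := rfl
lemma sg_pow_apply (m : ℕ) (f : Am F q) (n : ℕ) (w : Wd F q n) :
    (sg F q ^ m) f n w = f n ((sh F q n ^ m) w) := by
  induction m generalizing f with
  | zero => rfl
  | succ m ih =>
    rw [pow_succ, Module.End.mul_apply, ih, sg_apply, pow_succ', Equiv.Perm.mul_apply]

lemma T_sh {n n' : ℕ} (L : V B F.ι n →ₗ[B] V B F.ι n') (f : Wd F q n → B) (w : Wd F q n') :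
    T (ZMod q) L (fun v => f (sh F q n v)) w = T (ZMod q) L f (sh F q n' w) :=
  T_perm L (Equiv.addRight (1 : ZMod q)) f w

lemma DD_sg (f : Am F q) : DD F q (sg F q f) = sg F q (DD F q f) := by
  funext n w
  exact T_sh F _ (f (n+1)) w

lemma DD_sg_pow (m : ℕ) (f : Am F q) : DD F q ((sg F q ^ m) f) = (sg F q ^ m) (DD F q f) := by
  induction m generalizing f with
  | zero => rfl
  | succ m ih => rw [pow_succ, Module.End.mul_apply, ih, DD_sg]; rfl

/-- good words -/
def good {n : ℕ} (w : Wd F q n) : Prop :=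
  (∀ k, cd (w k).1 + 0 = F.deg (w k).2) ∧ ∀ i : Fin n, ∃ k, (w k).1 i = true

lemma good_sh {n : ℕ} (w : Wd F q n) : good F (sh F q n w) ↔ good F w := by
  constructor
  · rintro ⟨h1, h2⟩
    refine ⟨fun k => ?_, fun i => ?_⟩
    · have := h1 (k - 1)
      simpa [sh] using this
    · obtain ⟨k, hk⟩ := h2 i
      exact ⟨_, hk⟩
  · rintro ⟨h1, h2⟩
    refine ⟨fun k => h1 _, fun i => ?_⟩
    obtain ⟨k, hk⟩ := h2 i
    exact ⟨k - 1, by simpa [sh] using hk⟩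

lemma good_sh_pow {n : ℕ} (m : ℕ) (w : Wd F q n) : good F ((sh F q n ^ m) w) ↔ good F w := by
  induction m generalizing w with
  | zero => rfl
  | succ m ih => rw [pow_succ, Equiv.Perm.mul_apply, ih, good_sh]

variable (q)
def NN (j : ℕ) : Submodule B (Am F q) where
  carrier := {f | ∀ n w, f n w ≠ 0 → n = j ∧ good F w}
  add_mem' {f g} hf hg n w h := by
    by_cases h' : f n w = 0
    · exact hg n w (fun h0 => h (by simp [h', h0]))
    · exact hf n w h'
  zero_mem' n w h := absurd rfl h
  smul_mem' c f hf n w h := hf n w (fun h0 => h (by simp [h0]))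
variable {q}

/-- good functions of one level -/
def gd {n : ℕ} (f : Wd F q n → B) : Prop := ∀ w, f w ≠ 0 → good F w

lemma gd_of (n : ℕ) (f : Wd F q (n+1) → B) (h1 : ∀ w, f w ≠ 0 → ∀ k, cd (w k).1 + 0 = F.deg (w k).2)
    (h2 : ∀ i, T (ZMod q) (oR B F.ι n i) f = 0) : gd F f := by
  intro w hw
  refine ⟨h1 w hw, fun i => ?_⟩
  by_contra! hcon
  apply hw
  have := congrFun (h2 i) (fun k => (i.removeNth (w k).1, (w k).2))
  rw [oR, T_funLeft] at this
  rw [← show _ = (0:B) from this]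
  congr 1
  funext k
  have h3 := hcon k
  simp only [Bool.not_eq_true] at h3
  simp only [ins, Function.comp_apply]
  rw [← h3, Fin.insertNth_self_removeNth]

lemma gd.R {n : ℕ} {f : Wd F q (n+1) → B} (hf : gd F f) (i : Fin (n+1)) :
    T (ZMod q) (oR B F.ι n i) f = 0 := by
  funext w
  rw [oR, T_funLeft]
  by_contra h
  obtain ⟨k, hk⟩ := (hf _ h).2 i
  simp [ins] at hk

lemma gr_single {n : ℕ} (x : X F.ι n) (hx : cd x.1 + 0 = F.deg x.2) :
    Gr F.deg 0 (Pi.single x 1 : V B F.ι n) := by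
  intro x' hx'
  rw [Pi.single_apply] at hx'
  have : x' = x := by by_contra h; exact hx' (if_neg h)
  rw [this]; exact hx

lemma gd.E_deg {n : ℕ} {f : Wd F q (n+1) → B} (hf : gd F f) (w) (hw : T (ZMod q) (oE n F.d) f w ≠ 0) (k) :
    cd (w k).1 + 0 = F.deg (w k).2 :=
  T_supp (oE n F.d) (fun x => cd x.1 + 0 = F.deg x.2) (fun x => cd x.1 + 0 = F.deg x.2)
    (fun x hx x' h => (gr_single F x hx).E F.d_deg x' h) f (fun w hw => (hf w hw).1) w hw k

lemma gd.E {n : ℕ} {f : Wd F q (n+1) → B} (hf : gd F f) : gd F (T (ZMod q) (oE n F.d) f) := by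
  cases n with
  | zero => exact fun w hw => ⟨hf.E_deg F w hw, fun i => i.elim0⟩
  | succ n =>
    refine gd_of F n _ (hf.E_deg F) fun i => ?_
    rw [← T_comp]
    have : oR B F.ι n i ∘ₗ oE (n+1) F.d = oE n F.d ∘ₗ oR B F.ι (n+1) i.succ := by
      refine LinearMap.ext fun y => ?_; exact R_E n i F.d y
    rw [this, T_comp, hf.R, map_zero]

lemma gd.EE {n : ℕ} {f : Wd F q (n+2) → B} (hf : gd F f) :
    T (ZMod q) (oE n F.d) (T (ZMod q) (oE (n+1) F.d) f) = 0 := by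
  rw [← T_comp]
  have : oE n F.d ∘ₗ oE (n+1) F.d = oE n F.d ∘ₗ oR B F.ι (n+1) 0 := by
    refine LinearMap.ext fun y => ?_; rw [R_zero]; exact E_E n F.d F.d_sq y
  rw [this, T_comp, hf.R, map_zero]

lemma gd.S {n : ℕ} {f : Wd F q n → B} (hf : gd F f) {h : Matrix F.ι F.ι B}
    (hh : ∀ i j, h i j ≠ 0 → F.deg i = F.deg j + 1)
    (hcyc : ∀ m (e : m + 1 = n), T (ZMod q) (oE m F.d) (e ▸ f) = 0) :
    gd F (T (ZMod q) (oS n F.d h) f) := by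
  refine gd_of F n _ ?_ fun i => ?_
  · exact T_supp (oS n F.d h) (fun x => cd x.1 + 0 = F.deg x.2) (fun x => cd x.1 + 0 = F.deg x.2)
      (fun x hx x' h => (gr_single F x hx).S F.d_deg hh x' h) f (fun w hw => (hf w hw).1)
  · cases n with
    | zero =>
      obtain rfl : i = 0 := by ext; omega
      rw [← T_comp]
      refine T_zero _ (fun x => cd x.1 + 0 = F.deg x.2) (fun x hx => ?_) f (fun w hw => (hf w hw).1)
      rw [R_zero]
      exact QS_zero F.d_deg (gr_single F x hx)
    | succ n =>
      rw [← T_comp]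
      refine Fin.cases ?_ (fun i => ?_) i
      · have : oR B F.ι (n+1) 0 ∘ₗ oS (n+1) F.d h = oS n F.d h ∘ₗ oE n F.d := by
          refine LinearMap.ext fun y => ?_; rw [R_zero]; exact Q_S_eq n F.d h F.d_sq y
        rw [this, T_comp]
        have := hcyc n rfl
        simp only at this
        rw [this, map_zero]
      · have : oR B F.ι (n+1) i.succ ∘ₗ oS (n+1) F.d h = oS n F.d h ∘ₗ oR B F.ι n i := by
          refine LinearMap.ext fun y => ?_; exact R_S n i F.d h y
        rw [this, T_comp, hf.R, map_zero]

lemma NN_gd {j : ℕ} {f : Am F q} (hf : f ∈ NN F q j) (n : ℕ) : gd F (f n) := fun w hw => (hf n w hw).2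

lemma DD_NN {j : ℕ} {f : Am F q} (hf : f ∈ NN F q (j+1)) : DD F q f ∈ NN F q j := by
  intro n w hw
  refine ⟨?_, (NN_gd F hf (n+1)).E F w hw⟩
  by_contra h
  apply hw
  have : f (n+1) = 0 := by
    funext w'
    by_contra h'
    exact h (by have := (hf _ w' h').1; omega)
  rw [DD_apply, this, map_zero]; rfl

lemma DD_NN_zero {f : Am F q} (hf : f ∈ NN F q 0) : DD F q f = 0 := by
  funext n
  have : f (n+1) = 0 := by
    funext w'
    by_contra h'
    have := (hf _ w' h').1; omega
  rw [DD_apply, this, map_zero]; rfl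

lemma DD_DD {j : ℕ} {f : Am F q} (hf : f ∈ NN F q j) : DD F q (DD F q f) = 0 := by
  funext n
  exact (NN_gd F hf (n+2)).EE F

variable (q) in
noncomputable def SS (h : Matrix F.ι F.ι B) : Am F q →ₗ[B] Am F q :=
  LinearMap.pi fun n => match n with
    | 0 => 0
    | n+1 => (T (ZMod q) (oS n F.d h)) ∘ₗ LinearMap.proj n

lemma SS_sg (h : Matrix F.ι F.ι B) (f : Am F q) : SS F q h (sg F q f) = sg F q (SS F q h f) := by
  funext n w
  cases n with
  | zero => rfl
  | succ n => exact T_sh F _ (f n) w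

lemma SS_sg_pow (h : Matrix F.ι F.ι B) (m : ℕ) (f : Am F q) :
    SS F q h ((sg F q ^ m) f) = (sg F q ^ m) (SS F q h f) := by
  induction m generalizing f with
  | zero => rfl
  | succ m ih => rw [pow_succ, Module.End.mul_apply, ih, SS_sg]; rfl

lemma SS_NN {h : Matrix F.ι F.ι B}
    (hh : ∀ i j, h i j ≠ 0 → F.deg i = F.deg j + 1) {j : ℕ} {f : Am F q} (hf : f ∈ NN F q j)
    (hD : DD F q f = 0) : SS F q h f ∈ NN F q (j+1) := by
  intro n w hw
  cases n with
  | zero => exact absurd rfl hw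
  | succ n =>
    refine ⟨?_, (NN_gd F hf n).S F hh ?_ w hw⟩
    · by_contra hne
      apply hw
      have : f n = 0 := by
        funext w'
        by_contra h'
        exact hne (by have := (hf _ w' h').1; omega)
      change T (ZMod q) (oS n F.d h) (f n) w = 0
      rw [this, map_zero]; rfl
    · rintro m rfl
      exact congrFun hD m

lemma DD_SS {h : Matrix F.ι F.ι B} {c : B} (hc : F.d * h + h * F.d = c • 1) (f : Am F q) :
    DD F q (SS F q h f) = c ^ q • f := by
  funext n
  change T (ZMod q) (oE n F.d) (T (ZMod q) (oS n F.d h) (f n)) = _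
  rw [← T_comp]
  have : oE n F.d ∘ₗ oS n F.d h = c • LinearMap.id := by
    refine LinearMap.ext fun y => ?_; exact E_S n F.d h c hc y
  rw [this, T_smul_one, ZMod.card]; rfl

lemma NN_bot {s : ℕ} (hs : ∀ i, F.deg i ≤ s) (j : ℕ) (hj : q * s < j) : NN F q j = ⊥ := by
  rw [eq_bot_iff]
  intro f hf
  rw [Submodule.mem_bot]
  funext n w
  by_contra hw
  obtain ⟨rfl, h1, h2⟩ := hf n w hw
  have h3 : ((n : ℕ) : ℤ) ≤ ∑ k, cd (w k).1 := by
    unfold cd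
    rw [Finset.sum_comm]
    calc ((n : ℕ) : ℤ) = ∑ i : Fin n, (1 : ℤ) := by simp
      _ ≤ _ := by
        refine Finset.sum_le_sum fun i _ => ?_
        obtain ⟨k, hk⟩ := h2 i
        refine le_trans ?_ (Finset.single_le_sum (f := fun k => if (w k).1 i = true then (1:ℤ) else 0)
          (fun k _ => by positivity) (Finset.mem_univ k))
        simp [hk]
  have h4 : ∑ k, cd (w k).1 ≤ ∑ k : ZMod q, (s : ℤ) := by
    refine Finset.sum_le_sum fun k _ => ?_
    have := h1 k
    have := hs (w k).2
    omega
  simp [ZMod.card] at h4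
  have : (n : ℤ) ≤ (q * s : ℕ) := by push_cast; linarith
  omega

end main
end TPow
end NIT

-- Part 16

namespace NIT
namespace TPow
open IsLocalRing

section main
variable {B : Type} [CommRing B] (F : FC B) (p e : ℕ) [hp : Fact p.Prime]

noncomputable instance instNZ : NeZero (p ^ e) := ⟨pow_ne_zero _ hp.out.ne_zero⟩


noncomputable def UU (j : ℕ) : Submodule B (Am F (p ^ e)) :=
  NN F (p ^ e) j ⊓ LinearMap.ker (sg F (p ^ e) ^ p - 1)
noncomputable def II (j : ℕ) : Submodule B (Am F (p ^ e)) :=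
  NN F (p ^ e) j ⊓ LinearMap.ker (sg F (p ^ e) - 1)
noncomputable def tr : Am F (p ^ e) →ₗ[B] Am F (p ^ e) := ∑ i ∈ Finset.range p, sg F (p ^ e) ^ i

lemma mem_UU {j : ℕ} {f : Am F (p ^ e)} : f ∈ UU F p e j ↔ f ∈ NN F (p ^ e) j ∧ (sg F (p ^ e) ^ p) f = f := by
  rw [UU, Submodule.mem_inf, LinearMap.mem_ker, LinearMap.sub_apply, sub_eq_zero]; rfl
lemma mem_II {j : ℕ} {f : Am F (p ^ e)} : f ∈ II F p e j ↔ f ∈ NN F (p ^ e) j ∧ sg F (p ^ e) f = f := by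
  rw [II, Submodule.mem_inf, LinearMap.mem_ker, LinearMap.sub_apply, sub_eq_zero]; rfl

lemma tr_apply (f : Am F (p ^ e)) (n : ℕ) (w : Wd F (p ^ e) n) :
    tr F p e f n w = ∑ i ∈ Finset.range p, f n ((sh F (p ^ e) n ^ i) w) := by
  rw [tr, LinearMap.sum_apply, Finset.sum_apply, Finset.sum_apply]
  exact Finset.sum_congr rfl fun i _ => sg_pow_apply F i f n w

lemma DD_tr (f : Am F (p ^ e)) : DD F (p ^ e) (tr F p e f) = tr F p e (DD F (p ^ e) f) := by
  simp only [tr, LinearMap.sum_apply, map_sum, DD_sg_pow]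

lemma sg_NN {j : ℕ} {f : Am F (p ^ e)} (hf : f ∈ NN F (p ^ e) j) (m : ℕ) : (sg F (p ^ e) ^ m) f ∈ NN F (p ^ e) j := by
  intro n w hw
  rw [sg_pow_apply] at hw
  obtain ⟨h1, h2⟩ := hf n _ hw
  exact ⟨h1, (good_sh_pow F m w).1 h2⟩

lemma UU_D (j : ℕ) : ∀ z ∈ UU F p e (j+1), DD F (p ^ e) z ∈ UU F p e j := by
  intro z hz
  rw [mem_UU] at hz ⊢
  exact ⟨DD_NN F hz.1, by rw [← DD_sg_pow, hz.2]⟩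
lemma II_D (j : ℕ) : ∀ z ∈ II F p e (j+1), DD F (p ^ e) z ∈ II F p e j := by
  intro z hz
  rw [mem_II] at hz ⊢
  exact ⟨DD_NN F hz.1, by rw [← DD_sg, hz.2]⟩

lemma NN_noeth [IsNoetherianRing B] (q : ℕ) [NeZero q] (j : ℕ) : IsNoetherian B (NN F q j) := by
  refine isNoetherian_of_injective (LinearMap.proj (R := B) (φ := fun n => Wd F q n → B) j ∘ₗ (NN F q j).subtype) ?_
  intro f g hfg
  ext n w
  by_cases hn : n = j
  · subst hn; exact congrFun hfg w
  · have : ∀ f ∈ NN F q j, f n w = 0 := fun f hf => by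
      by_contra h; exact hn (hf n w h).1
    rw [this f f.2, this g g.2]

lemma sh_fix {q : ℕ} [NeZero q] {n : ℕ} (w : Wd F q n) : sh F q n w = w ↔ w = fun _ => w 0 := by
  constructor
  · intro h
    have h1 : ∀ m : ℕ, (sh F q n ^ m) w = w := fun m => by
      induction m with
      | zero => rfl
      | succ m ih => rw [pow_succ, Equiv.Perm.mul_apply, h, ih]
    funext k
    have := congrFun (h1 k.val) 0
    rw [sh_pow] at this
    simpa using this
  · intro h; rw [h]; rfl

/-- full letter -/
def fl {ι : Type} (n : ℕ) (b : ι) : X ι n := (fun _ => true, b)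

abbrev Rp (B : Type) [CommRing B] (p : ℕ) : Type := B ⧸ Ideal.span {(p : B)}

/-- evaluation at constant words modulo `p` -/
noncomputable def ev : Am F (p ^ e) →ₗ[B] (F.ι → Rp B p) :=
  LinearMap.pi fun b => (Algebra.linearMap B (Rp B p)) ∘ₗ
    (LinearMap.proj (fun _ => fl (F.deg b) b)) ∘ₗ (LinearMap.proj (F.deg b))

lemma ev_apply (f : Am F (p ^ e)) (b : F.ι) :
    ev F p e f b = Ideal.Quotient.mk (Ideal.span {(p : B)}) (f (F.deg b) (fun _ => fl (F.deg b) b)) := rfl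

noncomputable def dq : Matrix F.ι F.ι B := F.d.map (· ^ (p ^ e))

lemma good_const {q : ℕ} [NeZero q] {n : ℕ} (x : X F.ι n) (h : good F (fun _ : ZMod q => x)) :
    x = fl n x.2 ∧ F.deg x.2 = n := by
  have h1 : x.1 = fun _ => true := by
    funext i
    obtain ⟨k, hk⟩ := h.2 i
    exact hk
  refine ⟨Prod.ext h1 rfl, ?_⟩
  have := h.1 0
  simp only [h1] at this
  simp [cd] at this
  exact this.symm

lemma ev_DD (j : ℕ) (z : Am F (p ^ e)) (hz : z ∈ II F p e j) :
    ev F p e (DD F (p ^ e) z) = mact (Rp B p) (dq F p e) (ev F p e z) := by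
  rw [mem_II] at hz
  funext b
  rw [ev_apply, DD_apply, T_apply, mact_apply]
  set n := F.deg b with hn
  have hinv : ∀ w : Wd F (p ^ e) (n+1),
      (∏ k : ZMod (p ^ e), oE n F.d (Pi.single (sh F (p ^ e) (n+1) w k) 1) (fl n b)) * z (n+1) (sh F (p ^ e) (n+1) w)
      = (∏ k : ZMod (p ^ e), oE n F.d (Pi.single (w k) 1) (fl n b)) * z (n+1) w := by
    intro w
    rw [← sg_apply F z (n+1) w, hz.2]
    congr 1
    exact Fintype.prod_equiv (Equiv.addRight (1 : ZMod (p ^ e))) _ _ fun k => rfl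
  obtain ⟨c, hc⟩ := sum_cyc (B := B) (sh F (p ^ e) (n+1)) p e (sh_pow_q F (p ^ e) (n+1))
    (fun w => (∏ k : ZMod (p ^ e), oE n F.d (Pi.single (w k) 1) (fl n b)) * z (n+1) w) hinv
  rw [hc]
  have hsum : ∑ w : Wd F (p ^ e) (n+1) with sh F (p ^ e) (n+1) w = w,
      (∏ k : ZMod (p ^ e), oE n F.d (Pi.single (w k) 1) (fl n b)) * z (n+1) w
      = ∑ b', F.d b b' ^ (p ^ e) * z (n+1) (fun _ => fl (n+1) b') := by
    have hinj : Function.Injective (fun (b' : F.ι) (_ : ZMod (p ^ e)) => fl (n+1) b') := by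
      intro b1 b2 h
      exact congrArg Prod.snd (congrFun h 0)
    have h2 : ∀ b', F.d b b' ^ (p ^ e) = ∏ k : ZMod (p ^ e), oE n F.d (Pi.single (fl (n+1) b') 1) (fl n b) := by
      intro b'
      rw [Finset.prod_const, Finset.card_univ, ZMod.card]
      congr 1
      exact (E_univ b b').symm
    simp only [h2]
    symm
    refine Finset.sum_of_injOn (fun b' _ => fl (n+1) b') hinj.injOn ?_ ?_ ?_
    · intro b' _
      simp [sh_fix]
    · intro w hw hw'
      rw [Finset.mem_filter, sh_fix] at hw
      by_contra h0
      apply hw'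
      have h3 := (hz.1 _ _ (right_ne_zero_of_mul h0)).2
      rw [hw.2] at h3
      obtain ⟨h4, h5⟩ := good_const F _ h3
      refine ⟨(w 0).2, by simp, ?_⟩
      rw [hw.2]
      funext k
      exact h4.symm
    · intro b' _
      rfl
  rw [hsum, map_add, map_mul]
  have hp0 : Ideal.Quotient.mk (Ideal.span {(p : B)}) (p : B) = 0 :=
    Ideal.Quotient.eq_zero_iff_mem.2 (Ideal.mem_span_singleton_self _)
  rw [hp0, zero_mul, zero_add, map_sum]
  refine Finset.sum_congr rfl fun b' _ => ?_
  rw [ev_apply]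
  by_cases hd : F.d b b' = 0
  · have h0 : (0 : B) ^ p ^ e = 0 := zero_pow (pow_ne_zero e hp.out.ne_zero)
    simp [dq, hd, h0]
  · have hdeg := F.d_deg b b' hd
    rw [← hn] at hdeg
    have aux : ∀ m, m = n + 1 → z m (fun _ => fl m b') = z (n+1) (fun _ => fl (n+1) b') := by
      rintro m rfl; rfl
    rw [aux _ hdeg, map_mul, Algebra.smul_def]
    rfl

lemma ev_II (j : ℕ) (v : F.ι → Rp B p) : v ∈ F.supp (Rp B p) j ↔ ∃ z ∈ II F p e j, ev F p e z = v := by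
  classical
  constructor
  · intro hv
    choose l hl using fun b => Ideal.Quotient.mk_surjective (v b)
    refine ⟨fun n w => if n = j ∧ (∃ b, F.deg b = n ∧ w = fun _ => fl n b) then l (w 0).2 else 0, ?_, ?_⟩
    · rw [mem_II]
      refine ⟨?_, ?_⟩
      · intro n w hw
        have h : n = j ∧ (∃ b, F.deg b = n ∧ w = fun _ => fl n b) := by
          by_contra h; exact hw (if_neg h)
        refine ⟨h.1, ?_⟩
        obtain ⟨-, b, hb, rfl⟩ := h
        refine ⟨fun k => ?_, fun i => ⟨0, rfl⟩⟩
        simp [fl, cd, hb]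
      · funext n w
        rw [sg_apply]
        by_cases h : ∃ b, F.deg b = n ∧ w = fun _ => fl n b
        · obtain ⟨b, hb, rfl⟩ := h
          rfl
        · refine (if_neg ?_).trans (if_neg (fun h' => h h'.2)).symm
          rintro ⟨-, b, hb, h2⟩
          apply h
          refine ⟨b, hb, ?_⟩
          have := congrArg (sh F (p ^ e) n).symm h2
          rw [Equiv.symm_apply_apply] at this
          rw [this]; rfl
    · funext b
      rw [ev_apply]
      by_cases hb : F.deg b = j
      · rw [if_pos ⟨hb, b, rfl, rfl⟩]; exact hl b
      · rw [if_neg (fun h => hb h.1), hv b hb, map_zero]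
  · rintro ⟨z, hz, rfl⟩ b hb
    rw [mem_II] at hz
    rw [ev_apply]
    have : z (F.deg b) (fun _ => fl (F.deg b) b) = 0 := by
      by_contra h; exact hb (hz.1 _ _ h).1
    rw [this, map_zero]

lemma tr_II (j : ℕ) (z : Am F (p ^ e)) :
    z ∈ (UU F p e j).map (tr F p e) ↔ z ∈ II F p e j ∧ ev F p e z = 0 := by
  constructor
  · rintro ⟨u, hu, rfl⟩
    rw [SetLike.mem_coe, mem_UU] at hu
    rw [mem_II]
    have hinv : sg F (p ^ e) (tr F p e u) = tr F p e u := by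
      have h1 : sg F (p ^ e) (tr F p e u) = ∑ i ∈ Finset.range p, (sg F (p ^ e) ^ (i+1)) u := by
        simp only [tr, LinearMap.sum_apply, map_sum, pow_succ', Module.End.mul_apply]
      have h2 := Finset.sum_range_succ (fun i => (sg F (p ^ e) ^ i) u) p
      rw [Finset.sum_range_succ', hu.2] at h2
      rw [h1, tr, LinearMap.sum_apply]
      exact add_right_cancel h2
    refine ⟨⟨?_, hinv⟩, ?_⟩
    · rw [tr, LinearMap.sum_apply]
      exact Submodule.sum_mem _ fun i _ => sg_NN F p e hu.1 i
    · funext b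
      rw [ev_apply, tr_apply]
      have : ∀ i : ℕ, (sh F (p ^ e) (F.deg b) ^ i) (fun _ => fl (F.deg b) b) = fun _ => fl (F.deg b) b := by
        intro i; rw [sh_pow]
      simp only [this, Finset.sum_const, Finset.card_range, nsmul_eq_mul]
      exact Ideal.Quotient.eq_zero_iff_mem.2 (Ideal.mul_mem_right _ _ (Ideal.mem_span_singleton_self _))
  · rintro ⟨hz, hev⟩
    rw [mem_II] at hz
    have key : ∀ n, ∃ u : Wd F (p ^ e) n → B, (∀ ω, u ((sh F (p ^ e) n ^ p) ω) = u ω) ∧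
        (∀ ω, ∑ i ∈ Finset.range p, u ((sh F (p ^ e) n ^ i) ω) = z n ω) ∧ (∀ ω, u ω ≠ 0 → z n ω ≠ 0) := by
      intro n
      refine cyc_b (sh F (p ^ e) n) p e (sh_pow_q F (p ^ e) n) (z n) ?_ ?_
      · intro w
        exact congrFun (congrFun hz.2 n) w
      · intro w hw
        by_cases h0 : z n w = 0
        · exact ⟨0, by rw [h0, mul_zero]⟩
        rw [sh_fix] at hw
        rw [hw] at h0 ⊢
        obtain ⟨h1, h2⟩ := good_const F _ (hz.1 _ _ h0).2
        generalize w 0 = x at *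
        rw [h1]
        obtain ⟨A, b⟩ := x
        simp only at h2
        subst h2
        have := congrFun hev b
        rw [ev_apply, Pi.zero_apply, Ideal.Quotient.eq_zero_iff_mem, Ideal.mem_span_singleton'] at this
        obtain ⟨a, ha⟩ := this
        exact ⟨a, by rw [mul_comm, ha]⟩
    choose u h1 h2 h3 using key
    refine ⟨u, ?_, ?_⟩
    · rw [SetLike.mem_coe, mem_UU]
      refine ⟨fun n w hw => hz.1 n w (h3 n w hw), ?_⟩
      funext n w
      rw [sg_pow_apply, h1]
    · funext n w
      rw [tr_apply, h2]

lemma ker_tr (hpB : ∀ b : B, (p : B) * b = 0 → b = 0) (j : ℕ) (z : Am F (p ^ e)) :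
    z ∈ (UU F p e j).map (sg F (p ^ e) - 1) ↔ z ∈ UU F p e j ∧ tr F p e z = 0 := by
  constructor
  · rintro ⟨u, hu, rfl⟩
    rw [SetLike.mem_coe, mem_UU] at hu
    rw [mem_UU]
    have hs : (sg F (p ^ e) - 1) u = sg F (p ^ e) u - u := rfl
    refine ⟨⟨?_, ?_⟩, ?_⟩
    · rw [hs]
      have := sg_NN F p e hu.1 1
      rw [pow_one] at this
      exact sub_mem this hu.1
    · rw [hs, map_sub, hu.2, ← Module.End.mul_apply, ← pow_succ, pow_succ', Module.End.mul_apply, hu.2]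
    · have h1 : tr F p e (sg F (p ^ e) u) = ∑ i ∈ Finset.range p, (sg F (p ^ e) ^ (i+1)) u := by
        simp only [tr, LinearMap.sum_apply, pow_succ, Module.End.mul_apply]
      have h2 := Finset.sum_range_succ (fun i => (sg F (p ^ e) ^ i) u) p
      rw [Finset.sum_range_succ', hu.2] at h2
      rw [hs, map_sub, h1, tr, LinearMap.sum_apply, sub_eq_zero]
      exact add_right_cancel h2
  · rintro ⟨hz, htr⟩
    rw [mem_UU] at hz
    have key : ∀ n, ∃ g : Wd F (p ^ e) n → B, (∀ ω, g ((sh F (p ^ e) n ^ p) ω) = g ω) ∧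
        (∀ ω, g (sh F (p ^ e) n ω) - g ω = z n ω) ∧
        (∀ ω, g ω ≠ 0 → ∃ i : ℕ, z n ((sh F (p ^ e) n ^ i) ω) ≠ 0) := by
      intro n
      refine cyc_a (sh F (p ^ e) n) p e (sh_pow_q F (p ^ e) n) hpB (z n) ?_ ?_
      · intro w
        rw [← sg_pow_apply F p z n w, hz.2]
      · intro w
        rw [← tr_apply, htr]; rfl
    choose g h1 h2 h3 using key
    refine ⟨g, ?_, ?_⟩
    · rw [SetLike.mem_coe, mem_UU]
      refine ⟨fun n w hw => ?_, ?_⟩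
      · obtain ⟨i, hi⟩ := h3 n w hw
        obtain ⟨h4, h5⟩ := hz.1 n _ hi
        exact ⟨h4, (good_sh_pow F i w).1 h5⟩
      · funext n w
        rw [sg_pow_apply, h1]
    · funext n w
      exact h2 n w

lemma chi_phi [IsLocalRing B] [IsNoetherianRing B] (hpB : ∀ b : B, (p : B) * b = 0 → b = 0)
    (s : ℕ) (hs : ∀ i, F.deg i ≤ s)
    (hF : ∀ x ∈ maximalIdeal B, ∃ M : ℕ, F.NullHtp (x ^ M)) :
    (∀ j, chl (mact (Rp B p) (dq F p e)) (F.supp (Rp B p)) j ≠ ⊤) ∧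
    chi (mact (Rp B p) (dq F p e)) (F.supp (Rp B p)) (p ^ e * s + 1) = 0 := by
  have hUf : ∀ j, chl (DD F (p ^ e)) (UU F p e) j ≠ ⊤ := by
    intro j
    have := NN_noeth F (p ^ e) j
    refine chl_ne_top _ _ j (isNoetherian_of_le (inf_le_left : UU F p e j ≤ NN F (p ^ e) j)) fun x hx => ?_
    obtain ⟨M, h, hh, hc⟩ := hF x hx
    refine ⟨M * p ^ e, fun z hz hD => ⟨SS F (p ^ e) h z, ?_, ?_⟩⟩
    · rw [mem_UU] at hz ⊢
      exact ⟨SS_NN F hh hz.1 hD, by rw [← SS_sg_pow, hz.2]⟩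
    · rw [DD_SS F hc, pow_mul]
  have hIf : ∀ j, chl (DD F (p ^ e)) (II F p e) j ≠ ⊤ := by
    intro j
    have := NN_noeth F (p ^ e) j
    refine chl_ne_top _ _ j (isNoetherian_of_le (inf_le_left : II F p e j ≤ NN F (p ^ e) j)) fun x hx => ?_
    obtain ⟨M, h, hh, hc⟩ := hF x hx
    refine ⟨M * p ^ e, fun z hz hD => ⟨SS F (p ^ e) h z, ?_, ?_⟩⟩
    · rw [mem_II] at hz ⊢
      exact ⟨SS_NN F hh hz.1 hD, by rw [← SS_sg, hz.2]⟩
    · rw [DD_SS F hc, pow_mul]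
  set L := p ^ e * s + 1 with hLdef
  have hNL : ∀ j, L ≤ j → NN F (p ^ e) j = ⊥ := fun j hj => NN_bot F hs j (by omega)
  have hUL : ∀ j, L ≤ j → UU F p e j = ⊥ := fun j hj =>
    le_bot_iff.1 ((inf_le_left : UU F p e j ≤ NN F (p ^ e) j).trans (hNL j hj).le)
  have hIL : ∀ j, L ≤ j → II F p e j = ⊥ := fun j hj =>
    le_bot_iff.1 ((inf_le_left : II F p e j ≤ NN F (p ^ e) j).trans (hNL j hj).le)
  have hDDU : ∀ j, ∀ z ∈ UU F p e j, DD F (p ^ e) (DD F (p ^ e) z) = 0 := fun j z hz => DD_DD F hz.1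
  have hDDI : ∀ j, ∀ z ∈ II F p e j, DD F (p ^ e) (DD F (p ^ e) z) = 0 := fun j z hz => DD_DD F hz.1
  have hU0 : ∀ z ∈ UU F p e 0, DD F (p ^ e) z = 0 := fun z hz => DD_NN_zero F hz.1
  have hI0 : ∀ z ∈ II F p e 0, DD F (p ^ e) z = 0 := fun z hz => DD_NN_zero F hz.1
  -- first sequence
  obtain ⟨a1, b1⟩ := chi_add (DD F (p ^ e)) (DD F (p ^ e)) (II F p e) (UU F p e) hDDU
    (fun j => (UU F p e j).map (sg F (p ^ e) - 1)) (sg F (p ^ e) - 1) (UU_D F p e) hU0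
    (fun j z _ => by
      change sg F (p ^ e) (DD F (p ^ e) z) - DD F (p ^ e) z = DD F (p ^ e) (sg F (p ^ e) z - z)
      rw [map_sub, DD_sg])
    (fun j z => by
      rw [mem_II, mem_UU]
      have : (sg F (p ^ e) - 1) z = sg F (p ^ e) z - z := rfl
      rw [this, sub_eq_zero]
      constructor
      · rintro ⟨h1, h2⟩
        refine ⟨⟨h1, ?_⟩, h2⟩
        have : ∀ m : ℕ, (sg F (p ^ e) ^ m) z = z := fun m => by
          induction m with
          | zero => rfl
          | succ m ih => rw [pow_succ, Module.End.mul_apply, h2, ih]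
        exact this p
      · rintro ⟨h1, h2⟩
        exact ⟨h1.1, h2⟩)
    (fun j z => Iff.rfl) L hUL hUf
  have c1 := b1 hIf
  have hVf := a1.1 hIf
  obtain ⟨a2, b2⟩ := chi_add (DD F (p ^ e)) (DD F (p ^ e)) (fun j => (UU F p e j).map (sg F (p ^ e) - 1))
    (UU F p e) hDDU
    (fun j => (UU F p e j).map (tr F p e)) (tr F p e) (UU_D F p e) hU0
    (fun j z _ => (DD_tr F p e z).symm)
    (fun j z => ker_tr F p e hpB j z)
    (fun j z => Iff.rfl) L hUL hUf
  have c2 := b2 hVf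
  have hTf := a2.1 hVf
  obtain ⟨a3, b3⟩ := chi_add (DD F (p ^ e)) (mact (Rp B p) (dq F p e)) (fun j => (UU F p e j).map (tr F p e))
    (II F p e) hDDI
    (F.supp (Rp B p)) (ev F p e) (II_D F p e) hI0
    (fun j z hz => ev_DD F p e j z hz)
    (fun j z => tr_II F p e j z)
    (fun j z => ev_II F p e j z) L hIL hIf
  have c3 := b3 hTf
  refine ⟨a3.1 hTf, ?_⟩
  linarith

/-- Vanishing of the Euler characteristic of the Frobenius pullback modulo `p`. -/
lemma chi_frob [IsLocalRing B] [IsNoetherianRing B] [CharP (Rp B p) p] (hpB : ∀ b : B, (p : B) * b = 0 → b = 0)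
    (s : ℕ) (hs : ∀ i, F.deg i ≤ s)
    (hF : ∀ x ∈ maximalIdeal B, ∃ M : ℕ, F.NullHtp (x ^ M)) :
    (∀ j, ((F.map (Ideal.Quotient.mk (Ideal.span {(p : B)}))).frob p e).hl (Rp B p) j ≠ ⊤) ∧
    ∑ j ∈ Finset.range (p ^ e * s + 1), (-1 : ℤ) ^ j *
      ((((F.map (Ideal.Quotient.mk (Ideal.span {(p : B)}))).frob p e).hl (Rp B p) j).toNat : ℤ) = 0 := by
  have hD : ∀ z : F.ι → Rp B p, ((F.map (Ideal.Quotient.mk (Ideal.span {(p : B)}))).frob p e).D (Rp B p) z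
      = mact (Rp B p) (dq F p e) z := by
    intro z
    funext b
    refine (mact_apply ..).trans (Eq.trans ?_ (mact_apply ..).symm)
    refine Finset.sum_congr rfl fun b' _ => ?_
    refine Eq.trans ?_ (Algebra.smul_def (dq F p e b b') (z b')).symm
    refine congrArg (· * z b') ?_
    change iterateFrobenius (Rp B p) p e (Ideal.Quotient.mk _ (F.d b b')) = Ideal.Quotient.mk _ (F.d b b' ^ (p ^ e))
    rw [iterateFrobenius_def, map_pow]
  have hEq : ∀ j, ((F.map (Ideal.Quotient.mk (Ideal.span {(p : B)}))).frob p e).hl (Rp B p) j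
      = chl (mact (Rp B p) (dq F p e)) (F.supp (Rp B p)) j := by
    intro j
    refine rl_restrict (B := B) (R := Rp B p) (M := F.ι → Rp B p) Ideal.Quotient.mk_surjective _ _ _ _ ?_ ?_
    · intro z
      constructor
      · rintro ⟨u, hu, rfl⟩
        exact ⟨u, hu, (hD u).symm⟩
      · rintro ⟨u, hu, rfl⟩
        exact ⟨u, hu, hD u⟩
    · intro z
      constructor
      · rintro ⟨h1, h2⟩
        exact ⟨h1, (hD z).symm.trans h2⟩
      · rintro ⟨h1, h2⟩
        exact ⟨h1, (hD z).trans h2⟩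
  obtain ⟨h1, h2⟩ := chi_phi F p e hpB s hs hF
  simp only [hEq]
  exact ⟨h1, h2⟩

end main
end TPow
end NIT

-- Part 17

namespace NIT
open IsLocalRing

lemma quot_data {B : Type} [CommRing B] [IsLocalRing B] (I : Ideal B) (hI : I ≠ ⊤) [IsLocalRing (B ⧸ I)]
    (F : FC B) (hF : ∀ x ∈ maximalIdeal B, ∃ M : ℕ, F.NullHtp (x ^ M))
    (a : F.ι) (hd : ∀ j, F.d a j ∈ maximalIdeal B) :
    (∀ x ∈ maximalIdeal (B ⧸ I), ∃ M : ℕ, (F.map (Ideal.Quotient.mk I)).NullHtp (x ^ M)) ∧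
    (∀ j : F.ι, (F.map (Ideal.Quotient.mk I)).d a j ∈ maximalIdeal (B ⧸ I)) := by
  have hl : IsLocalHom (Ideal.Quotient.mk I) := IsLocalHom.of_surjective _ Ideal.Quotient.mk_surjective
  constructor
  · intro x hx
    obtain ⟨y, rfl⟩ := Ideal.Quotient.mk_surjective x
    have hy : y ∈ maximalIdeal B := by
      rw [mem_maximalIdeal, mem_nonunits_iff] at hx ⊢
      exact fun h => hx (h.map _)
    obtain ⟨M, hM⟩ := hF y hy
    refine ⟨M, ?_⟩
    have := hM.map (Ideal.Quotient.mk I)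
    rwa [map_pow] at this
  · intro j
    have h := hd j
    rw [mem_maximalIdeal, mem_nonunits_iff] at h ⊢
    exact fun h' => h (isUnit_of_map_unit (Ideal.Quotient.mk I) _ h')

lemma nit_mixed {B : Type} [CommRing B] [IsLocalRing B] [IsNoetherianRing B] (p : ℕ) [Fact p.Prime]
    (hpm : (p : B) ∈ maximalIdeal B) (hpB : ∀ b : B, (p : B) * b = 0 → b = 0)
    (F : FC B) (s : ℕ) (hs : ∀ i, F.deg i ≤ s)
    (hF : ∀ x ∈ maximalIdeal B, ∃ M : ℕ, F.NullHtp (x ^ M))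
    (a : F.ι) (ha : F.deg a = 0) (hd : ∀ j, F.d a j ∈ maximalIdeal B) : ringKrullDim B ≤ s := by
  by_contra hlt
  rw [not_le] at hlt
  have hne : Ideal.span {(p : B)} ≠ ⊤ := fun h => by
    rw [Ideal.span_singleton_eq_top] at h
    exact (mem_maximalIdeal _).1 hpm h
  haveI : Nontrivial (TPow.Rp B p) := Ideal.Quotient.nontrivial_iff.2 hne
  haveI : IsLocalRing (TPow.Rp B p) := IsLocalRing.of_surjective' _ Ideal.Quotient.mk_surjective
  haveI : CharP (TPow.Rp B p) p := CharP.quotient B p hpm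
  obtain ⟨r, hr⟩ := exists_nat_dim (TPow.Rp B p)
  have hsr : s ≤ r := by
    have h1 := ringKrullDim_le_ringKrullDim_quotient_add_card (R := B) {(p : B)} (by
      rw [Finset.coe_singleton, Set.singleton_subset_iff, SetLike.mem_coe, IsLocalRing.ringJacobson_eq_maximalIdeal]
      exact hpm)
    rw [Finset.coe_singleton, Finset.card_singleton] at h1
    rw [show ringKrullDim (B ⧸ Ideal.span {(p : B)}) = r from hr] at h1
    have h2 := hlt.trans_le h1
    have : s < r + 1 := by exact_mod_cast h2
    omega
  obtain ⟨hF', hd'⟩ := quot_data (Ideal.span {(p : B)}) hne F hF a hd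
  obtain ⟨C, K, h1, h2, h3⟩ := FC.frob_asymp p (F.map (Ideal.Quotient.mk (Ideal.span {(p : B)}))) s hs hF' a ha hd' r hr
  obtain ⟨e, he⟩ : ∃ e, K * (s * C) < p ^ e := ⟨_, Nat.lt_pow_self (Fact.out : p.Prime).one_lt⟩
  obtain ⟨c1, c2⟩ := TPow.chi_frob F p e hpB s hs hF
  set G := (F.map (Ideal.Quotient.mk (Ideal.span {(p : B)}))).frob p e with hG
  have hz : ∀ j, s < j → G.hl (TPow.Rp B p) j = 0 := fun j hj => FC.hl_eq_zero G hs hj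
  choose l hl using fun j => ENat.ne_top_iff_exists.1 (c1 j)
  have hl' : ∀ j, (G.hl (TPow.Rp B p) j).toNat = l j := fun j => by rw [← hl]; rfl
  simp only [hl'] at c2
  have g3 : (p ^ e) ^ r ≤ K * l 0 := by
    have := h3 e
    rw [← hG, ← hl] at this
    exact_mod_cast this
  have g1 : ∀ j, 1 ≤ j → p ^ e * l j ≤ C * (p ^ e) ^ r := fun j hj => by
    have := h1 e j (by omega)
    rw [← hG, ← hl] at this
    exact_mod_cast this
  have gz : ∀ j, s < j → l j = 0 := fun j hj => by rw [← hl', hz j hj]; rfl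
  have hpos : 0 < p ^ e := pow_pos (Fact.out : p.Prime).pos e
  have g0 : l 0 ≤ ∑ j ∈ Finset.range s, l (j+1) := by
    rw [Finset.sum_range_succ'] at c2
    have hsub : ∑ j ∈ Finset.range (p ^ e * s), (-1 : ℤ) ^ (j+1) * (l (j+1) : ℤ)
        = ∑ j ∈ Finset.range s, (-1 : ℤ) ^ (j+1) * (l (j+1) : ℤ) := by
      symm
      refine Finset.sum_subset (Finset.range_subset_range.2 (Nat.le_mul_of_pos_left s hpos)) ?_
      intro j _ hj
      rw [Finset.mem_range, not_lt] at hj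
      rw [gz (j+1) (by omega)]; simp
    rw [hsub] at c2
    have : (l 0 : ℤ) ≤ ∑ j ∈ Finset.range s, (l (j+1) : ℤ) := by
      have h5 : (l 0 : ℤ) = ∑ j ∈ Finset.range s, -((-1 : ℤ) ^ (j+1) * (l (j+1) : ℤ)) := by
        rw [Finset.sum_neg_distrib]; simp at c2; linarith
      rw [h5]
      refine Finset.sum_le_sum fun j _ => ?_
      rcases neg_one_pow_eq_or ℤ (j+1) with h | h <;> rw [h] <;> simp
    exact_mod_cast this
  have g4 : p ^ e * l 0 ≤ s * (C * (p ^ e) ^ r) := by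
    calc p ^ e * l 0 ≤ p ^ e * ∑ j ∈ Finset.range s, l (j+1) := Nat.mul_le_mul_left _ g0
      _ = ∑ j ∈ Finset.range s, p ^ e * l (j+1) := Finset.mul_sum _ _ _
      _ ≤ ∑ j ∈ Finset.range s, C * (p ^ e) ^ r := Finset.sum_le_sum fun j _ => g1 (j+1) (by omega)
      _ = _ := by simp
  have hposr : 0 < (p ^ e) ^ r := pow_pos hpos r
  have : p ^ e * (p ^ e) ^ r ≤ (K * (s * C)) * (p ^ e) ^ r := by
    calc p ^ e * (p ^ e) ^ r ≤ p ^ e * (K * l 0) := Nat.mul_le_mul_left _ g3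
      _ = K * (p ^ e * l 0) := by ring
      _ ≤ K * (s * (C * (p ^ e) ^ r)) := Nat.mul_le_mul_left _ g4
      _ = _ := by ring
  have := Nat.le_of_mul_le_mul_right this hposr
  omega

lemma nit_domain {B : Type} [CommRing B] [IsDomain B] [IsLocalRing B] [IsNoetherianRing B]
    (F : FC B) (s : ℕ) (hs : ∀ i, F.deg i ≤ s)
    (hF : ∀ x ∈ maximalIdeal B, ∃ M : ℕ, F.NullHtp (x ^ M))
    (a : F.ι) (ha : F.deg a = 0) (hd : ∀ j, F.d a j ∈ maximalIdeal B) : ringKrullDim B ≤ s := by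
  by_cases h : ∃ p : ℕ, p.Prime ∧ (p : B) ∈ maximalIdeal B
  · obtain ⟨p, hp, hpm⟩ := h
    haveI : Fact p.Prime := ⟨hp⟩
    by_cases h0 : (p : B) = 0
    · haveI : CharP B p := by
        obtain ⟨q, hq⟩ := CharP.exists B
        have h1 : q ∣ p := (CharP.cast_eq_zero_iff B q p).1 h0
        rcases (Nat.dvd_prime hp).1 h1 with h2 | h2
        · subst h2
          exact absurd rfl (CharP.char_ne_one B 1)
        · rwa [h2] at hq
      exact FC.nit_charP p F s hs hF a ha hd
    · exact nit_mixed p hpm (fun b hb => (mul_eq_zero.1 hb).resolve_left h0) F s hs hF a ha hd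
  · push Not at h
    have hu : ∀ n : ℕ, n ≠ 0 → IsUnit (n : B) := by
      intro n
      induction n using Nat.recOnMul with
      | zero => intro h; exact absurd rfl h
      | one => intro _; simp
      | prime q hq =>
        intro _
        have := h q hq
        rwa [mem_maximalIdeal, mem_nonunits_iff, not_not] at this
      | mul m n hm hn =>
        intro hmn
        rw [Nat.cast_mul]
        exact (hm (left_ne_zero_of_mul hmn)).mul (hn (right_ne_zero_of_mul hmn))
    have hq : Nonempty (ℚ →+* B) := by
      refine ⟨IsLocalization.lift (M := nonZeroDivisors ℤ) (g := Int.castRingHom B) ?_⟩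
      rintro ⟨y, hy⟩
      have hy0 : y ≠ 0 := nonZeroDivisors.ne_zero hy
      have := hu y.natAbs (Int.natAbs_ne_zero.2 hy0)
      rcases Int.natAbs_eq y with h | h
      · change IsUnit ((y : ℤ) : B)
        rw [h]; simpa using this
      · change IsUnit ((y : ℤ) : B)
        rw [h]; simpa using this
    letI : Algebra ℚ B := hq.some.toAlgebra
    exact nit_eqz F s hs hF a ha hd

lemma dim_le_of_primes {B : Type} [CommRing B] (s : ℕ)
    (h : ∀ P : Ideal B, P.IsPrime → ringKrullDim (B ⧸ P) ≤ s) : ringKrullDim B ≤ s := by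
  refine iSup_le fun l => ?_
  have := h l.head.asIdeal l.head.isPrime
  rw [ringKrullDim_quotient] at this
  refine le_trans ?_ this
  refine le_trans ?_ (le_iSup _ (⟨l.length, fun i => ⟨l i, ?_⟩, fun i => ?_⟩ :
    LTSeries (PrimeSpectrum.zeroLocus (l.head.asIdeal : Set B))))
  · exact le_rfl
  · exact l.head_le i
  · exact l.step i

/-- **New intersection theorem.** -/
theorem nit {B : Type} [CommRing B] [IsLocalRing B] [IsNoetherianRing B]
    (F : FC B) (s : ℕ) (hs : ∀ i, F.deg i ≤ s)
    (hF : ∀ x ∈ maximalIdeal B, ∃ M : ℕ, F.NullHtp (x ^ M))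
    (a : F.ι) (ha : F.deg a = 0) (hd : ∀ j, F.d a j ∈ maximalIdeal B) : ringKrullDim B ≤ s := by
  refine dim_le_of_primes s fun P hP => ?_
  haveI : IsLocalRing (B ⧸ P) := IsLocalRing.of_surjective' _ Ideal.Quotient.mk_surjective
  obtain ⟨hF', hd'⟩ := quot_data P hP.ne_top F hF a hd
  exact nit_domain (F.map (Ideal.Quotient.mk P)) s hs hF' a ha hd'

end NIT

-- Part 18

namespace NIT
open IsLocalRing
open scoped Pointwise

lemma ass_elt {R M : Type} [CommRing R] [IsNoetherianRing R] [AddCommGroup M] [Module R M] {P : Ideal R}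
    (h : IsAssociatedPrime P M) : ∃ x : M, x ≠ 0 ∧ ∀ r, r ∈ P ↔ r • x = 0 := by
  obtain ⟨h1, x, hx⟩ := isAssociatedPrime_iff.1 h
  have h2 : ∀ r, r ∈ P ↔ r • x = 0 := fun r => by
    rw [hx, Submodule.mem_colon_singleton, Submodule.mem_bot]
  refine ⟨x, fun h0 => h1.ne_top ?_, h2⟩
  rw [Ideal.eq_top_iff_one, h2, h0, smul_zero]

/-- Either there is a socle element or a regular element in the maximal ideal. -/
lemma socle_or_regular (R N : Type) [CommRing R] [IsLocalRing R] [IsNoetherianRing R] [AddCommGroup N] [Module R N]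
    [Module.Finite R N] : (∃ w : N, w ≠ 0 ∧ ∀ r ∈ maximalIdeal R, r • w = 0) ∨
      ∃ y ∈ maximalIdeal R, IsSMulRegular N y := by
  by_cases h : ∃ y ∈ maximalIdeal R, IsSMulRegular N y
  · exact Or.inr h
  left
  push Not at h
  have h1 : (maximalIdeal R : Set R) ⊆ ⋃ p ∈ associatedPrimes R N, ((p : Ideal R) : Set R) := by
    rw [biUnion_associatedPrimes_eq_compl_regular]
    exact fun y hy => h y hy
  rw [Ideal.subset_union_prime_finite (associatedPrimes.finite R N) (f := fun p => p) ⊥ ⊥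
    (fun i hi _ _ => IsAssociatedPrime.isPrime hi)] at h1
  obtain ⟨P, hP, hle⟩ := h1
  obtain ⟨x, hx, hx'⟩ := ass_elt hP
  exact ⟨x, hx, fun r hr => (hx' r).1 (hle hr)⟩

namespace FC
variable {R : Type} [CommRing R] (F : FC R) {N : Type} [AddCommGroup N] [Module R N]

lemma lift_supp {N' : Type} [AddCommGroup N'] [Module R N'] (f : N →ₗ[R] N') (hf : Function.Surjective f)
    {j : ℕ} {z : F.ι → N'} (hz : z ∈ F.supp N' j) : ∃ w ∈ F.supp N j, (fun i => f (w i)) = z := by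
  classical
  choose g hg using hf
  refine ⟨fun i => if F.deg i = j then g (z i) else 0, fun i hi => if_neg hi, ?_⟩
  funext i
  by_cases hi : F.deg i = j
  · simp [hi, hg]
  · simp [hi, hz i hi]

lemma supp_map {N' : Type} [AddCommGroup N'] [Module R N'] (f : N →ₗ[R] N') {j : ℕ} {z : F.ι → N}
    (hz : z ∈ F.supp N j) : (fun i => f (z i)) ∈ F.supp N' j := fun i hi => by
  simp [hz i hi]

lemma Bd_map {N' : Type} [AddCommGroup N'] [Module R N'] (f : N →ₗ[R] N') {j : ℕ} {z : F.ι → N}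
    (hz : z ∈ F.Bd N j) : (fun i => f (z i)) ∈ F.Bd N' j := by
  obtain ⟨w, hw, rfl⟩ := hz
  exact ⟨_, F.supp_map f hw, mact_comp f _ _⟩

/-- the quotient map -/
abbrev qm (y : R) (N : Type) [AddCommGroup N] [Module R N] : N →ₗ[R] QuotSMulTop y N :=
  Submodule.mkQ (y • (⊤ : Submodule R N))

lemma qm_surj (y : R) : Function.Surjective (qm y N) := Submodule.mkQ_surjective _

lemma qm_eq_zero {y : R} {n : N} : qm y N n = 0 ↔ ∃ u, y • u = n := by
  rw [Submodule.mkQ_apply, Submodule.Quotient.mk_eq_zero, Submodule.mem_smul_pointwise_iff_exists]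
  simp

lemma qm_supp {y : R} {j : ℕ} {z : F.ι → N} (hz : z ∈ F.supp N j) (h : (fun i => qm y N (z i)) = 0) :
    ∃ u ∈ F.supp N j, y • u = z := by
  classical
  choose g hg using fun i => qm_eq_zero.1 (congrFun h i)
  refine ⟨fun i => if F.deg i = j then g i else 0, fun i hi => if_neg hi, ?_⟩
  funext i
  by_cases hi : F.deg i = j
  · simp [hi, hg]
  · simp [hi, hz i hi]

lemma smul_inj {y : R} (hy : IsSMulRegular N y) {z w : F.ι → N} (h : y • z = y • w) : z = w := by
  funext i; exact hy (congrFun h i)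

/-- cycles modulo `y` -/
lemma cycle_mod {y : R} (hy : IsSMulRegular N y) {j : ℕ} {z : F.ι → N} (hz : z ∈ F.supp N (j+1))
    (h : F.D (QuotSMulTop y N) (fun i => qm y N (z i)) = 0) :
    ∃ u ∈ F.supp N j, F.D N z = y • u ∧ F.D N u = 0 := by
  rw [D, mact_comp] at h
  obtain ⟨u, hu, hu'⟩ := F.qm_supp (F.D_supp hz) h
  refine ⟨u, hu, hu'.symm, F.smul_inj hy ?_⟩
  rw [← map_smul, hu', F.D_D, smul_zero]

lemma core [IsLocalRing R] [IsNoetherianRing R] (hmin : ∀ i j, F.d i j ∈ maximalIdeal R)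
    (s : ℕ) (hs : ∀ i, F.deg i ≤ s) (t : F.ι) (ht : F.deg t = s) (k : ℕ) :
    ∀ (i : ℕ) (N : Type) [AddCommGroup N] [Module R N] [Module.Finite R N] (p : Ideal R) [p.IsPrime]
      (_ : ∃ n : N, n ≠ 0 ∧ ∀ r ∈ p, r • n = 0) (_ : ringKrullDim (R ⧸ p) ≤ k) (_ : i + k ≤ s)
      (_ : ∀ j, i < j → ∀ z ∈ F.supp N j, F.D N z = 0 → z ∈ F.Bd N j),
      ∃ z ∈ F.supp N i, F.D N z = 0 ∧ z ∉ F.Bd N i ∧ ∀ r ∈ maximalIdeal R, r • z ∈ F.Bd N i := by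
  induction k using Nat.strong_induction_on with
  | _ k ih =>
  intro i N _ _ _ p _ hn hdim hik hex
  rcases socle_or_regular R N with ⟨w, hw, hmw⟩ | ⟨y, hym, hy⟩
  · -- socle element
    have hz : (Pi.single t w : F.ι → N) ∈ F.supp N s := fun b hb => by
      rw [Pi.single_eq_of_ne]; rintro rfl; exact hb ht
    have hDz : F.D N (Pi.single t w) = 0 := by
      funext b
      rw [mact_apply, Finset.sum_eq_single t]
      · rw [Pi.single_eq_same]; exact hmw _ (hmin b t)
      · intro c _ hc; rw [Pi.single_eq_of_ne hc, smul_zero]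
      · simp
    have hnb : (Pi.single t w : F.ι → N) ∉ F.Bd N s := by
      rintro ⟨v, hv, hv'⟩
      rw [F.Z_eq_bot_of_lt hs (Nat.lt_succ_self s) hv, map_zero] at hv'
      exact hw (by simpa using (congrFun hv' t).symm)
    have : s ≤ i := by
      by_contra hlt
      exact hnb (hex s (by omega) _ hz hDz)
    obtain rfl : i = s := by omega
    refine ⟨_, hz, hDz, hnb, fun r hr => ?_⟩
    have : r • (Pi.single t w : F.ι → N) = 0 := by
      rw [← Pi.single_smul', hmw r hr, Pi.single_zero]
    rw [this]; exact zero_mem _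
  · -- regular element
    obtain ⟨n, hn0, hpn⟩ := hn
    have hyp : y ∉ p := fun h => hn0 (hy (by simpa using hpn y h))
    -- an element of the `p`-torsion outside `yN`
    obtain ⟨t1, ht1, hty⟩ : ∃ t1 : N, (∀ r ∈ p, r • t1 = 0) ∧ qm y N t1 ≠ 0 := by
      by_contra hcon
      push Not at hcon
      let T : Submodule R N :=
        { carrier := {t1 | ∀ r ∈ p, r • t1 = 0}
          add_mem' := fun ha hb r hr => by rw [smul_add, ha r hr, hb r hr, add_zero]
          zero_mem' := fun r _ => smul_zero r
          smul_mem' := fun c x hx r hr => by rw [smul_comm, hx r hr, smul_zero] }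
      have hT : T ≤ (maximalIdeal R) • T := by
        intro x hx
        obtain ⟨u, rfl⟩ := qm_eq_zero.1 (hcon x hx)
        refine Submodule.smul_mem_smul hym fun r hr => hy ?_
        have := hx r hr
        change y • r • u = y • 0
        rw [smul_zero, smul_comm]; exact this
      have hT0 : T = ⊥ := Submodule.eq_bot_of_le_smul_of_le_jacobson_bot (maximalIdeal R) T
        (IsNoetherian.noetherian T) hT (IsLocalRing.jacobson_eq_maximalIdeal ⊥ bot_ne_top).ge
      have : n ∈ T := hpn
      rw [hT0] at this
      exact hn0 this
    obtain ⟨p', hp', hle⟩ := exists_le_isAssociatedPrime_of_isNoetherianRing R (qm y N t1) hty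
    obtain ⟨x', hx'0, hx'⟩ := ass_elt hp'
    haveI := hp'.isPrime
    have hpp : p ≤ p' := fun r hr => hle (by
      rw [Submodule.mem_colon_singleton, Submodule.mem_bot, ← map_smul, ht1 r hr, map_zero])
    have hyp' : y ∈ p' := hle (by
      rw [Submodule.mem_colon_singleton, Submodule.mem_bot, ← map_smul]
      exact qm_eq_zero.2 ⟨t1, rfl⟩)
    have hd1 : ringKrullDim (R ⧸ p') + 1 ≤ ringKrullDim (R ⧸ p) := by
      refine ringKrullDim_succ_le_of_surjective (Ideal.Quotient.factor hpp) (Ideal.Quotient.factor_surjective hpp)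
        (r := Ideal.Quotient.mk p y) ?_ ?_
      · rw [mem_nonZeroDivisors_iff_ne_zero, Ne, Ideal.Quotient.eq_zero_iff_mem]; exact hyp
      · rw [Ideal.Quotient.factor_mk, Ideal.Quotient.eq_zero_iff_mem]; exact hyp'
    haveI : IsLocalRing (R ⧸ p') := IsLocalRing.of_surjective' _ Ideal.Quotient.mk_surjective
    obtain ⟨r', hr'⟩ := exists_nat_dim (R ⧸ p')
    rw [hr'] at hd1
    have hrk : r' + 1 ≤ k := by exact_mod_cast hd1.trans hdim
    obtain ⟨z0, hz0, hDz0, hnz0, hsoc⟩ := ih r' (by omega) (i+1) (QuotSMulTop y N) p'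
      ⟨x', hx'0, fun r hr => (hx' r).1 hr⟩ hr'.le (by omega) (by
        intro j hj z hzq hDz
        obtain ⟨z, hz, rfl⟩ := F.lift_supp (qm y N) (qm_surj y) hzq
        obtain ⟨j, rfl⟩ : ∃ j', j = j' + 1 := ⟨j - 1, by omega⟩
        obtain ⟨u, hu, hu1, hu2⟩ := F.cycle_mod hy hz hDz
        obtain ⟨v, hv, hv'⟩ := hex j (by omega) u hu hu2
        have h1 := hex (j+1) (by omega) (z - y • v) (sub_mem hz (Submodule.smul_mem _ _ hv)) (by
          rw [map_sub, map_smul, hv', hu1, sub_self])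
        have h2 := F.Bd_map (qm y N) h1
        convert h2 using 1
        funext b
        rw [Pi.sub_apply, map_sub, Pi.smul_apply, qm_eq_zero.2 ⟨v b, rfl⟩, sub_zero])
    obtain ⟨z, hz, rfl⟩ := F.lift_supp (qm y N) (qm_surj y) hz0
    obtain ⟨u, hu, hu1, hu2⟩ := F.cycle_mod hy hz hDz0
    refine ⟨u, hu, hu2, ?_, ?_⟩
    · rintro ⟨v, hv, hv'⟩
      apply hnz0
      have h1 := hex (i+1) (by omega) (z - y • v) (sub_mem hz (Submodule.smul_mem _ _ hv)) (by
          rw [map_sub, map_smul, hv', hu1, sub_self])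
      have h2 := F.Bd_map (qm y N) h1
      convert h2 using 1
      funext b
      rw [Pi.sub_apply, map_sub, Pi.smul_apply, qm_eq_zero.2 ⟨v b, rfl⟩, sub_zero]
    · intro r hr
      obtain ⟨w, hwq, hw'⟩ := hsoc r hr
      obtain ⟨w, hw, rfl⟩ := F.lift_supp (qm y N) (qm_surj y) hwq
      rw [D, mact_comp] at hw'
      obtain ⟨v, hv, hv'⟩ := F.qm_supp (y := y) (z := r • z - F.D N w)
        (sub_mem (Submodule.smul_mem _ _ hz) (F.D_supp hw)) (by
          funext b
          rw [Pi.sub_apply, map_sub, Pi.smul_apply, map_smul, congrFun hw' b]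
          simp)
      refine ⟨v, hv, F.smul_inj hy ?_⟩
      rw [← map_smul, hv', map_sub, F.D_D, sub_zero, map_smul, hu1, smul_comm]

end FC
end NIT

-- Part 19

namespace NIT
open IsLocalRing

namespace FC
variable {R : Type} [CommRing R]

section cancel
variable (F : FC R) (a b : F.ι) (v : R)

/-- the elementary homotopy -/
def cE : Matrix F.ι F.ι R := Matrix.single b a v
/-- the associated projection -/
def cP : Matrix F.ι F.ι R := 1 - F.d * F.cE a b v - F.cE a b v * F.d
abbrev cι : Type := {i : F.ι // i ≠ a ∧ i ≠ b}
def cf : Matrix F.ι (F.cι a b) R := fun i j => F.cP a b v i j.1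
def cg : Matrix (F.cι a b) F.ι R := fun i j => F.cP a b v i.1 j

variable {F a b v} (hv : v * F.d a b = 1)

lemma cE_apply (i j : F.ι) : F.cE a b v i j = if b = i ∧ a = j then v else 0 := by
  simp [cE, Matrix.single_apply]

lemma dE_apply (i j : F.ι) : (F.d * F.cE a b v) i j = if a = j then F.d i b * v else 0 := by
  rw [Matrix.mul_apply, Finset.sum_eq_single b]
  · rw [cE_apply]; by_cases h : a = j <;> simp [h]
  · intro c _ hc; rw [cE_apply, if_neg (fun h => hc h.1.symm), mul_zero]
  · simp

lemma Ed_apply (i j : F.ι) : (F.cE a b v * F.d) i j = if b = i then v * F.d a j else 0 := by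
  rw [Matrix.mul_apply, Finset.sum_eq_single a]
  · rw [cE_apply]; by_cases h : b = i <;> simp [h]
  · intro c _ hc; rw [cE_apply, if_neg (fun h => hc h.2.symm), zero_mul]
  · simp

lemma cE_ne [Nontrivial R] (hv : v * F.d a b = 1) : F.deg b = F.deg a + 1 :=
  F.d_deg a b fun h => by simp [h] at hv

lemma EE [Nontrivial R] (hv : v * F.d a b = 1) : F.cE a b v * F.cE a b v = 0 := by
  have hab : a ≠ b := fun h => by have := cE_ne hv; rw [h] at this; omega
  exact Matrix.single_mul_single_of_ne _ _ _ _ hab _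

lemma EdE (hv : v * F.d a b = 1) : F.cE a b v * F.d * F.cE a b v = F.cE a b v := by
  ext i j
  rw [Matrix.mul_apply, Finset.sum_eq_single b]
  · rw [Ed_apply, cE_apply, cE_apply]
    by_cases h : b = i
    · by_cases h' : a = j
      · rw [if_pos h, if_pos ⟨rfl, h'⟩, if_pos ⟨h, h'⟩, hv, one_mul]
      · simp [h']
    · simp [h]
  · intro c _ hc; rw [cE_apply, if_neg (fun h => hc h.1.symm), mul_zero]
  · simp

lemma PE [Nontrivial R] (hv : v * F.d a b = 1) : F.cP a b v * F.cE a b v = 0 := by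
  rw [cP, sub_mul, sub_mul, mul_assoc F.d, EE hv, EdE hv]; simp
lemma EP [Nontrivial R] (hv : v * F.d a b = 1) : F.cE a b v * F.cP a b v = 0 := by
  rw [cP, mul_sub, mul_sub, ← mul_assoc, ← mul_assoc, EE hv, EdE hv]; simp
lemma Pd : F.cP a b v * F.d = F.d - F.d * F.cE a b v * F.d := by
  rw [cP, sub_mul, sub_mul, mul_assoc (F.cE a b v), F.d_sq]; simp
lemma dP : F.d * F.cP a b v = F.d - F.d * F.cE a b v * F.d := by
  rw [cP, mul_sub, mul_sub, ← mul_assoc F.d F.d, F.d_sq, mul_assoc]; simp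
lemma Pd_dP : F.cP a b v * F.d = F.d * F.cP a b v := by rw [Pd, dP]
lemma PP [Nontrivial R] (hv : v * F.d a b = 1) : F.cP a b v * F.cP a b v = F.cP a b v := by
  have h : F.cP a b v * F.cP a b v
      = F.cP a b v - F.d * (F.cE a b v * F.cP a b v) - F.cE a b v * (F.d * F.cP a b v) := by
    conv_lhs => enter [1]; rw [cP]
    rw [sub_mul, sub_mul, one_mul, mul_assoc, mul_assoc]
  rw [h, EP hv, ← Pd_dP, ← mul_assoc, EP hv]
  simp

lemma cP_b [Nontrivial R] (hv : v * F.d a b = 1) (i : F.ι) : F.cP a b v i b = 0 := by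
  have hab : a ≠ b := fun h => by have := cE_ne hv; rw [h] at this; omega
  simp only [cP, Matrix.sub_apply, dE_apply, Ed_apply, Matrix.one_apply, hab, if_false, hv]
  by_cases h : i = b
  · simp [h]
  · simp [h, Ne.symm h]

lemma cP_a [Nontrivial R] (hv : v * F.d a b = 1) (i : F.ι) : F.cP a b v a i = 0 := by
  have hab : b ≠ a := fun h => by have := cE_ne hv; rw [h] at this; omega
  simp only [cP, Matrix.sub_apply, dE_apply, Ed_apply, Matrix.one_apply, hab, if_false, mul_comm _ v, hv]
  by_cases h : a = i <;> simp [h]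

lemma cfg [Nontrivial R] (hv : v * F.d a b = 1) : F.cf a b v * F.cg a b v = F.cP a b v := by
  rw [← PP hv]
  ext x y
  rw [Matrix.mul_apply, Matrix.mul_apply]
  refine Finset.sum_of_injOn Subtype.val Subtype.val_injective.injOn (by simp) ?_ (fun _ _ => rfl)
  intro i _ hi
  by_cases h1 : i = a
  · rw [h1, cP_a hv, mul_zero]
  by_cases h2 : i = b
  · rw [h2, cP_b hv, zero_mul]
  exact absurd ⟨⟨i, h1, h2⟩, by simp, rfl⟩ hi

lemma cgf [Nontrivial R] (hv : v * F.d a b = 1) : F.cg a b v * F.cf a b v = 1 := by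
  ext i j
  have h : (F.cg a b v * F.cf a b v) i j = (F.cP a b v * F.cP a b v) i.1 j.1 := rfl
  rw [h, PP hv]
  simp only [cP, Matrix.sub_apply, dE_apply, Ed_apply, if_neg (Ne.symm j.2.1), if_neg (Ne.symm i.2.2), sub_zero,
    Matrix.one_apply, Subtype.ext_iff]

lemma cPf [Nontrivial R] (hv : v * F.d a b = 1) : F.cP a b v * F.cf a b v = F.cf a b v := by
  have h : F.cf a b v = F.cP a b v * F.cf a b v := by
    rw [← cfg hv, Matrix.mul_assoc, cgf hv, Matrix.mul_one]
  exact h.symm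
lemma cgP [Nontrivial R] (hv : v * F.d a b = 1) : F.cg a b v * F.cP a b v = F.cg a b v := by
  rw [← cfg hv, ← Matrix.mul_assoc, cgf hv, Matrix.one_mul]

lemma cP_deg [Nontrivial R] (hv : v * F.d a b = 1) (i j : F.ι) (h : F.cP a b v i j ≠ 0) : F.deg i = F.deg j := by
  have hab := cE_ne hv
  by_contra hne
  apply h
  have h1 : i ≠ j := fun h => hne (by rw [h])
  simp only [cP, Matrix.sub_apply, dE_apply, Ed_apply, Matrix.one_apply, h1, if_false, zero_sub]
  have h2 : (if a = j then F.d i b * v else 0) = 0 := by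
    split_ifs with h3
    · by_cases h4 : F.d i b = 0
      · rw [h4, zero_mul]
      · have := F.d_deg i b h4
        rw [← h3] at hne; omega
    · rfl
  have h5 : (if b = i then v * F.d a j else 0) = 0 := by
    split_ifs with h3
    · by_cases h4 : F.d a j = 0
      · rw [h4, mul_zero]
      · have := F.d_deg a j h4
        rw [← h3] at hne; omega
    · rfl
  rw [h2, h5]; simp

/-- Gaussian elimination of a unit entry. -/
abbrev cancel [Nontrivial R] (hv : v * F.d a b = 1) : FC R where
  ι := F.cι a b
  deg i := F.deg i.1
  d := F.cg a b v * F.d * F.cf a b v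
  d_deg i j h := by
    obtain ⟨k, -, hk⟩ := Finset.exists_ne_zero_of_sum_ne_zero h
    obtain ⟨l, -, hl⟩ := Finset.exists_ne_zero_of_sum_ne_zero (left_ne_zero_of_mul hk)
    have h1 := cP_deg hv _ _ (right_ne_zero_of_mul hk)
    have h2 := F.d_deg _ _ (right_ne_zero_of_mul hl)
    have h3 := cP_deg hv _ _ (left_ne_zero_of_mul hl)
    omega
  d_sq := by
    have : F.cg a b v * F.d * F.cf a b v * (F.cg a b v * F.d * F.cf a b v)
        = F.cg a b v * (F.d * (F.cf a b v * F.cg a b v)) * F.d * F.cf a b v := by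
      simp only [Matrix.mul_assoc]
    rw [this, cfg hv, ← Pd_dP]
    simp only [Matrix.mul_assoc]
    rw [← Matrix.mul_assoc F.d, F.d_sq]; simp

variable [Nontrivial R] {hv : v * F.d a b = 1}

lemma cancel_gd : F.cg a b v * F.d = (cancel hv).d * F.cg a b v := by
  change _ = F.cg a b v * F.d * F.cf a b v * F.cg a b v
  rw [Matrix.mul_assoc _ (F.cf a b v), cfg hv, Matrix.mul_assoc, ← Pd_dP, ← Matrix.mul_assoc, cgP hv]

lemma cancel_df : F.d * F.cf a b v = F.cf a b v * (cancel hv).d := by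
  change _ = F.cf a b v * (F.cg a b v * F.d * F.cf a b v)
  rw [← Matrix.mul_assoc, ← Matrix.mul_assoc, cfg hv, Pd_dP, Matrix.mul_assoc, cPf hv]

lemma cancel_null {y : R} (h : F.NullHtp y) : (cancel hv).NullHtp y := by
  obtain ⟨h, hd, he⟩ := h
  refine ⟨F.cg a b v * h * F.cf a b v, ?_, ?_⟩
  · intro i j hij
    obtain ⟨k, -, hk⟩ := Finset.exists_ne_zero_of_sum_ne_zero hij
    obtain ⟨l, -, hl⟩ := Finset.exists_ne_zero_of_sum_ne_zero (left_ne_zero_of_mul hk)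
    have h1 := cP_deg hv _ _ (right_ne_zero_of_mul hk)
    have h2 := hd _ _ (right_ne_zero_of_mul hl)
    have h3 := cP_deg hv _ _ (left_ne_zero_of_mul hl)
    change F.deg i.1 = F.deg j.1 + 1
    omega
  · have h1 : (cancel hv).d * (F.cg a b v * h * F.cf a b v) = F.cg a b v * (F.d * h) * F.cf a b v := by
      rw [← Matrix.mul_assoc, ← Matrix.mul_assoc, ← cancel_gd, Matrix.mul_assoc (F.cg a b v)]
    have h2 : F.cg a b v * h * F.cf a b v * (cancel hv).d = F.cg a b v * (h * F.d) * F.cf a b v := by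
      rw [Matrix.mul_assoc _ (F.cf a b v), ← cancel_df]; simp only [Matrix.mul_assoc]
    have h3 : F.cg a b v * (F.d * h) * F.cf a b v + F.cg a b v * (h * F.d) * F.cf a b v = y • 1 := by
      rw [← Matrix.add_mul, ← Matrix.mul_add, he, Matrix.mul_smul, Matrix.smul_mul, Matrix.mul_one, cgf hv]
    exact (congrArg₂ (· + ·) h1 h2).trans h3

variable {N : Type} [AddCommGroup N] [Module R N]

lemma cf_supp (hv : v * F.d a b = 1) {j : ℕ} {z : F.cι a b → N} (hz : z ∈ (cancel hv).supp N j) :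
    mact N (F.cf a b v) z ∈ F.supp N j := by
  intro i hi
  rw [mact_apply]
  refine Finset.sum_eq_zero fun k _ => ?_
  by_cases h : F.cf a b v i k = 0
  · rw [h, zero_smul]
  · have := cP_deg hv _ _ h
    rw [hz k (fun h => hi (this.trans h)), smul_zero]

lemma cg_supp (hv : v * F.d a b = 1) {j : ℕ} {z : F.ι → N} (hz : z ∈ F.supp N j) :
    mact N (F.cg a b v) z ∈ (cancel hv).supp N j := by
  intro i hi
  rw [mact_apply]
  refine Finset.sum_eq_zero fun k _ => ?_
  by_cases h : F.cg a b v i k = 0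
  · rw [h, zero_smul]
  · have := cP_deg hv _ _ h
    rw [hz k (fun h => hi (this.trans h)), smul_zero]

lemma D_cf (z : F.cι a b → N) : F.D N (mact N (F.cf a b v) z) = mact N (F.cf a b v) ((cancel hv).D N z) := by
  rw [← mact_mul, cancel_df (hv := hv)]; exact mact_mul _ _ _

lemma D_cg (z : F.ι → N) : (cancel hv).D N (mact N (F.cg a b v) z) = mact N (F.cg a b v) (F.D N z) := by
  rw [← mact_mul, ← cancel_gd (hv := hv)]; exact mact_mul _ _ _

lemma cf_Bd {j : ℕ} {z : F.cι a b → N} : mact N (F.cf a b v) z ∈ F.Bd N j ↔ z ∈ (cancel hv).Bd N j := by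
  constructor
  · rintro ⟨w, hw, hw'⟩
    refine ⟨mact N (F.cg a b v) w, cg_supp hv hw, ?_⟩
    rw [D_cg, hw', ← mact_mul, cgf hv, mact_one]
  · rintro ⟨w, hw, rfl⟩
    exact ⟨_, cf_supp hv hw, D_cf w⟩

/-- in degree zero every class comes from the cancelled complex -/
lemma cg_Bd_zero {z : F.ι → N} (hz : z ∈ F.supp N 0) (h : mact N (F.cg a b v) z ∈ (cancel hv).Bd N 0) :
    z ∈ F.Bd N 0 := by
  rw [← cf_Bd, ← mact_mul, cfg hv, cP, mact_sub, mact_sub, mact_mul _ F.d, F.D_supp_zero hz, map_zero, sub_zero,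
    mact_one, mact_mul] at h
  have h2 : F.D N (mact N (F.cE a b v) z) ∈ F.Bd N 0 := by
    refine ⟨_, F.h_supp ?_ hz, rfl⟩
    intro i j hij
    rw [cE_apply] at hij
    have : b = i ∧ a = j := by by_contra hc; exact hij (if_neg hc)
    rw [← this.1, ← this.2]; exact cE_ne hv
  have := add_mem h h2
  rwa [sub_add_cancel] at this

end cancel

/-- The local contradiction. -/
lemma local_contra [IsLocalRing R] [IsNoetherianRing R] {N : Type} [AddCommGroup N] [Module R N] [Module.Finite R N]
    (p : Ideal R) [hp : p.IsPrime] (hn : ∃ n : N, n ≠ 0 ∧ ∀ r ∈ p, r • n = 0)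
    (x : R) (hx : x ∈ maximalIdeal R) (c : ℕ) :
    ∀ (F : FC R) (_ : Fintype.card F.ι ≤ c) (_ : ∀ y ∈ maximalIdeal R, ∃ M : ℕ, y ^ M ∈ F.nullIdeal ⊔ p)
      (_ : ∀ j, 0 < j → ∀ z ∈ F.supp N j, F.D N z = 0 → z ∈ F.Bd N j)
      (_ : ∀ z ∈ F.supp N 0, x • z ∈ F.Bd N 0 → z ∈ F.Bd N 0)
      (_ : ∃ z ∈ F.supp N 0, z ∉ F.Bd N 0), False := by
  induction c with
  | zero =>
    rintro F hc - - - ⟨z, -, hz⟩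
    haveI : IsEmpty F.ι := Fintype.card_eq_zero_iff.1 (Nat.le_zero.1 hc)
    apply hz
    rw [Subsingleton.elim z 0]; exact zero_mem _
  | succ c ih =>
    intro F hc hnull hex hreg hne
    by_cases hmin : ∀ i j, F.d i j ∈ maximalIdeal R
    · obtain ⟨z, hz, hzB⟩ := hne
      obtain ⟨a, ha⟩ : ∃ a, F.deg a = 0 := by
        by_contra hcon
        push Not at hcon
        apply hzB
        have : z = 0 := funext fun i => hz i (hcon i)
        rw [this]; exact zero_mem _
      obtain ⟨t, -, ht⟩ := Finset.exists_max_image Finset.univ F.deg ⟨a, Finset.mem_univ a⟩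
      haveI : IsLocalRing (R ⧸ p) := IsLocalRing.of_surjective' _ Ideal.Quotient.mk_surjective
      have hs : ∀ i, F.deg i ≤ F.deg t := fun i => ht i (Finset.mem_univ i)
      have hdim : ringKrullDim (R ⧸ p) ≤ F.deg t := by
        refine nit (F.map (Ideal.Quotient.mk p)) (F.deg t) hs ?_ a ha ?_
        · intro y hy
          obtain ⟨y, rfl⟩ := Ideal.Quotient.mk_surjective y
          have hy' : y ∈ maximalIdeal R := by
            rw [mem_maximalIdeal, mem_nonunits_iff] at hy ⊢
            exact fun h => hy (h.map _)
          obtain ⟨M, hM⟩ := hnull y hy'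
          obtain ⟨y1, hy1, y2, hy2, h12⟩ := Submodule.mem_sup.1 hM
          refine ⟨M, ?_⟩
          rw [← map_pow, ← h12, map_add, Ideal.Quotient.eq_zero_iff_mem.2 hy2, add_zero]
          exact NullHtp.map _ hy1
        · intro j
          have hl : IsLocalHom (Ideal.Quotient.mk p) := IsLocalHom.of_surjective _ Ideal.Quotient.mk_surjective
          have h := hmin a j
          rw [mem_maximalIdeal, mem_nonunits_iff] at h ⊢
          exact fun h' => h (isUnit_of_map_unit (Ideal.Quotient.mk p) _ h')
      obtain ⟨w, hw, -, hwB, hsoc⟩ := F.core hmin (F.deg t) hs t rfl (F.deg t) 0 N p hn hdim (by omega)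
        (fun j hj => hex j hj)
      exact hwB (hreg w hw (hsoc x hx))
    · push Not at hmin
      obtain ⟨a, b, hab⟩ := hmin
      rw [mem_maximalIdeal, mem_nonunits_iff, not_not] at hab
      obtain ⟨v, hv⟩ := hab.exists_left_inv
      refine ih (cancel hv) ?_ ?_ ?_ ?_ ?_
      · have : Fintype.card (F.cι a b) < Fintype.card F.ι :=
          Fintype.card_subtype_lt (x := a) (fun h => h.1 rfl)
        change Fintype.card (F.cι a b) ≤ c
        omega
      · intro y hy
        obtain ⟨M, hM⟩ := hnull y hy
        exact ⟨M, sup_le_sup_right (fun y hy => cancel_null hy : F.nullIdeal ≤ (cancel hv).nullIdeal) p hM⟩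
      · intro j hj z hz hDz
        refine cf_Bd.1 (hex j hj _ (cf_supp hv hz) ?_)
        rw [D_cf (hv := hv), hDz, map_zero]
      · intro z hz hxz
        refine cf_Bd.1 (hreg _ (cf_supp hv hz) ?_)
        rw [← map_smul]; exact cf_Bd.2 hxz
      · obtain ⟨z, hz, hzB⟩ := hne
        exact ⟨_, cg_supp hv hz, fun h => hzB (cg_Bd_zero hz h)⟩

end FC
end NIT

-- Part 20

namespace NIT
open IsLocalRing

namespace FC
variable {A : Type} [CommRing A]

/-- `F ⊗ N` resolves `Y`. -/
structure Res (F : FC A) (N Y : Type) [AddCommGroup N] [Module A N] [AddCommGroup Y] [Module A Y] where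
  e : F.ι → (N →ₗ[A] Y)
  exact : ∀ j, 0 < j → ∀ z ∈ F.supp N j, F.D N z = 0 → z ∈ F.Bd N j
  surj : ∀ y, ∃ z ∈ F.supp N 0, ∑ i, e i (z i) = y
  ker : ∀ z ∈ F.supp N 0, ∑ i, e i (z i) = 0 → z ∈ F.Bd N 0
  bd : ∀ z ∈ F.Bd N 0, ∑ i, e i (z i) = 0

variable {F : FC A} {N Y : Type} [AddCommGroup N] [Module A N] [AddCommGroup Y] [Module A Y]

/-- the augmentation -/
def Res.eps (r : Res F N Y) : (F.ι → N) →ₗ[A] Y := ∑ i, r.e i ∘ₗ LinearMap.proj i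

lemma Res.eps_apply (r : Res F N Y) (z : F.ι → N) : r.eps z = ∑ i, r.e i (z i) := by
  simp [Res.eps]

lemma Res.ker' (r : Res F N Y) {z : F.ι → N} (hz : z ∈ F.supp N 0) (h : r.eps z = 0) : z ∈ F.Bd N 0 :=
  r.ker z hz (by rw [← r.eps_apply, h])
lemma Res.bd' (r : Res F N Y) {z : F.ι → N} (hz : z ∈ F.Bd N 0) : r.eps z = 0 := by
  rw [r.eps_apply, r.bd z hz]
lemma Res.surj' (r : Res F N Y) (y : Y) : ∃ z ∈ F.supp N 0, r.eps z = y := by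
  obtain ⟨z, hz, h⟩ := r.surj y; exact ⟨z, hz, by rw [r.eps_apply, h]⟩

lemma Res.quot_eps (r : Res F N Y) (x : A) (z : F.ι → N) :
    ∑ i, QuotSMulTop.map x (r.e i) (qm x N (z i)) = qm x Y (r.eps z) := by
  rw [r.eps_apply, map_sum]; rfl

/-- reduction modulo a regular element -/
def Res.quot (r : Res F N Y) {x : A} (hN : IsSMulRegular N x) (hY : IsSMulRegular Y x) :
    Res F (QuotSMulTop x N) (QuotSMulTop x Y) where
  e i := QuotSMulTop.map x (r.e i)
  exact := by
    rintro j hj z' hz' hD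
    obtain ⟨j, rfl⟩ := Nat.exists_eq_add_of_lt hj
    rw [zero_add] at hz' ⊢
    obtain ⟨z, hz, rfl⟩ := F.lift_supp (qm x N) (qm_surj x) hz'
    obtain ⟨u, hu, hzu, hDu⟩ := F.cycle_mod hN hz hD
    have huB : u ∈ F.Bd N j := by
      rcases Nat.eq_zero_or_pos j with rfl | hj
      · refine r.ker' hu (hY ?_)
        change x • _ = x • _
        rw [smul_zero, ← map_smul, ← hzu]
        exact r.bd' ⟨z, hz, rfl⟩
      · exact r.exact j hj u hu hDu
    obtain ⟨w, hw, rfl⟩ := huB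
    have h1 : z - x • w ∈ F.Bd N (j+1) := by
      refine r.exact _ (Nat.succ_pos j) _ (sub_mem hz (Submodule.smul_mem _ _ hw)) ?_
      rw [map_sub, map_smul, hzu, sub_self]
    have h2 : (fun i => qm x N (z i)) = fun i => qm x N ((z - x • w) i) := by
      funext i
      rw [eq_comm, ← sub_eq_zero, ← map_sub]
      exact qm_eq_zero.2 ⟨- w i, by simp⟩
    rw [h2]; exact F.Bd_map _ h1
  surj y' := by
    obtain ⟨y, rfl⟩ := qm_surj x y'
    obtain ⟨z, hz, rfl⟩ := r.surj' y
    exact ⟨_, F.supp_map (qm x N) hz, r.quot_eps x z⟩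
  ker z' hz' h := by
    obtain ⟨z, hz, rfl⟩ := F.lift_supp (qm x N) (qm_surj x) hz'
    rw [r.quot_eps] at h
    obtain ⟨y, hy⟩ := qm_eq_zero.1 h
    obtain ⟨w, hw, rfl⟩ := r.surj' y
    have h1 : z - x • w ∈ F.Bd N 0 := by
      refine r.ker' (sub_mem hz (Submodule.smul_mem _ _ hw)) ?_
      rw [map_sub, map_smul, hy, sub_self]
    have h2 : (fun i => qm x N (z i)) = fun i => qm x N ((z - x • w) i) := by
      funext i
      rw [eq_comm, ← sub_eq_zero, ← map_sub]
      exact qm_eq_zero.2 ⟨- w i, by simp⟩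
    rw [h2]; exact F.Bd_map _ h1
  bd z' hz' := by
    obtain ⟨w', hw', rfl⟩ := hz'
    obtain ⟨w, hw, rfl⟩ := F.lift_supp (qm x N) (qm_surj x) hw'
    rw [D, mact_comp, r.quot_eps, r.bd' ⟨w, hw, rfl⟩, map_zero]

lemma null_bd {y : A} (hy : F.NullHtp y) {z : F.ι → N} (hz : z ∈ F.supp N 0) : y • z ∈ F.Bd N 0 := by
  obtain ⟨h, hd, he⟩ := hy
  refine ⟨_, F.h_supp hd hz, ?_⟩
  have := congrArg (fun M => mact N M z) he
  simp only [mact_add, mact_mul, mact_smul_one] at this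
  rw [F.D_supp_zero hz, map_zero, add_zero] at this
  exact this

lemma Res.null_smul (r : Res F N Y) {a : A} (ha : F.NullHtp a) (y : Y) : a • y = 0 := by
  obtain ⟨z, hz, rfl⟩ := r.surj' y
  rw [← map_smul]; exact r.bd' (null_bd ha hz)

section loc
variable (S : Submonoid A) {R : Type} [CommRing R] [Algebra A R] [IsLocalization S R]
  {N' : Type} [AddCommGroup N'] [Module A N'] [Module R N'] [IsScalarTower A R N'] (f : N →ₗ[A] N')

variable (F) in
/-- the localization map on vectors -/
def lg : (F.ι → N) →ₗ[A] (F.ι → N') := LinearMap.pi fun i => f ∘ₗ LinearMap.proj i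

lemma lg_D (z : F.ι → N) : (F.map (algebraMap A R)).D N' (F.lg f z) = F.lg f (F.D N z) := by
  refine funext fun (i : F.ι) => ?_
  refine (mact_apply _ _ _).trans ?_
  change ∑ j : F.ι, algebraMap A R (F.d i j) • f (z j) = f (mact N F.d z i)
  rw [mact_apply, map_sum]
  simp [algebraMap_smul]

lemma lg_supp {j : ℕ} {z : F.ι → N} (hz : z ∈ F.supp N j) : F.lg f z ∈ (F.map (algebraMap A R)).supp N' j := by
  intro i hi
  change f (z i) = 0
  rw [hz i hi, map_zero]

lemma lg_Bd {j : ℕ} {z : F.ι → N} (hz : z ∈ F.Bd N j) : F.lg f z ∈ (F.map (algebraMap A R)).Bd N' j := by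
  obtain ⟨w, hw, rfl⟩ := hz
  exact ⟨F.lg f w, lg_supp f hw, lg_D f w⟩

variable [IsLocalizedModule S f]

lemma lg_surj {j : ℕ} {z' : F.ι → N'} (hz : z' ∈ (F.map (algebraMap A R)).supp N' j) :
    ∃ s : S, ∃ z ∈ F.supp N j, (s : A) • z' = F.lg f z := by
  classical
  haveI : IsLocalizedModule S (F.lg f) := IsLocalizedModule.pi S (fun _ : F.ι => f)
  obtain ⟨⟨z, s⟩, h⟩ := IsLocalizedModule.surj S (F.lg f) z'
  refine ⟨s, fun i => if F.deg i = j then z i else 0, fun i hi => if_neg hi, ?_⟩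
  funext i
  have h' : (s : A) • z' i = f (z i) := congrFun h i
  change (s : A) • z' i = f (if F.deg i = j then z i else 0)
  split_ifs with hi
  · exact h'
  · have : z' i = 0 := hz i hi
    rw [this, smul_zero, map_zero]

lemma lg_zero {z : F.ι → N} (h : F.lg f z = 0) : ∃ s : S, (s : A) • z = 0 := by
  haveI : IsLocalizedModule S (F.lg f) := IsLocalizedModule.pi S (fun _ : F.ι => f)
  exact (IsLocalizedModule.eq_zero_iff S (F.lg f)).1 h

lemma Bd_unit (s : S) {j : ℕ} {z' : F.ι → N'} (h : (s : A) • z' ∈ (F.map (algebraMap A R)).Bd N' j) :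
    z' ∈ (F.map (algebraMap A R)).Bd N' j := by
  refine (Submodule.smul_mem_iff_of_isUnit _ (IsLocalization.map_units R s)).1 ?_
  have : (algebraMap A R (s : A)) • z' = (s : A) • z' := by
    funext i; exact algebraMap_smul R (s : A) (z' i)
  exact this ▸ h

lemma Bd_smul (s : A) {j : ℕ} {z' : F.ι → N'} (h : z' ∈ (F.map (algebraMap A R)).Bd N' j) :
    s • z' ∈ (F.map (algebraMap A R)).Bd N' j := by
  have : (algebraMap A R (s : A)) • z' = (s : A) • z' := by
    funext i; exact algebraMap_smul R (s : A) (z' i)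
  rw [← this]
  exact Submodule.smul_mem _ _ h

lemma lg_Bd_iff {j : ℕ} {z : F.ι → N} (h : F.lg f z ∈ (F.map (algebraMap A R)).Bd N' j) :
    ∃ s : S, (s : A) • z ∈ F.Bd N j := by
  obtain ⟨w', hw', hw⟩ := h
  obtain ⟨s, w, hws, hs⟩ := lg_surj S f hw'
  have h1 : F.lg f ((s : A) • z - F.D N w) = 0 := by
    have h2 : (F.map (algebraMap A R)).D N' ((algebraMap A R (s : A)) • w') = (algebraMap A R (s : A)) • F.lg f z := by
      rw [map_smul, hw]; rfl
    have h3 : (algebraMap A R (s : A)) • w' = (s : A) • w' := by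
      funext i; exact algebraMap_smul R (s : A) (w' i)
    have h4 : (algebraMap A R (s : A)) • F.lg f z = (s : A) • F.lg f z := by
      funext i; exact algebraMap_smul R (s : A) (F.lg f z i)
    rw [h4] at h2
    have h5 : (F.map (algebraMap A R)).D N' ((algebraMap A R (s : A)) • w') = F.lg f (F.D N w) := by
      rw [← lg_D (R := R), ← hs, h3]; rfl
    rw [map_sub, map_smul, ← h2, h5, sub_self]
  obtain ⟨t, ht⟩ := lg_zero S f h1
  refine ⟨t * s, (t : A) • w, Submodule.smul_mem _ _ hws, ?_⟩
  rw [smul_sub, sub_eq_zero] at ht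
  rw [map_smul, ← ht, Submonoid.coe_mul, mul_smul]

end loc

/-- Regularity transfers from `Y` to `N` for one element. -/
lemma Res.regular [IsLocalRing A] [IsNoetherianRing A] [Module.Finite A N] [Nontrivial Y]
    (r : Res F N Y) (hs : ∀ q : PrimeSpectrum A, F.nullIdeal ≤ q.asIdeal → Module.annihilator A N ≤ q.asIdeal →
      q ∈ Module.support A Y) {x : A} (hY : IsSMulRegular Y x) : IsSMulRegular N x := by
  by_contra hx
  have hx' : x ∈ ⋃ p ∈ associatedPrimes A N, (p : Set A) := by
    rw [biUnion_associatedPrimes_eq_compl_regular]; exact hx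
  simp only [Set.mem_iUnion] at hx'
  obtain ⟨p, hpa, hxp⟩ := hx'
  have hp : p.IsPrime := hpa.isPrime
  obtain ⟨n, hn0, hn⟩ := ass_elt hpa
  have hJ : F.nullIdeal ⊔ p ≤ maximalIdeal A := by
    refine sup_le (fun y hy => ?_) (le_maximalIdeal hp.ne_top)
    by_contra hcon
    have hu : IsUnit y := by
      by_contra h; exact hcon ((mem_maximalIdeal y).2 h)
    obtain ⟨v, hv⟩ := exists_ne (0 : Y)
    apply hv
    obtain ⟨w, hw⟩ := hu.exists_left_inv
    rw [← one_smul A v, ← hw, mul_smul, r.null_smul hy, smul_zero]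
  obtain ⟨q, hq, hqm⟩ := Ideal.exists_minimalPrimes_le hJ
  have hqp : q.IsPrime := hq.1.1
  have hnq : F.nullIdeal ≤ q := le_sup_left.trans hq.1.2
  have hpq : p ≤ q := le_sup_right.trans hq.1.2
  have hqs : (⟨q, hqp⟩ : PrimeSpectrum A) ∈ Module.support A Y := by
    refine hs _ hnq (fun a ha => hpq ((hn a).2 ?_))
    exact Module.mem_annihilator.1 ha n
  let S := q.primeCompl
  let R := Localization.AtPrime q
  let N' := LocalizedModule S N
  let f : N →ₗ[A] N' := LocalizedModule.mkLinearMap S N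
  haveI : IsNoetherianRing R := IsLocalization.isNoetherianRing S R inferInstance
  haveI : Module.Finite R N' := Module.Finite.of_isLocalizedModule S f
  have hpp : (p.map (algebraMap A R)).IsPrime := by
    refine IsLocalization.isPrime_of_isPrime_disjoint S R p hp ?_
    rw [Set.disjoint_left]
    exact fun a ha hap => ha (hpq hap)
  refine local_contra (N := N') (p.map (algebraMap A R)) ⟨f n, ?_, ?_⟩ (algebraMap A R x) ?_ _
    (F.map (algebraMap A R)) le_rfl ?_ ?_ ?_ ?_
  · intro h
    obtain ⟨s, hs⟩ := (IsLocalizedModule.eq_zero_iff S f).1 h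
    exact s.2 (hpq ((hn s).2 hs))
  · have : p.map (algebraMap A R) ≤ LinearMap.ker (LinearMap.toSpanSingleton R N' (f n)) := by
      rw [Ideal.map_le_iff_le_comap]
      intro a ha
      change algebraMap A R a • f n = 0
      rw [algebraMap_smul, ← map_smul, (hn a).1 ha, map_zero]
    exact fun a ha => this ha
  · rw [← Localization.AtPrime.map_eq_maximalIdeal]
    exact Ideal.mem_map_of_mem _ (hpq hxp)
  · intro y hy
    have h1 : (F.nullIdeal ⊔ p).map (algebraMap A R) ≤ (F.map (algebraMap A R)).nullIdeal ⊔ p.map (algebraMap A R) := by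
      rw [Ideal.map_sup]
      refine sup_le_sup_right ?_ _
      rw [Ideal.map_le_iff_le_comap]
      exact fun a ha => NullHtp.map _ ha
    have h2 : maximalIdeal R ≤ ((F.nullIdeal ⊔ p).map (algebraMap A R)).radical := by
      rw [Ideal.radical_eq_sInf]
      refine le_sInf fun Q hQ => ?_
      have hQp : Q.IsPrime := hQ.2
      have h3 : Q.comap (algebraMap A R) ≤ q := by
        have := Ideal.comap_mono (f := algebraMap A R) (le_maximalIdeal hQp.ne_top)
        refine this.trans (le_of_eq ?_)
        exact Localization.AtPrime.comap_maximalIdeal (I := q)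
      have h4 : q ≤ Q.comap (algebraMap A R) :=
        hq.2 ⟨Ideal.comap_isPrime _ Q, Ideal.map_le_iff_le_comap.1 hQ.1⟩ h3
      rw [← Ideal.map_le_iff_le_comap] at h4
      rwa [Localization.AtPrime.map_eq_maximalIdeal] at h4
    obtain ⟨M, hM⟩ := h2 hy
    exact ⟨M, h1 hM⟩
  · intro j hj z' hz' hD
    obtain ⟨s, z, hz, hs⟩ := lg_surj S f hz'
    have h1 : F.lg f (F.D N z) = 0 := by
      rw [← lg_D (R := R), ← hs]
      have h3 : (s : A) • z' = (algebraMap A R (s : A)) • z' := by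
        funext i; exact (algebraMap_smul R (s : A) (z' i)).symm
      refine (congrArg ((F.map (algebraMap A R)).D N') h3).trans ?_
      refine (map_smul ((F.map (algebraMap A R)).D N') _ _).trans ?_
      rw [hD, smul_zero]; rfl
    obtain ⟨t, ht⟩ := lg_zero S f h1
    have h2 : (t : A) • z ∈ F.Bd N j := r.exact j hj _ (Submodule.smul_mem _ _ hz) (by rw [map_smul, ht])
    have h3 := lg_Bd (R := R) f h2
    rw [map_smul, ← hs] at h3
    exact Bd_unit S s (Bd_unit S t h3)
  · intro z' hz' hx
    obtain ⟨s, z, hz, hs⟩ := lg_surj S f hz'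
    have h1 : F.lg f (x • z) ∈ (F.map (algebraMap A R)).Bd N' 0 := by
      have h3 : F.lg f (x • z) = (s : A) • ((algebraMap A R x) • z' : F.ι → N') := by
        rw [map_smul, ← hs]
        funext i
        change x • (s : A) • z' i = (s : A) • (algebraMap A R x) • z' i
        rw [algebraMap_smul, smul_comm]
      rw [h3]
      exact Bd_smul _ hx
    obtain ⟨t, ht⟩ := lg_Bd_iff S f h1
    have h2 : (t : A) • z ∈ F.Bd N 0 := by
      refine r.ker' (Submodule.smul_mem _ _ hz) (hY ?_)
      change x • _ = x • _
      rw [smul_zero, ← map_smul, smul_comm]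
      exact r.bd' ht
    have h3 := lg_Bd (R := R) f h2
    rw [map_smul, ← hs] at h3
    exact Bd_unit S s (Bd_unit S t h3)
  · obtain ⟨y, hy⟩ := Module.mem_support_iff_exists_annihilator.1 hqs
    obtain ⟨z, hz, rfl⟩ := r.surj' y
    refine ⟨F.lg f z, lg_supp f hz, fun h => ?_⟩
    obtain ⟨s, hs⟩ := lg_Bd_iff S f h
    refine s.2 (hy ?_)
    rw [Submodule.mem_annihilator_span_singleton, ← map_smul]
    exact r.bd' hs

/-- Regularity transfers from `Y` to `N` for sequences. -/
lemma Res.weaklyRegular [IsLocalRing A] [IsNoetherianRing A] (F : FC A) (rs : List A)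
    (hrs : ∀ x ∈ rs, x ∈ maximalIdeal A) :
    ∀ (N Y : Type) [AddCommGroup N] [Module A N] [AddCommGroup Y] [Module A Y]
      [Module.Finite A N] [Module.Finite A Y] [Nontrivial Y] (_ : Res F N Y)
      (_ : ∀ q : PrimeSpectrum A, F.nullIdeal ≤ q.asIdeal → Module.annihilator A N ≤ q.asIdeal →
        q ∈ Module.support A Y) (_ : RingTheory.Sequence.IsWeaklyRegular Y rs),
      RingTheory.Sequence.IsWeaklyRegular N rs := by
  induction rs with
  | nil => intros; exact RingTheory.Sequence.IsWeaklyRegular.nil _ _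
  | cons x rs ih =>
    intro N Y _ _ _ _ _ _ _ r hs hreg
    rw [RingTheory.Sequence.isWeaklyRegular_cons_iff] at hreg ⊢
    have hN := r.regular hs hreg.1
    have hxm := hrs x (by simp)
    haveI : Nontrivial (QuotSMulTop x Y) := by
      refine Submodule.Quotient.nontrivial_iff.2 (Ne.symm ?_)
      refine Submodule.top_ne_pointwise_smul_of_mem_jacobson_annihilator ?_
      exact Ideal.mem_sInf.2 fun {J} hJ => by rw [eq_maximalIdeal hJ.2]; exact hxm
    refine ⟨hN, ih (fun y hy => hrs y (by simp [hy])) _ _ (r.quot hN hreg.1) ?_ hreg.2⟩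
    intro q hq1 hq2
    rw [Module.support_quotSMulTop]
    refine ⟨hs q hq1 (le_trans ?_ hq2), ?_⟩
    · exact LinearMap.annihilator_le_of_surjective (qm x N) (qm_surj x)
    · rw [PrimeSpectrum.mem_zeroLocus, Set.singleton_subset_iff]
      exact hq2 (QuotSMulTop.mem_annihilator _ x)

end FC
end NIT

-- Part 21

namespace NIT
open IsLocalRing

/-- A projective resolution, unbundled. -/
structure PRes (A C : Type) [CommRing A] [AddCommGroup C] [Module A C] where
  P : ℕ → Type
  [acg : ∀ i, AddCommGroup (P i)]
  [mod : ∀ i, Module A (P i)]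
  proj : ∀ i, Module.Projective A (P i)
  d : ∀ i, P (i+1) →ₗ[A] P i
  η : P 0 →ₗ[A] C
  surj : Function.Surjective η
  exact0 : Function.Exact (d 0) η
  exact : ∀ i, Function.Exact (d (i+1)) (d i)

attribute [instance] PRes.acg PRes.mod PRes.proj

/-- the resolution supplied by Mathlib -/
noncomputable def PRes.of {A C : Type} [CommRing A] [AddCommGroup C] [Module A C]
    (Q : ProjectiveResolution (ModuleCat.of A C)) : PRes A C where
  P i := Q.complex.X i
  proj i := (IsProjective.iff_projective _).2 (Q.projective i)
  d i := (Q.complex.d (i+1) i).hom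
  η := (Q.π.f 0).hom
  surj := (ModuleCat.epi_iff_surjective _).1 inferInstance
  exact0 := (ShortComplex.ShortExact.moduleCat_exact_iff_function_exact _).1 Q.exact₀
  exact i := (ShortComplex.ShortExact.moduleCat_exact_iff_function_exact _).1 (Q.exact_succ i)

variable {A C : Type} [CommRing A] [AddCommGroup C] [Module A C]

/-- vanishing of the positive Ext groups -/
def PRes.Acyc (Q : PRes A C) (N : Type) [AddCommGroup N] [Module A N] : Prop :=
  ∀ i (f : Q.P (i+1) →ₗ[A] N), f ∘ₗ Q.d (i+1) = 0 → ∃ g : Q.P i →ₗ[A] N, g ∘ₗ Q.d i = f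

lemma acyc_of_ext (Q : ProjectiveResolution (ModuleCat.of A C)) (N : Type) [AddCommGroup N] [Module A N]
    (h : ∀ i : ℕ, 0 < i → Subsingleton (((Ext A (ModuleCat A) i).obj (op (ModuleCat.of A C))).obj (ModuleCat.of A N))) :
    (PRes.of Q).Acyc N := by
  intro i f hf
  have h1 := h (i+1) (Nat.succ_pos i)
  have h2 : Limits.IsZero ((Q.complex.linearYonedaObj A (ModuleCat.of A N)).homology (i+1)) := by
    refine Limits.IsZero.of_iso ?_ (Q.isoExt (R := A) (i+1) (ModuleCat.of A N)).symm
    exact ModuleCat.isZero_of_subsingleton _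
  rw [← HomologicalComplex.exactAt_iff_isZero_homology,
    HomologicalComplex.exactAt_iff' _ i (i+1) (i+2) (by simp) (by simp),
    ShortComplex.moduleCat_exact_iff] at h2
  obtain ⟨g, hg⟩ := h2 (ModuleCat.ofHom f) (ModuleCat.hom_ext hf)
  exact ⟨g.hom, congrArg ModuleCat.Hom.hom hg⟩

end NIT

-- Part 22

namespace NIT
open IsLocalRing FC

lemma descend {A P M N : Type} [CommRing A] [AddCommGroup P] [Module A P] [AddCommGroup M] [Module A M]
    [AddCommGroup N] [Module A N] (η : P →ₗ[A] M) (hη : Function.Surjective η) (g : P →ₗ[A] N)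
    (h : ∀ x, η x = 0 → g x = 0) : ∃ ψ : M →ₗ[A] N, ψ ∘ₗ η = g := by
  refine ⟨(LinearMap.ker η).liftQ g (fun x hx => h x hx) ∘ₗ (η.quotKerEquivOfSurjective hη).symm.toLinearMap, ?_⟩
  ext x
  have : (η.quotKerEquivOfSurjective hη).symm (η x) = (LinearMap.ker η).mkQ x := by
    rw [LinearEquiv.symm_apply_eq]; rfl
  simp only [LinearMap.comp_apply, LinearEquiv.coe_coe, this]; rfl

lemma lift_inj {A P M N : Type} [CommRing A] [AddCommGroup P] [Module A P] [AddCommGroup M] [Module A M]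
    [AddCommGroup N] [Module A N] (i : M →ₗ[A] N) (hi : Function.Injective i) (g : P →ₗ[A] N)
    (h : ∀ x, ∃ y, i y = g x) : ∃ k : P →ₗ[A] M, i ∘ₗ k = g := by
  refine ⟨(LinearEquiv.ofInjective i hi).symm.toLinearMap ∘ₗ g.codRestrict (LinearMap.range i) h, ?_⟩
  ext x
  have := (LinearEquiv.ofInjective i hi).apply_symm_apply ⟨g x, h x⟩
  exact congrArg Subtype.val this

namespace PRes
variable {A C : Type} [CommRing A] [AddCommGroup C] [Module A C] (Q : PRes A C)

lemma dd (i : ℕ) : Q.d i ∘ₗ Q.d (i+1) = 0 := LinearMap.ext fun x => (Q.exact i).apply_apply_eq_zero x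
lemma ηd : Q.η ∘ₗ Q.d 0 = 0 := LinearMap.ext fun x => Q.exact0.apply_apply_eq_zero x

section ses
variable {N' N N'' : Type} [AddCommGroup N'] [Module A N'] [AddCommGroup N] [Module A N]
  [AddCommGroup N''] [Module A N''] {i : N' →ₗ[A] N} {π : N →ₗ[A] N''}
  (hi : Function.Injective i) (hπ : Function.Surjective π) (hex : Function.Exact i π)
  (hN' : Q.Acyc N')

lemma acyc_corr (hi : Function.Injective i) (hex : Function.Exact i π)
    (hN' : Q.Acyc N') (n : ℕ) (f : Q.P n →ₗ[A] N) (hf : π ∘ₗ f ∘ₗ Q.d n = 0) :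
    ∃ k : Q.P n →ₗ[A] N', (f - i ∘ₗ k) ∘ₗ Q.d n = 0 := by
  obtain ⟨h, hh⟩ := lift_inj i hi (f ∘ₗ Q.d n) (fun x => (hex _).1 (LinearMap.congr_fun hf x))
  have h1 : h ∘ₗ Q.d (n+1) = 0 := by
    have : i ∘ₗ (h ∘ₗ Q.d (n+1)) = 0 := by
      rw [← LinearMap.comp_assoc, hh, LinearMap.comp_assoc, Q.dd, LinearMap.comp_zero]
    ext x
    exact hi (by simpa using LinearMap.congr_fun this x)
  obtain ⟨k, hk⟩ := hN' n h h1
  exact ⟨k, by rw [LinearMap.sub_comp, LinearMap.comp_assoc, hk, hh, sub_self]⟩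

lemma acyc_ses (hi : Function.Injective i) (hπ : Function.Surjective π) (hex : Function.Exact i π)
    (hN' : Q.Acyc N') (hN : Q.Acyc N) : Q.Acyc N'' := by
  intro n f hf
  obtain ⟨f', rfl⟩ := Module.projective_lifting_property π f hπ
  obtain ⟨k, hk⟩ := Q.acyc_corr hi hex hN' (n+1) f' (by rw [← LinearMap.comp_assoc, hf])
  obtain ⟨g, hg⟩ := hN n _ hk
  refine ⟨π ∘ₗ g, ?_⟩
  rw [LinearMap.comp_assoc, hg, LinearMap.comp_sub, ← LinearMap.comp_assoc, hex.linearMap_comp_eq_zero,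
    LinearMap.zero_comp, sub_zero]

lemma hom_surj (hi : Function.Injective i) (hπ : Function.Surjective π) (hex : Function.Exact i π)
    (hN' : Q.Acyc N') (φ : C →ₗ[A] N'') : ∃ ψ : C →ₗ[A] N, π ∘ₗ ψ = φ := by
  obtain ⟨g, hg⟩ := Module.projective_lifting_property π (φ ∘ₗ Q.η) hπ
  obtain ⟨k, hk⟩ := Q.acyc_corr hi hex hN' 0 g (by
    rw [← LinearMap.comp_assoc, hg, LinearMap.comp_assoc, Q.ηd, LinearMap.comp_zero])
  obtain ⟨ψ, hψ⟩ := descend Q.η Q.surj (g - i ∘ₗ k) (fun x hx => by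
    obtain ⟨w, rfl⟩ := (Q.exact0 x).1 hx
    exact LinearMap.congr_fun hk w)
  refine ⟨ψ, ?_⟩
  rw [← LinearMap.cancel_right Q.surj, LinearMap.comp_assoc, hψ, LinearMap.comp_sub, ← LinearMap.comp_assoc,
    hex.linearMap_comp_eq_zero, LinearMap.zero_comp, sub_zero, hg]

end ses

lemma acyc_quot {N : Type} [AddCommGroup N] [Module A N] (hN : Q.Acyc N) {x : A} (hx : IsSMulRegular N x) :
    Q.Acyc (QuotSMulTop x N) ∧ ∀ φ : C →ₗ[A] QuotSMulTop x N, ∃ ψ : C →ₗ[A] N, qm x N ∘ₗ ψ = φ := by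
  have hex : Function.Exact (LinearMap.lsmul A N x) (qm x N) := fun n => qm_eq_zero
  exact ⟨Q.acyc_ses (i := LinearMap.lsmul A N x) hx (qm_surj x) hex hN hN,
    Q.hom_surj (i := LinearMap.lsmul A N x) hx (qm_surj x) hex hN⟩

lemma hom_quot {N : Type} [AddCommGroup N] [Module A N] (hN : Q.Acyc N) {x : A} (hx : IsSMulRegular N x) :
    Nonempty (QuotSMulTop x (C →ₗ[A] N) ≃ₗ[A] (C →ₗ[A] QuotSMulTop x N)) := by
  let T : (C →ₗ[A] N) →ₗ[A] (C →ₗ[A] QuotSMulTop x N) :=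
    { toFun := fun ψ => qm x N ∘ₗ ψ
      map_add' := fun a b => LinearMap.comp_add _ _ _
      map_smul' := fun a b => LinearMap.comp_smul _ _ _ }
  have hT : Function.Surjective T := (Q.acyc_quot hN hx).2
  refine ⟨(Submodule.quotEquivOfEq _ _ ?_).trans (T.quotKerEquivOfSurjective hT)⟩
  ext ψ
  rw [LinearMap.mem_ker]
  constructor
  · intro h
    have h' : qm x (C →ₗ[A] N) ψ = 0 := (Submodule.Quotient.mk_eq_zero _).2 h
    obtain ⟨u, rfl⟩ := qm_eq_zero.1 h'
    ext c
    exact qm_eq_zero.2 ⟨u c, rfl⟩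
  · intro h
    obtain ⟨k, hk⟩ := lift_inj (LinearMap.lsmul A N x) hx ψ (fun c => qm_eq_zero.1 (LinearMap.congr_fun h c))
    have h' : qm x (C →ₗ[A] N) ψ = 0 := qm_eq_zero.2 ⟨k, by rw [← hk]; rfl⟩
    exact (Submodule.Quotient.mk_eq_zero _).1 h'

lemma hom_regular {N : Type} [AddCommGroup N] [Module A N] {x : A} (hx : IsSMulRegular N x) :
    IsSMulRegular (C →ₗ[A] N) x := by
  intro f g h
  ext c
  exact hx (LinearMap.congr_fun h c)

lemma hom_weaklyRegular (rs : List A) : ∀ (N : Type) [AddCommGroup N] [Module A N] (_ : Q.Acyc N)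
    (_ : RingTheory.Sequence.IsWeaklyRegular N rs), RingTheory.Sequence.IsWeaklyRegular (C →ₗ[A] N) rs := by
  induction rs with
  | nil => intros; exact RingTheory.Sequence.IsWeaklyRegular.nil _ _
  | cons x rs ih =>
    intro N _ _ hN h
    rw [RingTheory.Sequence.isWeaklyRegular_cons_iff] at h ⊢
    refine ⟨hom_regular h.1, ?_⟩
    obtain ⟨e⟩ := Q.hom_quot hN h.1
    rw [e.isWeaklyRegular_congr]
    exact ih _ (Q.acyc_quot hN h.1).1 h.2

/-- over a module with `A = End C`, regular on `C` implies regular on `A` -/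
lemma weaklyRegular_ring (hC : Function.Bijective (algebraMap A (Module.End A C))) (hQ : Q.Acyc C) (rs : List A)
    (h : RingTheory.Sequence.IsWeaklyRegular C rs) : RingTheory.Sequence.IsWeaklyRegular A rs := by
  have h1 := Q.hom_weaklyRegular rs C hQ h
  have e : A ≃ₗ[A] (C →ₗ[A] C) := LinearEquiv.ofBijective (Algebra.linearMap A (Module.End A C)) hC
  rwa [e.isWeaklyRegular_congr]

end PRes
end NIT

-- Part 23

namespace NIT
open IsLocalRing FC

namespace FC
variable {A C : Type} [CommRing A] [AddCommGroup C] [Module A C] (Q : PRes A C) {F : FC A}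

lemma acyc_supp (hQ : Q.Acyc C) (j : ℕ) : Q.Acyc (F.supp C j) := by
  intro n f hf
  have h1 : ∀ i : F.ι, ∃ g : Q.P n →ₗ[A] C, g ∘ₗ Q.d n = LinearMap.proj i ∘ₗ (F.supp C j).subtype ∘ₗ f := by
    intro i
    apply hQ n
    rw [LinearMap.comp_assoc, LinearMap.comp_assoc, hf]; simp
  choose g hg using h1
  classical
  refine ⟨LinearMap.codRestrict (F.supp C j) (LinearMap.pi fun i => if F.deg i = j then g i else 0) ?_, ?_⟩
  · intro c i hi
    simp [hi]
  · ext x i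
    change (if F.deg i = j then g i else 0) (Q.d n x) = (f x).1 i
    split_ifs with h
    · exact LinearMap.congr_fun (hg i) x
    · exact ((f x).2 i h).symm

lemma Bd_le_supp {N : Type} [AddCommGroup N] [Module A N] (j : ℕ) : F.Bd N j ≤ F.supp N j := by
  rintro _ ⟨w, hw, rfl⟩
  exact F.D_supp hw

lemma acyc_step (hQ : Q.Acyc C) (hex : ∀ j, 0 < j → ∀ z ∈ F.supp C j, F.D C z = 0 → z ∈ F.Bd C j) (j : ℕ)
    (h : Q.Acyc (F.Bd C (j+1))) : Q.Acyc (F.Bd C j) ∧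
      ∀ φ : C →ₗ[A] F.Bd C j, ∃ ψ : C →ₗ[A] F.supp C (j+1), ∀ c, F.D C (ψ c) = φ c := by
  let i : F.Bd C (j+1) →ₗ[A] F.supp C (j+1) := Submodule.inclusion (Bd_le_supp (j+1))
  let π : F.supp C (j+1) →ₗ[A] F.Bd C j :=
    LinearMap.codRestrict (F.Bd C j) (F.D C ∘ₗ (F.supp C (j+1)).subtype) (fun z => ⟨z.1, z.2, rfl⟩)
  have hi : Function.Injective i := Submodule.inclusion_injective _
  have hπ : Function.Surjective π := by
    rintro ⟨_, w, hw, rfl⟩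
    exact ⟨⟨w, hw⟩, rfl⟩
  have he : Function.Exact i π := by
    intro z
    constructor
    · intro hz
      exact ⟨⟨z.1, hex (j+1) (Nat.succ_pos j) z.1 z.2 (congrArg Subtype.val hz)⟩, rfl⟩
    · rintro ⟨⟨_, w, hw, rfl⟩, rfl⟩
      exact Subtype.ext (F.D_D C w)
  refine ⟨Q.acyc_ses hi hπ he h (acyc_supp Q hQ _), fun φ => ?_⟩
  obtain ⟨ψ, hψ⟩ := Q.hom_surj hi hπ he h φ
  exact ⟨ψ, fun c => congrArg Subtype.val (LinearMap.congr_fun hψ c)⟩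

lemma acyc_Bd (hQ : Q.Acyc C) (hex : ∀ j, 0 < j → ∀ z ∈ F.supp C j, F.D C z = 0 → z ∈ F.Bd C j) (j : ℕ) :
    Q.Acyc (F.Bd C j) := by
  obtain ⟨s, hs⟩ : ∃ s, ∀ i, F.deg i ≤ s :=
    ⟨Finset.univ.sup F.deg, fun i => Finset.le_sup (Finset.mem_univ i)⟩
  have key : ∀ k j, s ≤ j + k → Q.Acyc (F.Bd C j) := by
    intro k
    induction k with
    | zero =>
      intro j hj n f _
      have h0 : ∀ z : F.Bd C j, z = 0 := by
        rintro ⟨_, w, hw, rfl⟩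
        have : w = 0 := funext fun i => hw i (by have := hs i; omega)
        apply Subtype.ext
        change F.D C w = 0
        rw [this, map_zero]
      exact ⟨0, LinearMap.ext fun x => by rw [h0 (f x)]; simp⟩
    | succ k ih =>
      intro j hj
      exact (acyc_step Q hQ hex j (ih (j+1) (by omega))).1
  exact key s j (by omega)

/-- boundaries over `C` come from boundaries over `A` -/
lemma bd_ring (hC : Function.Bijective (algebraMap A (Module.End A C))) (hQ : Q.Acyc C)
    (hex : ∀ j, 0 < j → ∀ z ∈ F.supp C j, F.D C z = 0 → z ∈ F.Bd C j) (j : ℕ) (z : F.ι → A)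
    (h : ∀ c : C, (fun i => z i • c) ∈ F.Bd C j) : z ∈ F.Bd A j := by
  obtain ⟨ψ, hψ⟩ := (acyc_step Q hQ hex j (acyc_Bd Q hQ hex (j+1))).2
    (LinearMap.codRestrict (F.Bd C j) (LinearMap.pi fun i => algebraMap A (Module.End A C) (z i)) h)
  have h1 : ∀ i : F.ι, ∃ w : A, algebraMap A (Module.End A C) w =
      LinearMap.proj i ∘ₗ (F.supp C (j+1)).subtype ∘ₗ ψ := fun i => hC.2 _
  choose w hw using h1
  have hw' : ∀ i c, w i • c = (ψ c).1 i := fun i c => LinearMap.congr_fun (hw i) c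
  refine ⟨w, fun i hi => hC.1 ?_, funext fun i => hC.1 ?_⟩
  · rw [hw, map_zero]
    ext c
    exact (ψ c).2 i hi
  · ext c
    change (F.D A w i) • c = z i • c
    have h2 : F.D C (ψ c).1 i = z i • c := congrFun (hψ c) i
    rw [← h2, mact_apply, mact_apply, Finset.sum_smul]
    refine Finset.sum_congr rfl fun k _ => ?_
    rw [← hw', smul_smul, smul_eq_mul]

lemma smul_vec_supp {j : ℕ} {z : F.ι → A} (hz : z ∈ F.supp A j) (c : C) : (fun i => z i • c) ∈ F.supp C j := by
  intro i hi
  change z i • c = 0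
  rw [hz i hi, zero_smul]

lemma smul_vec_D (z : F.ι → A) (c : C) : F.D C (fun i => z i • c) = fun i => F.D A z i • c := by
  exact mact_comp (LinearMap.toSpanSingleton A C c) F.d z

/-- constructing null homotopies -/
lemma null_of_exact (hex : ∀ j, 0 < j → ∀ z ∈ F.supp A j, F.D A z = 0 → z ∈ F.Bd A j) (a : A)
    (ha : ∀ z ∈ F.supp A 0, a • z ∈ F.Bd A 0) : F.NullHtp a := by
  classical
  have key : ∀ n, ∃ h : Matrix F.ι F.ι A, (∀ i j, h i j ≠ 0 → F.deg i = F.deg j + 1) ∧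
      ∀ i j, F.deg j < n → (F.d * h + h * F.d) i j = (a • (1 : Matrix F.ι F.ι A)) i j := by
    intro n
    induction n with
    | zero => exact ⟨0, by simp, by simp⟩
    | succ n ih =>
      obtain ⟨h, hd, he⟩ := ih
      let v : F.ι → F.ι → A := fun j i => (a • (1 : Matrix F.ι F.ι A) - h * F.d) i j
      have hv : ∀ j, F.deg j = n → v j ∈ F.Bd A n := by
        intro j hj
        rcases Nat.eq_zero_or_pos n with h0 | hn
        · have h1 : v j = a • Pi.single j (1 : A) := by
            funext i
            have h2 : (h * F.d) i j = 0 := by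
              rw [Matrix.mul_apply]
              refine Finset.sum_eq_zero fun k _ => ?_
              by_cases hk : F.d k j = 0
              · rw [hk, mul_zero]
              · have := F.d_deg k j hk; omega
            simp only [v, Matrix.sub_apply, h2, sub_zero, Matrix.smul_apply, Pi.smul_apply, Matrix.one_apply,
              Pi.single_apply]
          rw [h1, h0]
          refine ha _ fun i hi => ?_
          exact Pi.single_eq_of_ne (fun hij => hi (by rw [hij, hj, h0])) _
        · refine hex n hn _ ?_ ?_
          · intro i hi
            have h1 : i ≠ j := fun hij => hi (by rw [hij, hj])
            have h2 : (h * F.d) i j = 0 := by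
              rw [Matrix.mul_apply]
              refine Finset.sum_eq_zero fun k _ => ?_
              by_cases hk : F.d k j = 0
              · rw [hk, mul_zero]
              · have h3 := F.d_deg k j hk
                by_cases hk' : h i k = 0
                · rw [hk', zero_mul]
                · have := hd i k hk'; omega
            simp only [v, Matrix.sub_apply, h2, sub_zero, Matrix.smul_apply, Matrix.one_apply, h1, if_false, smul_zero]
          · funext i
            have h1 : F.D A (v j) i = (F.d * (a • (1 : Matrix F.ι F.ι A) - h * F.d)) i j := by
              rw [mact_apply, Matrix.mul_apply]; rfl
            have h2 : (F.d * h * F.d) i j = a * F.d i j := by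
              have h3 : (F.d * h * F.d) i j = ((a • (1 : Matrix F.ι F.ι A) - h * F.d) * F.d) i j := by
                rw [Matrix.mul_apply, Matrix.mul_apply]
                refine Finset.sum_congr rfl fun k _ => ?_
                by_cases hk : F.d k j = 0
                · rw [hk, mul_zero, mul_zero]
                · have h4 := F.d_deg k j hk
                  have h5 := he i k (by omega)
                  rw [Matrix.add_apply] at h5
                  rw [Matrix.sub_apply, ← h5, add_sub_cancel_right]
              rw [h3, sub_mul, mul_assoc, F.d_sq]; simp
            rw [h1, mul_sub, Matrix.sub_apply, ← mul_assoc, h2]; simp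
      have hw : ∀ j, ∃ w : F.ι → A, F.deg j = n → w ∈ F.supp A (n+1) ∧ F.D A w = v j := by
        intro j
        by_cases hj : F.deg j = n
        · obtain ⟨w, hw, hw'⟩ := hv j hj
          exact ⟨w, fun _ => ⟨hw, hw'⟩⟩
        · exact ⟨0, fun h => absurd h hj⟩
      choose w hw using hw
      obtain ⟨h', hh'⟩ : ∃ h' : Matrix F.ι F.ι A, ∀ i j, h' i j = if F.deg j = n then w j i else h i j :=
        ⟨fun i j => if F.deg j = n then w j i else h i j, fun _ _ => rfl⟩
      refine ⟨h', ?_, ?_⟩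
      · intro i j hij
        rw [hh'] at hij
        by_cases hj : F.deg j = n
        · simp only [hj, if_true] at hij
          by_contra hc
          exact hij ((hw j hj).1 i (by omega))
        · simp only [hj, if_false] at hij
          exact hd i j hij
      · intro i j hj
        have h1 : (h' * F.d) i j = (h * F.d) i j := by
          rw [Matrix.mul_apply, Matrix.mul_apply]
          refine Finset.sum_congr rfl fun k _ => ?_
          by_cases hk : F.d k j = 0
          · rw [hk, mul_zero, mul_zero]
          · have := F.d_deg k j hk
            rw [hh', if_neg (by omega)]
        rw [Matrix.add_apply, h1]
        by_cases hjn : F.deg j = n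
        · have h2 : (F.d * h') i j = v j i := by
            rw [← (hw j hjn).2, mact_apply, Matrix.mul_apply]
            simp only [hh', hjn, if_true, smul_eq_mul]
          rw [h2]
          simp [v]
        · have h2 : (F.d * h') i j = (F.d * h) i j := by
            rw [Matrix.mul_apply, Matrix.mul_apply]
            simp only [hh', hjn, if_false]
          rw [h2, ← Matrix.add_apply]
          exact he i j (by omega)
  obtain ⟨s, hs⟩ : ∃ s, ∀ i, F.deg i ≤ s :=
    ⟨Finset.univ.sup F.deg, fun i => Finset.le_sup (Finset.mem_univ i)⟩
  obtain ⟨h, hd, he⟩ := key (s+1)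
  exact ⟨h, hd, Matrix.ext fun i j => he i j (Nat.lt_succ_of_le (hs j))⟩

lemma ann_le_null {Y : Type} [AddCommGroup Y] [Module A Y] (r : Res F C Y)
    (hC : Function.Bijective (algebraMap A (Module.End A C))) (hQ : Q.Acyc C) :
    Module.annihilator A Y ≤ F.nullIdeal := by
  intro a ha
  refine null_of_exact ?_ a ?_
  · intro j hj z hz hD
    refine bd_ring Q hC hQ r.exact j z fun c => r.exact j hj _ (smul_vec_supp hz c) ?_
    rw [smul_vec_D, hD]
    funext i
    exact zero_smul A c
  · intro z hz
    refine bd_ring Q hC hQ r.exact 0 _ fun c => r.ker' (smul_vec_supp (Submodule.smul_mem _ _ hz) c) ?_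
    have : (fun i => (a • z) i • c) = a • (fun i => z i • c) := by
      funext i; exact mul_smul a (z i) c
    rw [this, map_smul]
    exact Module.mem_annihilator.1 ha _

end FC
end NIT

-- Part 24

namespace NIT
open IsLocalRing FC

section build
variable {A C Y : Type} [CommRing A] [AddCommGroup C] [Module A C] [AddCommGroup Y] [Module A Y]
  (n : ℕ → ℕ)

/-- entries of the total differential -/
def bd_ent (m : ∀ i, Fin (n i) → Fin (n (i+1)) → A) (x y : Σ i : ℕ, Fin (n i)) : A :=
  if h : y.1 = x.1 + 1 then m x.1 x.2 (Fin.cast (by rw [h]) y.2) else 0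

lemma bd_ent_pos (m : ∀ i, Fin (n i) → Fin (n (i+1)) → A) (i : ℕ) (a : Fin (n i)) (b : Fin (n (i+1))) :
    bd_ent n m ⟨i, a⟩ ⟨i+1, b⟩ = m i a b := by
  simp [bd_ent]

lemma bd_ent_neg (m : ∀ i, Fin (n i) → Fin (n (i+1)) → A) {x y : Σ i : ℕ, Fin (n i)} (h : y.1 ≠ x.1 + 1) :
    bd_ent n m x y = 0 := by
  simp [bd_ent, h]

/-- vectors concentrated in one degree -/
def vec (k : ℕ) (u : Fin (n k) → C) (x : Σ i : ℕ, Fin (n i)) : C :=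
  if h : x.1 = k then u (Fin.cast (by rw [h]) x.2) else 0

lemma vec_pos (k : ℕ) (u : Fin (n k) → C) : (fun b => vec n k u ⟨k, b⟩) = u := by
  funext b; simp [vec]

lemma vec_neg (k : ℕ) (u : Fin (n k) → C) {x : Σ i : ℕ, Fin (n i)} (h : x.1 ≠ k) : vec n k u x = 0 := by
  simp [vec, h]

lemma sum_sigma_deg [Fintype (Σ i : ℕ, Fin (n i))] {M : Type} [AddCommMonoid M] (k : ℕ)
    (f : (Σ i : ℕ, Fin (n i)) → M) (hf : ∀ x, x.1 ≠ k → f x = 0) : ∑ x, f x = ∑ b : Fin (n k), f ⟨k, b⟩ := by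
  symm
  refine Finset.sum_of_injOn (fun b : Fin (n k) => (⟨k, b⟩ : Σ i : ℕ, Fin (n i))) ?_ (by simp) ?_ (fun _ _ => rfl)
  · intro b _ b' _ h
    simpa using h
  · rintro ⟨i, b⟩ _ hx
    apply hf
    rintro rfl
    exact hx ⟨b, by simp, rfl⟩

lemma exists_res (hC : Function.Bijective (algebraMap A (Module.End A C))) (s : ℕ)
    (d : ∀ i : ℕ, ((Fin (n (i + 1)) → C) →ₗ[A] (Fin (n i) → C))) (ε : (Fin (n 0) → C) →ₗ[A] Y)
    (hn : ∀ i, s < i → n i = 0) (hε : Function.Surjective ε) (h0 : Function.Exact (d 0) ε)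
    (hd : ∀ i : ℕ, Function.Exact (d (i + 1)) (d i)) : ∃ F : FC A, Nonempty (Res F C Y) := by
  classical
  -- the index type is finite
  have hfin : Finite (Σ i : ℕ, Fin (n i)) := by
    refine Finite.of_injective (β := Σ i : Fin (s+1), Fin (n i)) (fun x => ⟨⟨x.1, ?_⟩, x.2⟩) ?_
    · by_contra hc
      have := hn x.1 (by omega)
      have h2 := x.2.2
      omega
    · rintro ⟨i, a⟩ ⟨j, b⟩ h
      simp only [Sigma.mk.injEq, Fin.mk.injEq] at h
      obtain ⟨rfl, h⟩ := h
      simpa using h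
  letI : Fintype (Σ i : ℕ, Fin (n i)) := Fintype.ofFinite _
  -- matrix entries
  have hm : ∀ i (a : Fin (n i)) (b : Fin (n (i+1))), ∃ r : A, algebraMap A (Module.End A C) r =
      LinearMap.proj a ∘ₗ d i ∘ₗ LinearMap.single A (fun _ => C) b := fun i a b => hC.2 _
  choose m hm using hm
  have hm' : ∀ i a b (c : C), m i a b • c = d i (Pi.single b c) a := fun i a b c => LinearMap.congr_fun (hm i a b) c
  let M : Matrix (Σ i : ℕ, Fin (n i)) (Σ i : ℕ, Fin (n i)) A := bd_ent n m
  have hM : ∀ (z : (Σ i : ℕ, Fin (n i)) → C) i a, mact C M z ⟨i, a⟩ = d i (fun b => z ⟨i+1, b⟩) a := by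
    intro z i a
    rw [mact_apply, sum_sigma_deg n (i+1)]
    · have h1 : (fun b => z ⟨i+1, b⟩) = ∑ b, Pi.single b (z ⟨i+1, b⟩) :=
        (Finset.univ_sum_single (fun b => z ⟨i+1, b⟩)).symm
      rw [h1, map_sum, Finset.sum_apply]
      refine Finset.sum_congr rfl fun b _ => ?_
      rw [← hm']
      change bd_ent n m ⟨i, a⟩ ⟨i+1, b⟩ • _ = _
      rw [bd_ent_pos]
    · intro x hx
      change bd_ent n m ⟨i, a⟩ x • _ = _
      rw [bd_ent_neg n m hx, zero_smul]
  have hMM : ∀ (z : (Σ i : ℕ, Fin (n i)) → C), mact C M (mact C M z) = 0 := by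
    intro z
    funext ⟨i, a⟩
    rw [hM]
    have : (fun b => mact C M z ⟨i+1, b⟩) = d (i+1) (fun b => z ⟨i+1+1, b⟩) := funext fun b => hM z (i+1) b
    rw [this, (hd i).apply_apply_eq_zero]; rfl
  let F : FC A :=
    { ι := Σ i : ℕ, Fin (n i)
      deg := fun x => x.1
      d := M
      d_deg := fun x y h => by
        by_contra hc
        exact h (bd_ent_neg n m hc)
      d_sq := by
        ext x y
        apply hC.1
        ext c
        have h1 : mact C (M * M) (Pi.single y c) x = 0 := by rw [mact_mul, hMM]; rfl
        rw [mact_apply, Finset.sum_eq_single y] at h1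
        · simpa using h1
        · intro k _ hk
          rw [Pi.single_eq_of_ne hk, smul_zero]
        · simp }
  have hvs : ∀ k u, vec n k u ∈ F.supp C k := fun k u x hx => vec_neg n k u hx
  have hvD : ∀ k u, F.D C (vec n (k+1) u) = vec n k (d k u) := by
    intro k u
    funext ⟨i, a⟩
    refine (hM _ i a).trans ?_
    by_cases hi : i = k
    · subst hi
      rw [vec_pos]
      exact (congrFun (vec_pos n i (d i u)) a).symm
    · rw [vec_neg n k _ (x := ⟨i, a⟩) hi]
      have : (fun b => vec n (k+1) u ⟨i+1, b⟩) = 0 := funext fun b => vec_neg n (k+1) u (by simpa using hi)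
      rw [this, map_zero]; rfl
  have hzv : ∀ k (z : F.ι → C), z ∈ F.supp C k → z = vec n k (fun b => z ⟨k, b⟩) := by
    intro k z hz
    funext ⟨i, a⟩
    by_cases hi : i = k
    · subst hi
      exact (congrFun (vec_pos n i (fun b => z ⟨i, b⟩)) a).symm
    · rw [vec_neg n k _ (x := ⟨i, a⟩) hi]
      exact hz _ hi
  let e : F.ι → (C →ₗ[A] Y) := fun x =>
    if h : x.1 = 0 then ε ∘ₗ LinearMap.single A (fun _ => C) (Fin.cast (by rw [h]) x.2) else 0
  have he : ∀ z : F.ι → C, ∑ x, e x (z x) = ε (fun b => z ⟨0, b⟩) := by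
    intro z
    refine (sum_sigma_deg n 0 (fun x => e x (z x)) ?_).trans ?_
    · intro x hx
      simp only [e, dif_neg hx, LinearMap.zero_apply]
    · have h1 : (fun b => z ⟨0, b⟩) = ∑ b, Pi.single b (z ⟨0, b⟩) :=
        (Finset.univ_sum_single (fun b => z ⟨0, b⟩)).symm
      rw [h1, map_sum]
      refine Finset.sum_congr rfl fun b _ => ?_
      simp [e]
  refine ⟨F, ⟨⟨e, ?_, ?_, ?_, ?_⟩⟩⟩
  · intro j hj z hz hD
    obtain ⟨k, rfl⟩ := Nat.exists_eq_succ_of_ne_zero hj.ne'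
    have h1 : d k (fun b => z ⟨k+1, b⟩) = 0 := by
      funext a
      exact (hM z k a).symm.trans (congrFun hD ⟨k, a⟩)
    obtain ⟨u, hu⟩ := (hd k _).1 h1
    refine ⟨vec n (k+1+1) u, hvs _ _, ?_⟩
    rw [hvD, hu]
    exact (hzv (k+1) z hz).symm
  · intro y
    obtain ⟨u, rfl⟩ := hε y
    refine ⟨vec n 0 u, hvs _ _, ?_⟩
    rw [he, vec_pos]
  · intro z hz hez
    rw [he] at hez
    obtain ⟨u, hu⟩ := (h0 _).1 hez
    refine ⟨vec n 1 u, hvs _ _, ?_⟩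
    refine (hvD 0 u).trans ?_
    rw [hu]
    exact (hzv 0 z hz).symm
  · rintro _ ⟨w, hw, rfl⟩
    rw [he]
    have : (fun b => F.D C w ⟨0, b⟩) = d 0 (fun b => w ⟨1, b⟩) := funext fun b => hM w 0 b
    rw [this, h0.apply_apply_eq_zero]

end build
end NIT

-- Part 25

namespace NIT
open IsLocalRing

lemma length_le {A : Type} [CommRing A] [IsNoetherianRing A] [IsLocalRing A] {k : ℕ} (hk : ringKrullDim A = k)
    {rs : List A} (h : RingTheory.Sequence.IsRegular A rs) (hm : ∀ r ∈ rs, r ∈ maximalIdeal A) : rs.length ≤ k := by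
  have h1 := ringKrullDim_add_length_eq_ringKrullDim_of_isRegular rs h
  haveI : Nontrivial (A ⧸ Ideal.ofList rs) := by
    refine Ideal.Quotient.nontrivial_iff.2 (ne_top_of_le_ne_top (maximalIdeal.isMaximal A).ne_top ?_)
    exact Ideal.span_le.2 hm
  have h2 : (0 : WithBot ℕ∞) ≤ ringKrullDim (A ⧸ Ideal.ofList rs) := ringKrullDim_nonneg_of_nontrivial
  rw [hk] at h1
  have h3 : ((rs.length : ℕ) : WithBot ℕ∞) ≤ (k : WithBot ℕ∞) := by
    rw [← h1]; exact le_add_of_nonneg_left h2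
  exact_mod_cast h3

end NIT

open RingTheory.Sequence in
/-- If `C` is semidualizing over the commutative noetherian local ring `A` and `Y` is a
nonzero finitely generated module of finite `C`-dimension, then every `Y`-regular sequence
of elements of the maximal ideal is a regular sequence in `A`, and it extends to a maximal
`C`-regular sequence in the maximal ideal which is also a regular sequence in `A`. -/
theorem regular_sequence_extends
    (A : Type) [CommRing A] [IsNoetherianRing A] [IsLocalRing A]
    (C : Type) [AddCommGroup C] [Module A C] [Module.Finite A C]
    (hC : IsSemidualizing A C)
    (Y : Type) [AddCommGroup Y] [Module A Y] [Module.Finite A Y] [Nontrivial Y]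
    (hY : HasFiniteCDim A C Y)
    (rs : List A) (hrs : ∀ r ∈ rs, r ∈ IsLocalRing.maximalIdeal A)
    (hreg : IsRegular Y rs) :
    IsRegular A rs ∧
    ∃ rs' : List A, (∀ r ∈ rs', r ∈ IsLocalRing.maximalIdeal A) ∧
      IsRegular C (rs ++ rs') ∧
      IsRegular A (rs ++ rs') ∧
      -- maximality of the `C`-regular sequence `rs ++ rs'` in the maximal ideal:
      ∀ y ∈ IsLocalRing.maximalIdeal A, ¬ IsRegular C ((rs ++ rs') ++ [y]) := by
  classical
  obtain ⟨s, n, d, ε, hn, hε, h0, hd⟩ := hY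
  obtain ⟨hEnd, hExt⟩ := hC
  obtain ⟨F, ⟨r⟩⟩ := NIT.exists_res n hEnd s d ε hn hε h0 hd
  let Q := NIT.PRes.of (ProjectiveResolution.of (ModuleCat.of A C))
  have hQ : Q.Acyc C := NIT.acyc_of_ext _ C hExt
  haveI : Nontrivial C := by
    by_contra hc
    rw [not_nontrivial_iff_subsingleton] at hc
    exact zero_ne_one (hEnd.1 (Subsingleton.elim _ _) : (0 : A) = 1)
  have hCA : ∀ l : List A, (∀ r ∈ l, r ∈ IsLocalRing.maximalIdeal A) → IsRegular C l → IsRegular A l := by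
    intro l hl h
    rw [IsLocalRing.isRegular_iff_isWeaklyRegular_of_subset_maximalIdeal hl] at h ⊢
    exact Q.weaklyRegular_ring hEnd hQ l h
  have hCrs : IsRegular C rs := by
    rw [IsLocalRing.isRegular_iff_isWeaklyRegular_of_subset_maximalIdeal hrs] at hreg ⊢
    refine NIT.FC.Res.weaklyRegular F rs hrs C Y r ?_ hreg
    intro q hq _
    rw [Module.support_eq_zeroLocus]
    exact (NIT.FC.ann_le_null Q r hEnd hQ).trans hq
  refine ⟨hCA rs hrs hCrs, ?_⟩
  obtain ⟨k, hk⟩ := NIT.exists_nat_dim A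
  let P : ℕ → Prop := fun t => ∃ rs' : List A, rs'.length = t ∧ (∀ r ∈ rs', r ∈ IsLocalRing.maximalIdeal A) ∧
    IsRegular C (rs ++ rs')
  have hmem : ∀ rs' : List A, (∀ r ∈ rs', r ∈ IsLocalRing.maximalIdeal A) →
      ∀ r ∈ rs ++ rs', r ∈ IsLocalRing.maximalIdeal A := fun rs' h r hr =>
    (List.mem_append.1 hr).elim (hrs r) (h r)
  have hP0 : P 0 := ⟨[], rfl, by simp, by simpa using hCrs⟩
  have hPk : ∀ t, P t → t ≤ k := by
    rintro t ⟨rs', rfl, h1, h2⟩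
    have := NIT.length_le hk (hCA _ (hmem rs' h1) h2) (hmem rs' h1)
    rw [List.length_append] at this
    omega
  obtain ⟨rs', hl, h1, h2⟩ : P (Nat.findGreatest P k) := Nat.findGreatest_spec (Nat.zero_le k) hP0
  refine ⟨rs', h1, h2, hCA _ (hmem rs' h1) h2, fun y hy hyr => ?_⟩
  have hPs : P (rs'.length + 1) := by
    refine ⟨rs' ++ [y], by simp, ?_, by rwa [← List.append_assoc]⟩
    intro r hr
    rcases List.mem_append.1 hr with h | h
    · exact h1 r h
    · rw [List.mem_singleton.1 h]; exact hy
  have := Nat.le_findGreatest (hPk _ hPs) hPs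
  omega
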